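/- Consider on $\mathbb{R}^2$ the inhomogeneous incompressible Navier–Stokes system $$\partial_t\rho+u\cdot\nabla\rho=0,\qquad \rho\,\partial_tu+\rho(u\cdot\nabla)u-\Delta u+\nabla\Pi=0,\qquad \operatorname{div}u=0,\qquad (\rho,u)|_{t=0}=(\rho_0,u_0).$$ There is an increasing function $\mathcal{C}:\mathbb{R}\to\mathbb{R}$ such that the following holds. Let $(\rho,u,\nabla\Pi)$ be a global solution of this system on $[0,\infty)\times\mathbb{R}^2$ such that $\rho-1$, $u$ and $\nabla\Pi$ belong to $C^\infty([0,\infty);H^k(\mathbb{R}^2))$ for every $k\in\mathbb{N}$, and suppose that $\frac34\le\rho_0(x)\le\frac54$ for all $x\in\mathbb{R}^2$. Set $$E_0=\int_{\mathbb{R}^2}\rho_0|u_0|^2\,dx,\qquad E_2(t)=\|\sqrt{\rho}\,\partial_tu(t)\|_{L^2}^2+\|\nabla u(t)\|_{L^2}^4 .$$ Then for every $t_0>0$ and every $t\ge t_0$, $$\|\sqrt{\rho}\,\partial_tu(t)\|_{L^2}^2+\|\nabla^2u(t)\|_{L^2}^2+\|\nabla\Pi(t)\|_{L^2}^2+\int_{t_0}^t\|\nabla\partial_tu(t')\|_{L^2}^2\,dt'\le\mathcal{C}(E_0)\,E_2(t_0).$$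 -/

import Mathlib

open MeasureTheory Set Filter Topology
open scoped ContDiff

noncomputable section

namespace INS2D

/-- The plane `ℝ²` with its Euclidean norm. -/
abbrev Plane : Type := EuclideanSpace ℝ (Fin 2)

section Calculus

variable {F : Type*} [NormedAddCommGroup F] [NormedSpace ℝ F]

/-- The partial derivative `∂ᵢ f` in space. -/
def pd (i : Fin 2) (f : Plane → F) (x : Plane) : F :=
  fderiv ℝ f x (EuclideanSpace.single i 1)

/-- The divergence `∂₁ f¹ + ∂₂ f²` of a vector field. -/
def divergence (f : Plane → Plane) (x : Plane) : ℝ := ∑ i, pd i f x i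

/-- The Laplacian `∂₁² f + ∂₂² f`. -/
def lap (f : Plane → F) (x : Plane) : F := ∑ i, pd i (pd i f) x

/-- The time derivative of a function on `[0, ∞) × ℝ²` (one-sided at `t = 0`). -/
def tderiv (f : ℝ → Plane → F) (t : ℝ) (x : Plane) : F :=
  derivWithin (fun s => f s x) (Ici 0) t

/-- `‖f‖²_{L²}`. -/
def sqL2 (f : Plane → F) : ℝ := ∫ x, ‖f x‖ ^ 2

/-- `‖∇f‖²_{L²}`. -/
def gradSqL2 (f : Plane → F) : ℝ := ∑ i, sqL2 (pd i f)

/-- `‖∇²f‖²_{L²}`. -/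
def hessSqL2 (f : Plane → F) : ℝ := ∑ i, ∑ j, sqL2 (pd i (pd j f))

/-- `f` is smooth in time, on `[0, ∞)`, with values in all Sobolev spaces `Hᵏ(ℝ²)`:
it is smooth on `[0, ∞) × ℝ²`, and every `∇ᵏ ∂ₜʲ f` is a continuous function of `t ∈ [0, ∞)`
with values in `L²(ℝ²)`. -/
structure SmoothSobolev (f : ℝ → Plane → F) : Prop where
  contDiffOn : ContDiffOn ℝ ∞ (fun q : ℝ × Plane => f q.1 q.2) (Ici 0 ×ˢ univ)
  memLp : ∀ (j k : ℕ) (t : ℝ), 0 ≤ t → MemLp (iteratedFDeriv ℝ k (tderiv^[j] f t)) 2 volume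
  continuous : ∀ (j k : ℕ) (t : ℝ), 0 ≤ t →
    Tendsto
      (fun s => eLpNorm (fun x =>
        iteratedFDeriv ℝ k (tderiv^[j] f s) x - iteratedFDeriv ℝ k (tderiv^[j] f t) x) 2 volume)
      (𝓝[Ici 0] t) (𝓝 0)

end Calculus

/-- `(ρ, u, ∇P)` is a smooth global solution of the two-dimensional inhomogeneous incompressible
Navier–Stokes system, `ρ - 1`, `u` and `∇P` being smooth in time with values in all Sobolev
spaces. The initial data are `ρ 0` and `u 0`; values at negative times play no role. -/
structure IsSmoothSolution (ρ : ℝ → Plane → ℝ) (u : ℝ → Plane → Plane)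
    (P : ℝ → Plane → ℝ) : Prop where
  smooth_rho : SmoothSobolev (fun t x => ρ t x - 1)
  smooth_u : SmoothSobolev u
  differentiable_P : ∀ t, 0 ≤ t → Differentiable ℝ (P t)
  smooth_gradP : SmoothSobolev (fun t => gradient (P t))
  mass : ∀ t, 0 ≤ t → ∀ x, tderiv ρ t x + fderiv ℝ (ρ t) x (u t x) = 0
  momentum : ∀ t, 0 ≤ t → ∀ x,
    ρ t x • tderiv u t x + ρ t x • fderiv ℝ (u t) x (u t x) - lap (u t) x
      + gradient (P t) x = 0
  incompressible : ∀ t, 0 ≤ t → ∀ x, divergence (u t) x = 0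

/-- `E₀ = ∫ ρ₀ |u₀|² dx`. -/
def E0 (ρ : ℝ → Plane → ℝ) (u : ℝ → Plane → Plane) : ℝ := ∫ x, ρ 0 x * ‖u 0 x‖ ^ 2

/-- `‖√ρ ∂ₜu(t)‖²_{L²}`. -/
def sqRhoDt (ρ : ℝ → Plane → ℝ) (u : ℝ → Plane → Plane) (t : ℝ) : ℝ :=
  sqL2 (fun x => Real.sqrt (ρ t x) • tderiv u t x)

/-- `E₂(t) = ‖√ρ ∂ₜu(t)‖²_{L²} + ‖∇u(t)‖⁴_{L²}`. -/
def E2 (ρ : ℝ → Plane → ℝ) (u : ℝ → Plane → Plane) (t : ℝ) : ℝ :=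
  sqRhoDt ρ u t + gradSqL2 (u t) ^ 2

end INS2D

end

namespace INS2D

/-! ### Integration on the plane by Fubini -/

/-- The standard basis vector `eᵢ` of the plane. -/
noncomputable abbrev basisVec (i : Fin 2) : Plane := EuclideanSpace.single i (1 : ℝ)

/-- The point of the plane with coordinates `(a, b)`. -/
noncomputable def pt (a b : ℝ) : Plane := !₂[a, b]

theorem pt_eq (a b : ℝ) : pt a b = a • basisVec 0 + b • basisVec 1 := by
  ext i; fin_cases i <;> simp [pt]

theorem pt_coord (x : Plane) : pt (x 0) (x 1) = x := by
  ext i; fin_cases i <;> simp [pt]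

theorem continuous_pt : Continuous fun p : ℝ × ℝ => pt p.1 p.2 := by
  simp only [pt_eq]; fun_prop

theorem measurePreserving_pt :
    MeasurePreserving (fun p : ℝ × ℝ => pt p.1 p.2) volume volume :=
  (PiLp.volume_preserving_toLp (Fin 2)).comp (volume_preserving_finTwoArrow ℝ).symm

theorem measurableEmbedding_pt : MeasurableEmbedding (fun p : ℝ × ℝ => pt p.1 p.2) :=
  ((MeasurableEquiv.toLp 2 (Fin 2 → ℝ)).measurableEmbedding).comp
    (MeasurableEquiv.finTwoArrow (α := ℝ)).symm.measurableEmbedding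

theorem integral_plane (f : Plane → ℝ) : ∫ x, f x = ∫ p : ℝ × ℝ, f (pt p.1 p.2) :=
  (measurePreserving_pt.integral_comp measurableEmbedding_pt f).symm

theorem integrable_plane {f : Plane → ℝ} (hf : Integrable f) :
    Integrable (fun p : ℝ × ℝ => f (pt p.1 p.2)) (volume.prod volume) :=
  (measurePreserving_pt.integrable_comp_emb measurableEmbedding_pt).2 hf

theorem hasDerivAt_pt_left {w : Plane → ℝ} (hw : Differentiable ℝ w) (a b : ℝ) :
    HasDerivAt (fun s => w (pt s b)) (pd 0 w (pt a b)) a := by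
  have h : HasDerivAt (fun s => pt s b) (basisVec 0) a := by
    simp only [pt_eq]
    simpa using ((hasDerivAt_id a).smul_const (basisVec 0)).add_const (b • basisVec 1)
  exact (hw (pt a b)).hasFDerivAt.comp_hasDerivAt a h

theorem hasDerivAt_pt_right {w : Plane → ℝ} (hw : Differentiable ℝ w) (a b : ℝ) :
    HasDerivAt (fun s => w (pt a s)) (pd 1 w (pt a b)) b := by
  have h : HasDerivAt (fun s => pt a s) (basisVec 1) b := by
    simp only [pt_eq]
    simpa using ((hasDerivAt_id b).smul_const (basisVec 1)).const_add (a • basisVec 0)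
  exact (hw (pt a b)).hasFDerivAt.comp_hasDerivAt b h

theorem integrable_add {f g : Plane → ℝ} (hf : Integrable f) (hg : Integrable g) :
    Integrable fun x => f x + g x :=
  hf.add hg

theorem integrable_mul {f g : Plane → ℝ} (hf : MemLp f 2) (hg : MemLp g 2) :
    Integrable fun x => f x * g x :=
  hf.integrable_mul hg

theorem abs_le_integral_abs_deriv {h h' : ℝ → ℝ} (hd : ∀ x, HasDerivAt h (h' x) x)
    (hi : Integrable h) (hi' : Integrable h') (x : ℝ) : |h x| ≤ ∫ s, |h' s| := by
  have h0 := tendsto_zero_of_hasDerivAt_of_integrableOn_Iic (a := x) (fun y _ => hd y)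
    hi'.integrableOn hi.integrableOn
  have h1 := integral_Iic_of_hasDerivAt_of_tendsto' (a := x) (fun y _ => hd y)
    hi'.integrableOn h0
  rw [sub_zero] at h1
  rw [← h1]
  refine (abs_integral_le_integral_abs).trans ?_
  exact setIntegral_le_integral hi'.abs (Eventually.of_forall fun _ => abs_nonneg _)

theorem contDiff_pd {F : Type*} [NormedAddCommGroup F] [NormedSpace ℝ F] {w : Plane → F}
    {m n : ℕ∞ω} (hw : ContDiff ℝ n w) (hmn : m + 1 ≤ n)
    (i : Fin 2) : ContDiff ℝ m (pd i w) :=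
  (hw.fderiv_right hmn).clm_apply contDiff_const

theorem ae_abs_le_integral_pd_zero {w : Plane → ℝ} (hw : Differentiable ℝ w)
    (h0 : Integrable w) (h1 : Integrable (pd 0 w)) :
    ∀ᵐ b : ℝ, ∀ a, |w (pt a b)| ≤ ∫ s, |pd 0 w (pt s b)| := by
  filter_upwards [(integrable_plane h0).prod_left_ae, (integrable_plane h1).prod_left_ae]
    with b hb hb' a
  exact abs_le_integral_abs_deriv (fun s => hasDerivAt_pt_left hw s b) hb hb' a

theorem ae_abs_le_integral_pd_one {w : Plane → ℝ} (hw : Differentiable ℝ w)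
    (h0 : Integrable w) (h1 : Integrable (pd 1 w)) :
    ∀ᵐ a : ℝ, ∀ b, |w (pt a b)| ≤ ∫ s, |pd 1 w (pt a s)| := by
  filter_upwards [(integrable_plane h0).prod_right_ae, (integrable_plane h1).prod_right_ae]
    with a ha ha' b
  exact abs_le_integral_abs_deriv (fun s => hasDerivAt_pt_right hw a s) ha ha' b

/-- A `W^{2,1}` function on the plane is bounded by the `L¹` norm of its mixed derivative. -/
theorem abs_le_integral_pd_pd {w : Plane → ℝ} (hw : ContDiff ℝ 2 w) (h0 : Integrable w)
    (h1 : Integrable (pd 0 w)) (h2 : Integrable (pd 1 (pd 0 w))) (x : Plane) :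
    |w x| ≤ ∫ y, |pd 1 (pd 0 w) y| := by
  have hw1 : ContDiff ℝ 1 (pd 0 w) := contDiff_pd hw (by norm_num) 0
  have hwd := hw.differentiable (by norm_num)
  have hE : ∫ y, |pd 1 (pd 0 w) y| = ∫ s, ∫ r, |pd 1 (pd 0 w) (pt s r)| := by
    rw [integral_plane fun y => |pd 1 (pd 0 w) y|]
    exact integral_prod _ (integrable_plane h2).abs
  have key : ∀ᵐ b : ℝ, |w (pt (x 0) b)| ≤ ∫ y, |pd 1 (pd 0 w) y| := by
    filter_upwards [ae_abs_le_integral_pd_zero hwd h0 h1, (integrable_plane h1).prod_left_ae]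
      with b hb hb'
    refine (hb (x 0)).trans ?_
    rw [hE]
    refine integral_mono_ae hb'.abs (integrable_plane h2).abs.integral_prod_left ?_
    filter_upwards [ae_abs_le_integral_pd_one (hw1.differentiable (by norm_num)) h1 h2] with s hs
    exact hs b
  have hcl : IsClosed {b : ℝ | |w (pt (x 0) b)| ≤ ∫ y, |pd 1 (pd 0 w) y|} := by
    refine isClosed_le (Continuous.abs ?_) continuous_const
    exact hw.continuous.comp (continuous_pt.comp (by fun_prop : Continuous fun b : ℝ => (x 0, b)))
  have := (hcl.closure_eq ▸ (Measure.dense_of_ae key).closure_eq : _ = univ)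
  have h := this.symm ▸ mem_univ (x 1)
  simpa [pt_coord] using h

/-- The Gagliardo–Nirenberg inequality `‖w‖₂² ≤ ‖∂₁w‖₁ ‖∂₂w‖₁` on the plane. -/
theorem integral_sq_le_integral_pd_mul {w : Plane → ℝ} (hw : Differentiable ℝ w)
    (h : Integrable w) (h0 : Integrable (pd 0 w)) (h1 : Integrable (pd 1 w)) :
    ∫ x, w x ^ 2 ≤ (∫ x, |pd 0 w x|) * ∫ x, |pd 1 w x| := by
  set A : ℝ → ℝ := fun b => ∫ s, |pd 0 w (pt s b)| with hA
  set B : ℝ → ℝ := fun a => ∫ s, |pd 1 w (pt a s)| with hB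
  have hAi : Integrable A := (integrable_plane h0).abs.integral_prod_right
  have hBi : Integrable B := (integrable_plane h1).abs.integral_prod_left
  have eA : ∫ x, |pd 0 w x| = ∫ b, A b := by
    rw [integral_plane fun y => |pd 0 w y|]
    exact integral_prod_symm _ (integrable_plane h0).abs
  have eB : ∫ x, |pd 1 w x| = ∫ b, B b := by
    rw [integral_plane fun y => |pd 1 w y|]
    exact integral_prod _ (integrable_plane h1).abs
  rw [integral_plane fun x => w x ^ 2, eA, eB, mul_comm]
  rw [show (volume : Measure (ℝ × ℝ)) = volume.prod volume from rfl, ← integral_prod_mul]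
  refine integral_mono_of_nonneg (Eventually.of_forall fun _ => sq_nonneg _)
    (hBi.mul_prod hAi) ?_
  have hA2 := Measure.quasiMeasurePreserving_snd (μ := (volume : Measure ℝ))
    (ν := (volume : Measure ℝ)) |>.ae (ae_abs_le_integral_pd_zero hw h h0)
  have hB2 := Measure.quasiMeasurePreserving_fst (μ := (volume : Measure ℝ))
    (ν := (volume : Measure ℝ)) |>.ae (ae_abs_le_integral_pd_one hw h h1)
  filter_upwards [hA2, hB2] with p hp hq
  have e1 := hp p.1
  have e2 := hq p.2
  calc w (pt p.1 p.2) ^ 2 = |w (pt p.1 p.2)| * |w (pt p.1 p.2)| := by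
        rw [← sq, sq_abs]
    _ ≤ B p.1 * A p.2 := mul_le_mul e2 e1 (abs_nonneg _) ((abs_nonneg _).trans e2)

theorem integral_pd_eq_zero {w : Plane → ℝ} (hw : Differentiable ℝ w) (i : Fin 2)
    (h : Integrable w) (h' : Integrable (pd i w)) : ∫ x, pd i w x = 0 := by
  have := integral_mul_fderiv_eq_neg_fderiv_mul_of_integrable (μ := (volume : Measure Plane))
    (f := fun _ : Plane => (1 : ℝ)) (g := w) (v := basisVec i) (by simp)
    (by simp only [one_mul]; exact h') (by simpa using h) (by fun_prop) (fun x _ => hw x)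
  simp only [pd]
  simpa using this

/-! ### Functions of time and space -/

theorem integrable_prod_of_bounded {K : ℝ → Plane → ℝ} {a b : ℝ}
    (hK : ContinuousOn (fun q : ℝ × Plane => K q.1 q.2) (Icc a b ×ˢ univ)) {M : ℝ}
    (hM : ∀ t ∈ Icc a b, Integrable (K t) ∧ ∫ x, |K t x| ≤ M) :
    Integrable (fun q : ℝ × Plane => K q.1 q.2) ((volume.restrict (Ioc a b)).prod volume) := by
  have hm : AEStronglyMeasurable (fun q : ℝ × Plane => K q.1 q.2)
      ((volume.restrict (Ioc a b)).prod volume) := by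
    have e : ((volume.restrict (Ioc a b)).prod (volume : Measure Plane))
        = ((volume : Measure ℝ).prod (volume : Measure Plane)).restrict (Ioc a b ×ˢ univ) := by
      rw [← Measure.prod_restrict, Measure.restrict_univ]
    rw [e]
    exact (hK.mono (prod_mono Ioc_subset_Icc_self subset_rfl)).aestronglyMeasurable
      (measurableSet_Ioc.prod MeasurableSet.univ)
  rw [integrable_prod_iff hm]
  constructor
  · filter_upwards [ae_restrict_mem measurableSet_Ioc] with t ht
    exact (hM t (Ioc_subset_Icc_self ht)).1
  · refine Integrable.of_bound hm.norm.integral_prod_right' M ?_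
    filter_upwards [ae_restrict_mem measurableSet_Ioc] with t ht
    rw [Real.norm_eq_abs, abs_of_nonneg (integral_nonneg fun _ => norm_nonneg _)]
    exact (hM t (Ioc_subset_Icc_self ht)).2

theorem intervalIntegrable_integral {K : ℝ → Plane → ℝ} {a b : ℝ} (hab : a ≤ b)
    (hK : ContinuousOn (fun q : ℝ × Plane => K q.1 q.2) (Icc a b ×ˢ univ)) {M : ℝ}
    (hM : ∀ t ∈ Icc a b, Integrable (K t) ∧ ∫ x, |K t x| ≤ M) :
    IntervalIntegrable (fun t => ∫ x, K t x) volume a b :=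
  (intervalIntegrable_iff_integrableOn_Ioc_of_le hab).2
    (integrable_prod_of_bounded hK hM).integral_prod_left

theorem integral_sub_eq_of_hasDerivAt {F K : ℝ → Plane → ℝ} {a b : ℝ} (hab : a ≤ b)
    (hF : ∀ x, ContinuousOn (fun t => F t x) (Icc a b))
    (hFK : ∀ x, ∀ t ∈ Ioo a b, HasDerivAt (fun s => F s x) (K t x) t)
    (hK : ContinuousOn (fun q : ℝ × Plane => K q.1 q.2) (Icc a b ×ˢ univ)) {M : ℝ}
    (hM : ∀ t ∈ Icc a b, Integrable (K t) ∧ ∫ x, |K t x| ≤ M)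
    (ha : Integrable (F a)) (hb : Integrable (F b)) :
    (∫ x, F b x) - ∫ x, F a x = ∫ t in a..b, ∫ x, K t x := by
  have hI := integrable_prod_of_bounded hK hM
  rw [← integral_sub hb ha]
  rw [intervalIntegral_integral_swap (by rw [uIoc_of_le hab]; exact hI)]
  refine integral_congr_ae (Eventually.of_forall fun x => ?_)
  have hc : ContinuousOn (fun t => K t x) (Icc a b) :=
    hK.comp (by fun_prop : Continuous fun t : ℝ => (t, x)).continuousOn fun t ht => ⟨ht, mem_univ _⟩
  exact (intervalIntegral.integral_eq_sub_of_hasDerivAt_of_le hab (hF x) (hFK x)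
    (hc.intervalIntegrable_of_Icc hab)).symm

/-! ### Orthogonality of curl free and divergence free fields -/

theorem tendsto_integral_indicator_zero {f : Plane → ℝ} (hf : Integrable f) {S : ℕ → Set Plane}
    (hS : ∀ n, MeasurableSet (S n)) (hS' : ∀ x, ∀ᶠ n in atTop, x ∉ S n) :
    Tendsto (fun n => ∫ x, (S n).indicator f x) atTop (𝓝 0) := by
  have : Tendsto (fun n => ∫ x, (S n).indicator f x) atTop (𝓝 (∫ _ : Plane, (0 : ℝ))) := by
    refine tendsto_integral_of_dominated_convergence (fun x => ‖f x‖)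
      (fun n => (hf.indicator (hS n)).aestronglyMeasurable) hf.norm
      (fun n => Eventually.of_forall fun x => norm_indicator_le_norm_self _ _)
      (Eventually.of_forall fun x => ?_)
    refine tendsto_const_nhds.congr' ?_
    filter_upwards [hS' x] with n hn
    simp [hn]
  simpa using this

/-- Translates of a square integrable function tend weakly to zero. -/
theorem tendsto_integral_translate_mul {f h : Plane → ℝ} (hf : MemLp f 2) (hh : MemLp h 2) :
    Tendsto (fun n : ℕ => ∫ x, f (x + (2 * n : ℝ) • basisVec 0) * h x) atTop (𝓝 0) := by
  have hf2 := hf.integrable_sq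
  have hh2 := hh.integrable_sq
  have c0 : Continuous fun x : Plane => x 0 := by fun_prop
  set S : ℕ → Set Plane := fun n => {x | (n : ℝ) < x 0} with hS
  set R : ℕ → Set Plane := fun n => {x | x 0 ≤ -(n : ℝ)} with hR
  have hSm : ∀ n, MeasurableSet (S n) := fun n =>
    (isOpen_lt continuous_const c0).measurableSet
  have hRm : ∀ n, MeasurableSet (R n) := fun n =>
    (isClosed_le c0 continuous_const).measurableSet
  have t1 := tendsto_integral_indicator_zero hf2 hSm fun x => by
    obtain ⟨N, hN⟩ := exists_nat_ge (x 0)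
    filter_upwards [eventually_ge_atTop N] with n hn
    have : (N : ℝ) ≤ n := by exact_mod_cast hn
    simp only [hS, mem_ofPred_eq, not_lt]; linarith
  have t2 := tendsto_integral_indicator_zero hh2 hRm fun x => by
    obtain ⟨N, hN⟩ := exists_nat_gt (-x 0)
    filter_upwards [eventually_ge_atTop N] with n hn
    have : (N : ℝ) ≤ n := by exact_mod_cast hn
    simp only [hR, mem_ofPred_eq, not_le]; linarith
  set L := (∫ x, f x ^ 2) + ∫ x, h x ^ 2 with hL
  have hL0 : 0 ≤ L := add_nonneg (integral_nonneg fun _ => sq_nonneg _)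
    (integral_nonneg fun _ => sq_nonneg _)
  have bound : ∀ K : ℝ, 0 < K → ∀ n : ℕ, |∫ x, f (x + (2 * n : ℝ) • basisVec 0) * h x| ≤
      K * ((∫ x, (S n).indicator (fun x => f x ^ 2) x)
        + ∫ x, (R n).indicator (fun x => h x ^ 2) x) + L / K := by
    intro K hK n
    set e : Plane := (2 * n : ℝ) • basisVec 0 with he
    have i1 := ((hf2.indicator (hSm n)).comp_add_right e).const_mul K
    have i2 := (hh2.indicator (hRm n)).const_mul K
    have i3 := (hf2.comp_add_right e).const_mul K⁻¹
    have i4 := hh2.const_mul K⁻¹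
    have e1 : ∫ x, (S n).indicator (fun x => f x ^ 2) (x + e)
        = ∫ x, (S n).indicator (fun x => f x ^ 2) x := integral_add_right_eq_self _ e
    have e3 : ∫ x, f (x + e) ^ 2 = ∫ x, f x ^ 2 :=
      integral_add_right_eq_self (fun x => f x ^ 2) e
    have : K * ((∫ x, (S n).indicator (fun x => f x ^ 2) x)
        + ∫ x, (R n).indicator (fun x => h x ^ 2) x) + L / K
        = ∫ x, ((K * (S n).indicator (fun x => f x ^ 2) (x + e)
          + K * (R n).indicator (fun x => h x ^ 2) x)
          + (K⁻¹ * f (x + e) ^ 2 + K⁻¹ * h x ^ 2)) := by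
      rw [integral_add (integrable_add i1 i2) (integrable_add i3 i4), integral_add i1 i2, integral_add i3 i4,
        integral_const_mul, integral_const_mul, integral_const_mul, integral_const_mul, e1, e3, hL]
      field_simp
    rw [this]
    refine abs_integral_le_integral_abs.trans
      (integral_mono_of_nonneg (Eventually.of_forall fun _ => abs_nonneg _)
        ((i1.add i2).add (i3.add i4)) (Eventually.of_forall fun x => ?_))
    beta_reduce
    have young : ∀ p q : ℝ, |p * q| ≤ K * p ^ 2 + K⁻¹ * q ^ 2 := by
      intro p q
      have : K * p ^ 2 + K⁻¹ * q ^ 2 - 2 * (|p| * |q|) = K⁻¹ * (K * |p| - |q|) ^ 2 := by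
        have a1 := sq_abs p
        have a2 := sq_abs q
        rw [← a1, ← a2]; field_simp; ring
      have h2 : 0 ≤ K⁻¹ * (K * |p| - |q|) ^ 2 := by positivity
      rw [abs_mul]
      nlinarith [abs_nonneg p, abs_nonneg q, mul_nonneg (abs_nonneg p) (abs_nonneg q)]
    have hKi : 0 < K⁻¹ := inv_pos.2 hK
    have g1 : 0 ≤ (S n).indicator (fun x => f x ^ 2) (x + e) :=
      indicator_nonneg (fun _ _ => sq_nonneg _) _
    have g2 : 0 ≤ (R n).indicator (fun x => h x ^ 2) x :=
      indicator_nonneg (fun _ _ => sq_nonneg _) _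
    by_cases hx : x 0 ≤ -(n : ℝ)
    · have : x ∈ R n := hx
      rw [indicator_of_mem this]
      have := young (h x) (f (x + e))
      rw [mul_comm] at this
      nlinarith [mul_nonneg hK.le g1, mul_nonneg hKi.le (sq_nonneg (h x))]
    · have hm : x + e ∈ S n := by
        simp only [hS, mem_ofPred_eq, he]
        simp
        linarith
      rw [indicator_of_mem hm]
      have := young (f (x + e)) (h x)
      nlinarith [mul_nonneg hK.le g2, mul_nonneg hKi.le (sq_nonneg (f (x + e)))]
  rw [Metric.tendsto_atTop']
  intro ε hε
  set K := 2 * (L + 1) / ε with hK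
  have hKp : 0 < K := by positivity
  have t3 := (t1.add t2).const_mul K
  simp only [add_zero, mul_zero] at t3
  have := (tendsto_order.1 t3).2 (ε / 2) (by positivity)
  obtain ⟨N, hN⟩ := eventually_atTop.1 this
  refine ⟨N, fun n hn => ?_⟩
  rw [Real.dist_0_eq_abs]
  have b := bound K hKp n
  have c := hN n hn.le
  have : L / K < ε / 2 := by
    rw [div_lt_iff₀ hKp, hK]
    have : ε / 2 * (2 * (L + 1) / ε) = L + 1 := by field_simp
    linarith
  linarith

theorem pd_comp_add {w : Plane → ℝ} (i : Fin 2) (c x : Plane) :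
    pd i (fun y => w (y + c)) x = pd i w (x + c) := by
  simp [pd, fderiv_comp_add_right]

theorem pd_mul {f g : Plane → ℝ} {x : Plane} (hf : DifferentiableAt ℝ f x)
    (hg : DifferentiableAt ℝ g x) (i : Fin 2) :
    pd i (fun y => f y * g y) x = pd i f x * g x + f x * pd i g x := by
  simp only [pd]
  rw [fderiv_fun_mul hf hg]
  simp; ring

theorem integral_pd_mul {f g : Plane → ℝ} (hf : Differentiable ℝ f) (hg : Differentiable ℝ g)
    (i : Fin 2) (h1 : MemLp f 2) (h2 : MemLp g 2) (h3 : MemLp (pd i f) 2) (h4 : MemLp (pd i g) 2) :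
    ∫ x, pd i f x * g x = - ∫ x, f x * pd i g x := by
  have i1 : Integrable (fun x => pd i f x * g x) := h3.integrable_mul h2
  have i2 : Integrable (fun x => f x * pd i g x) := h1.integrable_mul h4
  have i3 : Integrable (fun x => f x * g x) := h1.integrable_mul h2
  have := integral_mul_fderiv_eq_neg_fderiv_mul_of_integrable (μ := (volume : Measure Plane))
    (f := f) (g := g) (v := basisVec i) i1 i2 i3 (fun x _ => hf x) (fun x _ => hg x)
  simp only [pd]
  linarith

theorem memLp_comp_add {f : Plane → ℝ} (hf : MemLp f 2) (c : Plane) :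
    MemLp (fun x => f (x + c)) 2 :=
  hf.comp_measurePreserving (measurePreserving_add_right volume c)

/-- A curl free field is orthogonal to a divergence free field in `L²`. -/
theorem integral_curlFree_mul_divFree {g v : Fin 2 → Plane → ℝ} (hg : ∀ i, ContDiff ℝ 1 (g i))
    (hv : ∀ i, ContDiff ℝ 1 (v i)) (hg2 : ∀ i, MemLp (g i) 2) (hv2 : ∀ i, MemLp (v i) 2)
    (hg3 : ∀ i j, MemLp (pd i (g j)) 2) (hv3 : ∀ i j, MemLp (pd i (v j)) 2)
    (hcurl : ∀ x, pd 0 (g 1) x = pd 1 (g 0) x) (hdiv : ∀ x, pd 0 (v 0) x + pd 1 (v 1) x = 0) :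
    ∫ x, (g 0 x * v 0 x + g 1 x * v 1 x) = 0 := by
  have hgd := fun i => (hg i).differentiable (by norm_num)
  have hvd := fun i => (hv i).differentiable (by norm_num)
  set T : ℝ → Plane → Plane := fun s x => x + s • basisVec 0 with hT
  set F : ℝ → Plane → ℝ := fun s x => g 0 (T s x) * v 0 x + g 1 (T s x) * v 1 x with hF
  set K : ℝ → Plane → ℝ :=
    fun s x => pd 0 (g 0) (T s x) * v 0 x + pd 0 (g 1) (T s x) * v 1 x with hK
  have cT : Continuous fun q : ℝ × Plane => T q.1 q.2 := by simp only [hT]; fun_prop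
  have cpd : ∀ i j, Continuous (pd i (g j)) := fun i j =>
    (contDiff_pd (hg j) (m := 0) (by norm_num) i).continuous
  have cK : Continuous fun q : ℝ × Plane => K q.1 q.2 :=
    (((cpd 0 0).comp cT).mul ((hv 0).continuous.comp continuous_snd)).add
      (((cpd 0 1).comp cT).mul ((hv 1).continuous.comp continuous_snd))
  have iF : ∀ s, Integrable (F s) := fun s =>
    ((memLp_comp_add (hg2 0) _).integrable_mul (hv2 0)).add
      ((memLp_comp_add (hg2 1) _).integrable_mul (hv2 1))
  have iK : ∀ s, Integrable (K s) := fun s =>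
    ((memLp_comp_add (hg3 0 0) _).integrable_mul (hv2 0)).add
      ((memLp_comp_add (hg3 0 1) _).integrable_mul (hv2 1))
  have zK : ∀ s, ∫ x, K s x = 0 := by
    intro s
    have e : ∀ x, K s x = pd 0 (fun y => g 0 (y + s • basisVec 0)) x * v 0 x
        + pd 1 (fun y => g 0 (y + s • basisVec 0)) x * v 1 x := by
      intro x; simp only [hK, hT, pd_comp_add, hcurl]
    have m : ∀ i, MemLp (pd i (fun y => g 0 (y + s • basisVec 0))) 2 := by
      intro i
      have : pd i (fun y => g 0 (y + s • basisVec 0)) = fun x => pd i (g 0) (x + s • basisVec 0) := by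
        ext x; exact pd_comp_add i _ x
      rw [this]; exact memLp_comp_add (hg3 i 0) _
    have dT : Differentiable ℝ (fun y => g 0 (y + s • basisVec 0)) :=
      (hgd 0).comp (by fun_prop)
    simp only [e]
    rw [integral_add (integrable_mul (m 0) (hv2 0)) (integrable_mul (m 1) (hv2 1)),
      integral_pd_mul dT (hvd 0) 0 (memLp_comp_add (hg2 0) _) (hv2 0) (m 0) (hv3 0 0),
      integral_pd_mul dT (hvd 1) 1 (memLp_comp_add (hg2 0) _) (hv2 1) (m 1) (hv3 1 1),
      ← neg_add, ← integral_add (integrable_mul (memLp_comp_add (hg2 0) _) (hv3 0 0))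
        (integrable_mul (memLp_comp_add (hg2 0) _) (hv3 1 1))]
    simp only [← mul_add, hdiv, mul_zero, integral_zero, neg_zero]
  have sqint : ∀ s, ∫ x, |K s x| ≤ (∫ x, pd 0 (g 0) x ^ 2) + (∫ x, v 0 x ^ 2)
      + ((∫ x, pd 0 (g 1) x ^ 2) + ∫ x, v 1 x ^ 2) := by
    intro s
    have j : ∀ i, Integrable fun x => pd 0 (g i) (T s x) ^ 2 := fun i =>
      (memLp_comp_add (hg3 0 i) _).integrable_sq
    have ej : ∀ i, ∫ x, pd 0 (g i) (T s x) ^ 2 = ∫ x, pd 0 (g i) x ^ 2 := fun i =>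
      integral_add_right_eq_self (fun x => pd 0 (g i) x ^ 2) _
    rw [← ej 0, ← ej 1, ← integral_add (j 0) (hv2 0).integrable_sq,
      ← integral_add (j 1) (hv2 1).integrable_sq, ← integral_add
        (integrable_add (j 0) (hv2 0).integrable_sq) (integrable_add (j 1) (hv2 1).integrable_sq)]
    refine integral_mono (iK s).abs (((j 0).add (hv2 0).integrable_sq).add
      ((j 1).add (hv2 1).integrable_sq)) fun x => ?_
    simp only [hK]
    rw [abs_le]
    constructor <;> nlinarith [sq_nonneg (pd 0 (g 0) (T s x) - v 0 x),
      sq_nonneg (pd 0 (g 0) (T s x) + v 0 x), sq_nonneg (pd 0 (g 1) (T s x) - v 1 x),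
      sq_nonneg (pd 0 (g 1) (T s x) + v 1 x), sq_nonneg (v 0 x), sq_nonneg (v 1 x),
      sq_nonneg (pd 0 (g 0) (T s x)), sq_nonneg (pd 0 (g 1) (T s x))]
  have hder : ∀ x s, HasDerivAt (fun s => F s x) (K s x) s := by
    intro x s
    have hTd : HasDerivAt (fun s => T s x) (basisVec 0) s := by
      simpa [hT] using ((hasDerivAt_id s).smul_const (basisVec 0)).const_add x
    have hc : ∀ i, HasDerivAt (fun s => g i (T s x)) (pd 0 (g i) (T s x)) s := fun i =>
      (hgd i (T s x)).hasFDerivAt.comp_hasDerivAt s hTd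
    exact ((hc 0).mul_const (v 0 x)).add ((hc 1).mul_const (v 1 x))
  have const : ∀ n : ℕ, ∫ x, F (2 * n) x = ∫ x, F 0 x := by
    intro n
    have := integral_sub_eq_of_hasDerivAt (a := 0) (b := 2 * n) (by positivity)
      (fun x => (continuous_iff_continuousAt.2 fun s => (hder x s).continuousAt).continuousOn)
      (fun x t _ => hder x t) cK.continuousOn (fun t _ => ⟨iK t, sqint t⟩) (iF 0) (iF _)
    simp only [zK, intervalIntegral.integral_zero] at this
    linarith
  have lim : Tendsto (fun n : ℕ => ∫ x, F (2 * n) x) atTop (𝓝 0) := by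
    have := (tendsto_integral_translate_mul (hg2 0) (hv2 0)).add
      (tendsto_integral_translate_mul (hg2 1) (hv2 1))
    rw [add_zero] at this
    refine this.congr fun n => ?_
    rw [← integral_add (integrable_mul (memLp_comp_add (hg2 0) _) (hv2 0))
      (integrable_mul (memLp_comp_add (hg2 1) _) (hv2 1))]
  simp only [const] at lim
  have := tendsto_nhds_unique lim tendsto_const_nhds
  simpa [hF, hT] using this.symm

/-! ### Differentiation in time and space on `[0, ∞) × ℝ²` -/

section Operators

variable {F : Type*} [NormedAddCommGroup F] [NormedSpace ℝ F]

/-- The set `[0, ∞) × ℝ²`. -/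
def slab : Set (ℝ × Plane) := Ici 0 ×ˢ univ

/-- The first order operators: `∂ₜ` for `none`, and `∂ᵢ` for `some i`. -/
noncomputable def op : Option (Fin 2) → (ℝ → Plane → F) → ℝ → Plane → F
  | none, f => tderiv f
  | some i, f => fun t => pd i (f t)

/-- The vector in the direction of which `op o` differentiates. -/
noncomputable def dir : Option (Fin 2) → ℝ × Plane
  | none => (1, 0)
  | some i => (0, basisVec i)

/-- `f` is smooth on `[0, ∞) × ℝ²`. -/
def Sm (f : ℝ → Plane → F) : Prop := ContDiffOn ℝ ∞ (fun q : ℝ × Plane => f q.1 q.2) slab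

theorem uniqueDiffOn_slab : UniqueDiffOn ℝ slab := (uniqueDiffOn_Ici 0).prod uniqueDiffOn_univ

theorem mem_slab {t : ℝ} (ht : 0 ≤ t) (x : Plane) : (t, x) ∈ slab := ⟨ht, mem_univ _⟩

theorem closure_interior_slab {q : ℝ × Plane} (hq : q ∈ slab) : q ∈ closure (interior slab) := by
  have h : interior slab = Ioi (0 : ℝ) ×ˢ (univ : Set Plane) := by
    rw [slab, interior_prod_eq, interior_Ici, interior_univ]
  rw [h, closure_prod_eq, closure_Ioi, closure_univ]
  exact hq

variable {f g : ℝ → Plane → F} {t : ℝ}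

theorem Sm.hasFDerivWithinAt (hf : Sm f) (ht : 0 ≤ t) (x : Plane) :
    HasFDerivWithinAt (fun q : ℝ × Plane => f q.1 q.2)
      (fderivWithin ℝ (fun q : ℝ × Plane => f q.1 q.2) slab (t, x)) slab (t, x) :=
  ((hf.differentiableOn (by simp)) (t, x) (mem_slab ht x)).hasFDerivWithinAt

theorem Sm.contDiff (hf : Sm f) (ht : 0 ≤ t) : ContDiff ℝ ∞ (f t) := by
  rw [← contDiffOn_univ]
  exact hf.comp (f := fun x : Plane => (t, x)) (by fun_prop) fun x _ => mem_slab ht x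

theorem Sm.continuousOn (hf : Sm f) : ContinuousOn (fun q : ℝ × Plane => f q.1 q.2) slab :=
  ContDiffOn.continuousOn hf

theorem Sm.hasDerivWithinAt_tderiv_aux (hf : Sm f) (ht : 0 ≤ t) (x : Plane) :
    HasDerivWithinAt (fun s => f s x)
      (fderivWithin ℝ (fun q : ℝ × Plane => f q.1 q.2) slab (t, x) (1, 0)) (Ici 0) t := by
  have h1 : HasDerivWithinAt (fun s : ℝ => (s, x)) ((1 : ℝ), (0 : Plane)) (Ici 0) t :=
    (hasDerivWithinAt_id t _).prodMk (hasDerivWithinAt_const t _ x)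
  exact (hf.hasFDerivWithinAt ht x).comp_hasDerivWithinAt t h1 fun s hs => mem_slab hs x

theorem Sm.op_eq (hf : Sm f) (o : Option (Fin 2)) (ht : 0 ≤ t) (x : Plane) :
    op o f t x = fderivWithin ℝ (fun q : ℝ × Plane => f q.1 q.2) slab (t, x) (dir o) := by
  cases o with
  | none =>
    exact (hf.hasDerivWithinAt_tderiv_aux ht x).derivWithin ((uniqueDiffOn_Ici 0) t ht)
  | some i =>
    have h1 : HasFDerivWithinAt (fun y : Plane => (t, y))
        (ContinuousLinearMap.inr ℝ ℝ Plane) univ x :=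
      ((hasFDerivAt_prodMk_right t x)).hasFDerivWithinAt
    have h2 := (hf.hasFDerivWithinAt ht x).comp x h1 fun y _ => mem_slab ht y
    rw [hasFDerivWithinAt_univ] at h2
    have h3 : fderiv ℝ (f t) x = _ := h2.fderiv
    simp [op, pd, h3, dir]

theorem Sm.hasDerivWithinAt_tderiv (hf : Sm f) (ht : 0 ≤ t) (x : Plane) :
    HasDerivWithinAt (fun s => f s x) (tderiv f t x) (Ici 0) t := by
  have := hf.hasDerivWithinAt_tderiv_aux ht x
  have e := hf.op_eq none ht x
  simp only [op, dir] at e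
  rwa [e]

theorem Sm.congr (hf : Sm f) (h : ∀ t, 0 ≤ t → f t = g t) : Sm g :=
  ContDiffOn.congr hf fun q hq => by rw [h q.1 hq.1]

theorem Sm.op (hf : Sm f) (o : Option (Fin 2)) : Sm (op o f) := by
  have h : ContDiffOn ℝ ∞ (fun q => fderivWithin ℝ (fun q : ℝ × Plane => f q.1 q.2) slab q (dir o))
      slab :=
    (ContDiffOn.fderivWithin hf uniqueDiffOn_slab (by simp)).clm_apply contDiffOn_const
  exact h.congr fun q hq => hf.op_eq o hq.1 q.2

theorem op_congr (h : ∀ t, 0 ≤ t → f t = g t) (o : Option (Fin 2)) (t : ℝ) (ht : 0 ≤ t) :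
    op o f t = op o g t := by
  cases o with
  | none =>
    ext x
    exact derivWithin_congr (fun s hs => by rw [h s hs]) (by rw [h t ht])
  | some i => simp only [op, h t ht]

theorem Sm.op_comm (hf : Sm f) (o p : Option (Fin 2)) (ht : 0 ≤ t) :
    INS2D.op o (INS2D.op p f) t = INS2D.op p (INS2D.op o f) t := by
  ext x
  have key : ∀ o p : Option (Fin 2), INS2D.op o (INS2D.op p f) t x =
      fderivWithin ℝ (fderivWithin ℝ (fun q : ℝ × Plane => f q.1 q.2) slab) slab (t, x)
        (dir o) (dir p) := by
    intro o p
    rw [(hf.op p).op_eq o ht x]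
    have e : EqOn (fun q : ℝ × Plane => INS2D.op p f q.1 q.2)
        (fun q => fderivWithin ℝ (fun q : ℝ × Plane => f q.1 q.2) slab q (dir p)) slab :=
      fun q hq => hf.op_eq p hq.1 q.2
    rw [fderivWithin_congr e (e (mem_slab ht x))]
    have hd : DifferentiableWithinAt ℝ (fderivWithin ℝ (fun q : ℝ × Plane => f q.1 q.2) slab)
        slab (t, x) :=
      (ContDiffOn.fderivWithin hf uniqueDiffOn_slab (m := 1) (by norm_cast)).differentiableOn
        (by norm_num) _ (mem_slab ht x)
    rw [fderivWithin_clm_apply (uniqueDiffOn_slab _ (mem_slab ht x)) hd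
      (differentiableWithinAt_const _)]
    simp
  rw [key, key]
  exact (hf.contDiffWithinAt (mem_slab ht x)).isSymmSndFDerivWithinAt (by simp; norm_cast)
    uniqueDiffOn_slab (closure_interior_slab (mem_slab ht x)) (mem_slab ht x) _ _

theorem Sm.clm {G : Type*} [NormedAddCommGroup G] [NormedSpace ℝ G] (hf : Sm f) (L : F →L[ℝ] G) :
    Sm (fun t x => L (f t x)) :=
  L.contDiff.comp_contDiffOn hf

theorem Sm.op_clm {G : Type*} [NormedAddCommGroup G] [NormedSpace ℝ G] (hf : Sm f) (L : F →L[ℝ] G)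
    (o : Option (Fin 2)) (ht : 0 ≤ t) (x : Plane) :
    INS2D.op o (fun t x => L (f t x)) t x = L (INS2D.op o f t x) := by
  rw [(hf.clm L).op_eq o ht, hf.op_eq o ht]
  have := (L.hasFDerivAt.comp_hasFDerivWithinAt (t, x) (hf.hasFDerivWithinAt ht x)).fderivWithin
    (uniqueDiffOn_slab _ (mem_slab ht x))
  exact congrArg (fun A => A (dir o)) this

theorem Sm.add (hf : Sm f) (hg : Sm g) : Sm (fun t x => f t x + g t x) :=
  ContDiffOn.add hf hg

theorem Sm.op_add (hf : Sm f) (hg : Sm g) (o : Option (Fin 2)) (ht : 0 ≤ t) (x : Plane) :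
    INS2D.op o (fun t x => f t x + g t x) t x = INS2D.op o f t x + INS2D.op o g t x := by
  rw [(hf.add hg).op_eq o ht, hf.op_eq o ht, hg.op_eq o ht]
  have := ((hf.hasFDerivWithinAt ht x).add (hg.hasFDerivWithinAt ht x)).fderivWithin
    (uniqueDiffOn_slab _ (mem_slab ht x))
  exact congrArg (fun A => A (dir o)) this

end Operators

theorem Sm.mul {f g : ℝ → Plane → ℝ} (hf : Sm f) (hg : Sm g) : Sm (fun t x => f t x * g t x) :=
  ContDiffOn.mul hf hg

theorem Sm.op_mul {f g : ℝ → Plane → ℝ} {t : ℝ} (hf : Sm f) (hg : Sm g) (o : Option (Fin 2))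
    (ht : 0 ≤ t) (x : Plane) :
    INS2D.op o (fun t x => f t x * g t x) t x
      = INS2D.op o f t x * g t x + f t x * INS2D.op o g t x := by
  rw [(hf.mul hg).op_eq o ht, hf.op_eq o ht, hg.op_eq o ht]
  have := ((hf.hasFDerivWithinAt ht x).mul (hg.hasFDerivWithinAt ht x)).fderivWithin
    (uniqueDiffOn_slab _ (mem_slab ht x))
  refine (congrArg (fun A => A (dir o)) this).trans ?_
  simp; ring

/-! ### Functions all of whose derivatives are locally bounded in time with values in `L²` -/

/-- `f` is locally bounded in time with values in `L²`. -/
def L2Bdd (f : ℝ → Plane → ℝ) : Prop :=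
  ∀ T, ∃ M, ∀ t ∈ Icc 0 T, MemLp (f t) 2 ∧ ∫ x, f t x ^ 2 ≤ M

/-- Iterated derivatives, the head of the list being applied first. -/
noncomputable def opw : List (Option (Fin 2)) → (ℝ → Plane → ℝ) → ℝ → Plane → ℝ
  | [], f => f
  | o :: l, f => opw l (op o f)

/-- `f` is smooth, and all its derivatives are locally bounded in time with values in `L²`. -/
def Tame (f : ℝ → Plane → ℝ) : Prop := ∀ l, Sm (opw l f) ∧ L2Bdd (opw l f)

theorem Tame.of_closed {K : (ℝ → Plane → ℝ) → Prop} (hop : ∀ f, K f → ∀ o, K (op o f))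
    (hS : ∀ f, K f → Sm f) (hL : ∀ f, K f → L2Bdd f) {f : ℝ → Plane → ℝ} (hf : K f) : Tame f := by
  intro l
  induction l generalizing f with
  | nil => exact ⟨hS f hf, hL f hf⟩
  | cons o l ih => exact ih (hop f hf o)

section Tame

variable {f g : ℝ → Plane → ℝ} {t : ℝ}

theorem Tame.sm (hf : Tame f) : Sm f := (hf []).1

theorem Tame.l2Bdd (hf : Tame f) : L2Bdd f := (hf []).2

theorem Tame.op (hf : Tame f) (o : Option (Fin 2)) : Tame (op o f) := fun l => hf (o :: l)

theorem Tame.tderiv (hf : Tame f) : Tame (tderiv f) := hf.op none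

theorem Tame.pd (hf : Tame f) (i : Fin 2) : Tame (fun t => pd i (f t)) := hf.op (some i)

theorem Tame.memLp (hf : Tame f) (ht : 0 ≤ t) : MemLp (f t) 2 :=
  let ⟨_, hM⟩ := hf.l2Bdd t
  (hM t ⟨ht, le_rfl⟩).1

theorem Tame.contDiff (hf : Tame f) (ht : 0 ≤ t) : ContDiff ℝ ∞ (f t) := hf.sm.contDiff ht

theorem Tame.differentiable (hf : Tame f) (ht : 0 ≤ t) : Differentiable ℝ (f t) :=
  (hf.contDiff ht).differentiable (by simp)

theorem Tame.integrable_mul (hf : Tame f) (hg : Tame g) (ht : 0 ≤ t) :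
    Integrable fun x => f t x * g t x :=
  INS2D.integrable_mul (hf.memLp ht) (hg.memLp ht)

theorem Tame.integrable_sq (hf : Tame f) (ht : 0 ≤ t) : Integrable fun x => f t x ^ 2 :=
  (hf.memLp ht).integrable_sq

theorem L2Bdd.congr (hf : L2Bdd f) (h : ∀ t, 0 ≤ t → f t = g t) : L2Bdd g := by
  intro T
  obtain ⟨M, hM⟩ := hf T
  exact ⟨M, fun t ht => h t ht.1 ▸ hM t ht⟩

theorem Tame.congr (hf : Tame f) (h : ∀ t, 0 ≤ t → f t = g t) : Tame g := by
  refine Tame.of_closed (K := fun g => ∃ f, Tame f ∧ ∀ t, 0 ≤ t → f t = g t) ?_ ?_ ?_ ⟨f, hf, h⟩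
  · rintro g ⟨f, hf, h⟩ o
    exact ⟨_, hf.op o, op_congr h o⟩
  · rintro g ⟨f, hf, h⟩
    exact hf.sm.congr h
  · rintro g ⟨f, hf, h⟩
    exact hf.l2Bdd.congr h

theorem L2Bdd.add (hf : L2Bdd f) (hg : L2Bdd g) : L2Bdd (fun t x => f t x + g t x) := by
  intro T
  obtain ⟨M, hM⟩ := hf T
  obtain ⟨N, hN⟩ := hg T
  refine ⟨2 * M + 2 * N, fun t ht => ?_⟩
  obtain ⟨h1, h2⟩ := hM t ht
  obtain ⟨h3, h4⟩ := hN t ht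
  refine ⟨h1.add h3, ?_⟩
  calc ∫ x, (f t x + g t x) ^ 2 ≤ ∫ x, (2 * f t x ^ 2 + 2 * g t x ^ 2) :=
        integral_mono (h1.add h3).integrable_sq
          (integrable_add (h1.integrable_sq.const_mul 2) (h3.integrable_sq.const_mul 2))
          fun x => by nlinarith [sq_nonneg (f t x - g t x)]
    _ ≤ 2 * M + 2 * N := by
        rw [integral_add (h1.integrable_sq.const_mul 2) (h3.integrable_sq.const_mul 2),
          integral_const_mul, integral_const_mul]
        linarith

theorem Tame.add (hf : Tame f) (hg : Tame g) : Tame (fun t x => f t x + g t x) := by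
  refine Tame.of_closed
    (K := fun h => ∃ f g, Tame f ∧ Tame g ∧ ∀ t, 0 ≤ t → (fun x => f t x + g t x) = h t)
    ?_ ?_ ?_ ⟨f, g, hf, hg, fun _ _ => rfl⟩
  · rintro h ⟨f, g, hf, hg, e⟩ o
    refine ⟨_, _, hf.op o, hg.op o, fun t ht => ?_⟩
    rw [← op_congr e o t ht]
    ext x
    exact (hf.sm.op_add hg.sm o ht x).symm
  · rintro h ⟨f, g, hf, hg, e⟩
    exact (hf.sm.add hg.sm).congr e
  · rintro h ⟨f, g, hf, hg, e⟩
    exact (hf.l2Bdd.add hg.l2Bdd).congr e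

theorem Tame.const_mul (c : ℝ) (hf : Tame f) : Tame (fun t x => c * f t x) := by
  set L : ℝ →L[ℝ] ℝ := c • ContinuousLinearMap.id ℝ ℝ with hL
  have eL : ∀ y, L y = c * y := fun y => by simp [hL]
  refine Tame.of_closed
    (K := fun h => ∃ f, Tame f ∧ ∀ t, 0 ≤ t → (fun x => L (f t x)) = h t)
    ?_ ?_ ?_ ⟨f, hf, fun _ _ => by simp [eL]⟩
  · rintro h ⟨f, hf, e⟩ o
    refine ⟨_, hf.op o, fun t ht => ?_⟩
    rw [← op_congr e o t ht]
    ext x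
    exact (hf.sm.op_clm L o ht x).symm
  · rintro h ⟨f, hf, e⟩
    exact (hf.sm.clm L).congr e
  · rintro h ⟨f, hf, e⟩
    refine L2Bdd.congr (f := fun t x => L (f t x)) ?_ e
    intro T
    obtain ⟨M, hM⟩ := hf.l2Bdd T
    refine ⟨c ^ 2 * M, fun t ht => ?_⟩
    simp only [eL, mul_pow]
    exact ⟨(hM t ht).1.const_mul c, by
      rw [integral_const_mul]; exact mul_le_mul_of_nonneg_left (hM t ht).2 (sq_nonneg c)⟩

theorem integral_abs_mul_le {p q : Plane → ℝ} (hp : MemLp p 2) (hq : MemLp q 2) :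
    2 * ∫ x, |p x * q x| ≤ (∫ x, p x ^ 2) + ∫ x, q x ^ 2 := by
  rw [← integral_const_mul, ← integral_add hp.integrable_sq hq.integrable_sq]
  refine integral_mono ((INS2D.integrable_mul hp hq).abs.const_mul 2)
    (integrable_add hp.integrable_sq hq.integrable_sq) fun x => ?_
  beta_reduce
  rw [abs_mul]
  nlinarith [sq_nonneg (|p x| - |q x|), sq_abs (p x), sq_abs (q x)]

theorem Tame.pd_sq (hf : Tame f) (ht : 0 ≤ t) (i : Fin 2) (x : Plane) :
    INS2D.pd i (fun y => f t y * f t y) x = 2 * (f t x * INS2D.pd i (f t) x) := by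
  rw [pd_mul (hf.differentiable ht x) (hf.differentiable ht x)]; ring

theorem Tame.sq_le (hf : Tame f) (ht : 0 ≤ t) (x : Plane) :
    f t x ^ 2 ≤ (∫ x, f t x ^ 2) + (∫ x, INS2D.pd 0 (f t) x ^ 2) + (∫ x, INS2D.pd 1 (f t) x ^ 2)
      + ∫ x, INS2D.pd 1 (INS2D.pd 0 (f t)) x ^ 2 := by
  have m := hf.memLp ht
  have m0 : MemLp (INS2D.pd 0 (f t)) 2 := (hf.pd 0).memLp ht
  have m1 : MemLp (INS2D.pd 1 (f t)) 2 := (hf.pd 1).memLp ht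
  have m2 : MemLp (INS2D.pd 1 (INS2D.pd 0 (f t))) 2 := ((hf.pd 0).pd 1).memLp ht
  have d0 : Differentiable ℝ (INS2D.pd 0 (f t)) := (hf.pd 0).differentiable ht
  have e0 : INS2D.pd 0 (fun y => f t y * f t y) = fun x => 2 * (f t x * INS2D.pd 0 (f t) x) :=
    funext fun x => hf.pd_sq ht 0 x
  have e1 : INS2D.pd 1 (INS2D.pd 0 (fun y => f t y * f t y)) = fun x =>
      2 * (INS2D.pd 1 (f t) x * INS2D.pd 0 (f t) x + f t x * INS2D.pd 1 (INS2D.pd 0 (f t)) x) := by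
    ext x
    rw [e0, INS2D.pd, fderiv_const_mul (((hf.differentiable ht x)).fun_mul (d0 x)),
      smul_apply, smul_eq_mul]
    congr 1
    exact pd_mul (hf.differentiable ht x) (d0 x) 1
  have i1 : Integrable fun x => INS2D.pd 1 (f t) x * INS2D.pd 0 (f t) x :=
    INS2D.integrable_mul m1 m0
  have i2 : Integrable fun x => f t x * INS2D.pd 1 (INS2D.pd 0 (f t)) x :=
    INS2D.integrable_mul m m2
  have := abs_le_integral_pd_pd (w := fun y => f t y * f t y)
    (((hf.contDiff ht).mul (hf.contDiff ht)).of_le (by norm_cast)) (INS2D.integrable_mul m m)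
    (by rw [e0]; exact (INS2D.integrable_mul m m0).const_mul 2)
    (by rw [e1]; exact (integrable_add i1 i2).const_mul 2) x
  rw [e1] at this
  have h1 := integral_abs_mul_le m1 m0
  have h2 := integral_abs_mul_le m m2
  have h3 : ∫ y, |2 * (INS2D.pd 1 (f t) y * INS2D.pd 0 (f t) y
      + f t y * INS2D.pd 1 (INS2D.pd 0 (f t)) y)|
      ≤ 2 * (∫ y, |INS2D.pd 1 (f t) y * INS2D.pd 0 (f t) y|)
        + 2 * ∫ y, |f t y * INS2D.pd 1 (INS2D.pd 0 (f t)) y| := by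
    rw [← integral_const_mul, ← integral_const_mul,
      ← integral_add (i1.abs.const_mul 2) (i2.abs.const_mul 2)]
    refine integral_mono ((integrable_add i1 i2).const_mul 2).abs
      (integrable_add (i1.abs.const_mul 2) (i2.abs.const_mul 2)) fun y => ?_
    beta_reduce
    rw [abs_mul, abs_two, ← mul_add]
    exact mul_le_mul_of_nonneg_left (abs_add_le _ _) (by norm_num)
  have h4 := le_abs_self (f t x * f t x)
  nlinarith

theorem Tame.bounded (hf : Tame f) (T : ℝ) : ∃ M, 0 ≤ M ∧ ∀ t ∈ Icc 0 T, ∀ x, |f t x| ≤ M := by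
  obtain ⟨M, hM⟩ := hf.l2Bdd T
  obtain ⟨M0, hM0⟩ := (hf.pd 0).l2Bdd T
  obtain ⟨M1, hM1⟩ := (hf.pd 1).l2Bdd T
  obtain ⟨M2, hM2⟩ := ((hf.pd 0).pd 1).l2Bdd T
  refine ⟨√(M + M0 + M1 + M2), Real.sqrt_nonneg _, fun t ht x => Real.abs_le_sqrt ?_⟩
  have := hf.sq_le ht.1 x
  have a := (hM t ht).2
  have b := (hM0 t ht).2
  have c := (hM1 t ht).2
  have d := (hM2 t ht).2
  linarith

theorem Tame.l2Bdd_mul (hf : Tame f) (hg : Tame g) : L2Bdd (fun t x => f t x * g t x) := by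
  intro T
  obtain ⟨M, hM0, hM⟩ := hf.bounded T
  obtain ⟨N, hN⟩ := hg.l2Bdd T
  refine ⟨M ^ 2 * N, fun t ht => ?_⟩
  have hg2 := (hN t ht).1
  have hm : MemLp (fun x => f t x * g t x) 2 := by
    refine hg2.of_le_mul (c := M)
      ((hf.contDiff ht.1).continuous.mul (hg.contDiff ht.1).continuous).aestronglyMeasurable
      (Eventually.of_forall fun x => ?_)
    rw [norm_mul]
    exact mul_le_mul_of_nonneg_right (hM t ht x) (norm_nonneg _)
  refine ⟨hm, ?_⟩
  calc ∫ x, (f t x * g t x) ^ 2 ≤ ∫ x, M ^ 2 * g t x ^ 2 :=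
        integral_mono hm.integrable_sq (hg2.integrable_sq.const_mul _) fun x => by
          beta_reduce
          rw [mul_pow]
          exact mul_le_mul_of_nonneg_right (sq_le_sq' (abs_le.1 (hM t ht x)).1
            (abs_le.1 (hM t ht x)).2) (sq_nonneg _)
    _ ≤ M ^ 2 * N := by
        rw [integral_const_mul]; exact mul_le_mul_of_nonneg_left (hN t ht).2 (sq_nonneg M)

/-- Finite sums of products of two tame functions. -/
inductive SumProd : (ℝ → Plane → ℝ) → Prop
  | mul {f g : ℝ → Plane → ℝ} : Tame f → Tame g → SumProd (fun t x => f t x * g t x)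
  | add {f g : ℝ → Plane → ℝ} : SumProd f → SumProd g → SumProd (fun t x => f t x + g t x)
  | congr {f g : ℝ → Plane → ℝ} : SumProd f → (∀ t, 0 ≤ t → f t = g t) → SumProd g

theorem SumProd.sm {h : ℝ → Plane → ℝ} (hh : SumProd h) : Sm h := by
  induction hh with
  | mul hf hg => exact hf.sm.mul hg.sm
  | add _ _ h1 h2 => exact h1.add h2
  | congr _ e h => exact h.congr e

theorem SumProd.l2Bdd {h : ℝ → Plane → ℝ} (hh : SumProd h) : L2Bdd h := by
  induction hh with
  | mul hf hg => exact hf.l2Bdd_mul hg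
  | add _ _ h1 h2 => exact h1.add h2
  | congr _ e h => exact h.congr e

theorem SumProd.op {h : ℝ → Plane → ℝ} (hh : SumProd h) (o : Option (Fin 2)) :
    SumProd (INS2D.op o h) := by
  induction hh with
  | mul hf hg =>
    exact ((SumProd.mul (hf.op o) hg).add (SumProd.mul hf (hg.op o))).congr fun t ht =>
      funext fun x => (hf.sm.op_mul hg.sm o ht x).symm
  | add h1 h2 k1 k2 =>
    exact (k1.add k2).congr fun t ht => funext fun x => (h1.sm.op_add h2.sm o ht x).symm
  | congr _ e h => exact h.congr (op_congr e o)

theorem Tame.mul (hf : Tame f) (hg : Tame g) : Tame (fun t x => f t x * g t x) :=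
  Tame.of_closed (K := SumProd) (fun _ h o => h.op o) (fun _ h => h.sm) (fun _ h => h.l2Bdd)
    (SumProd.mul hf hg)

theorem Tame.neg (hf : Tame f) : Tame (fun t x => - f t x) := by
  simpa using hf.const_mul (-1)

/-- Multiplication by the density `1 + r`. -/
theorem Tame.one_add_mul {r : ℝ → Plane → ℝ} (hr : Tame r) (hf : Tame f) :
    Tame (fun t x => (1 + r t x) * f t x) := by
  simpa [add_mul] using hf.add (hr.mul hf)

end Tame

/-! ### Components of Sobolev functions are tame -/

section Sobolev

variable {F : Type*} [NormedAddCommGroup F] [NormedSpace ℝ F]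

/-- Iterated space derivatives, the head of the list being applied last. -/
noncomputable def pdw : List (Fin 2) → (ℝ → Plane → F) → ℝ → Plane → F
  | [], f => f
  | i :: l, f => op (some i) (pdw l f)

theorem Sm.pdw {f : ℝ → Plane → F} (hf : Sm f) (l : List (Fin 2)) : Sm (pdw l f) := by
  induction l with
  | nil => exact hf
  | cons i l ih => exact ih.op (some i)

theorem Sm.iterate_tderiv {f : ℝ → Plane → F} (hf : Sm f) (j : ℕ) : Sm (tderiv^[j] f) := by
  induction j with
  | zero => exact hf
  | succ j ih => rw [Function.iterate_succ_apply']; exact ih.op none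

theorem Sm.op_none_pdw {f : ℝ → Plane → F} (hf : Sm f) (l : List (Fin 2)) (t : ℝ) (ht : 0 ≤ t) :
    INS2D.op none (INS2D.pdw l f) t = INS2D.pdw l (tderiv f) t := by
  induction l generalizing t with
  | nil => rfl
  | cons i l ih =>
    exact ((hf.pdw l).op_comm none (some i) ht).trans (op_congr ih (some i) t ht)

theorem Sm.pdw_eq {f : ℝ → Plane → F} (hf : Sm f) (l : List (Fin 2)) :
    ∃ Λ : (ContinuousMultilinearMap ℝ (fun _ : Fin l.length => Plane) F) →L[ℝ] F,
      ∀ t, 0 ≤ t → ∀ x, INS2D.pdw l f t x = Λ (iteratedFDeriv ℝ l.length (f t) x) := by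
  suffices h : ∃ m : Fin l.length → Plane, ∀ t, 0 ≤ t → ∀ x,
      INS2D.pdw l f t x = iteratedFDeriv ℝ l.length (f t) x m by
    obtain ⟨m, hm⟩ := h
    exact ⟨ContinuousMultilinearMap.apply ℝ _ _ m, hm⟩
  induction l with
  | nil => exact ⟨Fin.elim0, fun t ht x => by simp [INS2D.pdw]⟩
  | cons i l ih =>
    obtain ⟨m, hm⟩ := ih
    refine ⟨Fin.cons (basisVec i) m, fun t ht x => ?_⟩
    have e : INS2D.pdw l f t = fun x => iteratedFDeriv ℝ l.length (f t) x m :=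
      funext fun x => hm t ht x
    have hd : DifferentiableAt ℝ (iteratedFDeriv ℝ l.length (f t)) x :=
      ((hf.contDiff ht).differentiable_iteratedFDeriv (by norm_cast; simp)) x
    change fderiv ℝ (INS2D.pdw l f t) x (basisVec i) = _
    rw [e]
    simp only [List.length_cons]
    rw [iteratedFDeriv_succ_apply_left]
    simp only [Fin.cons_zero, Fin.tail_cons]
    have := ((ContinuousMultilinearMap.apply ℝ (fun _ : Fin l.length => Plane) F m).hasFDerivAt.comp
      x hd.hasFDerivAt).fderiv
    exact congrArg (fun A => A (basisVec i)) this

theorem exists_integral_norm_sq_le {E : Type*} [NormedAddCommGroup E] {z : ℝ → Plane → E}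
    (hm : ∀ t, 0 ≤ t → MemLp (z t) 2)
    (hc : ∀ t, 0 ≤ t →
      Tendsto (fun s => eLpNorm (fun x => z s x - z t x) 2 volume) (𝓝[Ici 0] t) (𝓝 0)) (T : ℝ) :
    ∃ M, ∀ t ∈ Icc 0 T, ∫ x, ‖z t x‖ ^ 2 ≤ M := by
  have hcont : ContinuousOn (fun t => (eLpNorm (z t) 2 volume).toReal) (Ici 0) := by
    intro t ht
    have ht : 0 ≤ t := ht
    rw [ContinuousWithinAt, tendsto_iff_dist_tendsto_zero]
    have h1 : Tendsto (fun s => (eLpNorm (fun x => z s x - z t x) 2 volume).toReal)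
        (𝓝[Ici 0] t) (𝓝 0) := by
      exact (ENNReal.tendsto_toReal ENNReal.zero_ne_top).comp (hc t ht)
    refine squeeze_zero' (Eventually.of_forall fun _ => dist_nonneg) ?_ h1
    filter_upwards [self_mem_nhdsWithin] with s hs
    have hs : 0 ≤ s := hs
    have key : ∀ a b : Plane → E, MemLp a 2 → MemLp b 2 → (eLpNorm a 2 volume).toReal ≤
        (eLpNorm (fun x => a x - b x) 2 volume).toReal + (eLpNorm b 2 volume).toReal := by
      intro a b ha hb
      change _ ≤ (eLpNorm (a - b) 2 volume).toReal + _
      rw [← ENNReal.toReal_add (ha.sub hb).eLpNorm_ne_top hb.eLpNorm_ne_top]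
      refine ENNReal.toReal_mono
        (ENNReal.add_ne_top.2 ⟨(ha.sub hb).eLpNorm_ne_top, hb.eLpNorm_ne_top⟩) ?_
      have := eLpNorm_add_le (ha.sub hb).1 hb.1 (p := 2) (by norm_num)
      simpa using this
    have k1 := key _ _ (hm s hs) (hm t ht)
    have k2 := key _ _ (hm t ht) (hm s hs)
    have e : eLpNorm (fun x => z t x - z s x) 2 volume = eLpNorm (fun x => z s x - z t x) 2 volume :=
      eLpNorm_sub_comm _ _ _ _
    rw [e] at k2
    rw [Real.dist_eq, abs_le]
    constructor <;> linarith
  obtain ⟨M, hM⟩ := isCompact_Icc.bddAbove_image (hcont.mono (Icc_subset_Ici_self : Icc 0 T ⊆ Ici 0))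
  refine ⟨M ^ 2, fun t ht => ?_⟩
  have h1 := hM (mem_image_of_mem _ ht)
  have h2 : (eLpNorm (z t) 2 volume).toReal ^ 2 = ∫ x, ‖z t x‖ ^ 2 := by
    rw [(hm t ht.1).eLpNorm_eq_integral_rpow_norm (by norm_num) (by norm_num)]
    have h0 : 0 ≤ ∫ x, ‖z t x‖ ^ 2 := integral_nonneg fun _ => by positivity
    simp only [ENNReal.toReal_ofNat, Real.rpow_two]
    rw [ENNReal.toReal_ofReal (by positivity), ← Real.rpow_natCast, ← Real.rpow_mul h0]
    norm_num
  rw [← h2]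
  exact pow_le_pow_left₀ ENNReal.toReal_nonneg h1 2

theorem SmoothSobolev.tame {f : ℝ → Plane → F} (hf : SmoothSobolev f) (L : F →L[ℝ] ℝ) :
    Tame (fun t x => L (f t x)) := by
  have hS : Sm f := hf.contDiffOn
  refine Tame.of_closed (K := fun h => ∃ (j : ℕ) (l : List (Fin 2)), ∀ t, 0 ≤ t →
    (fun x => L (pdw l (tderiv^[j] f) t x)) = h t) ?_ ?_ ?_ ⟨0, [], fun _ _ => rfl⟩
  · rintro h ⟨j, l, e⟩ o
    have hw := (hS.iterate_tderiv j).pdw l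
    cases o with
    | none =>
      refine ⟨j + 1, l, fun t ht => ?_⟩
      rw [← op_congr e none t ht]
      ext x
      rw [hw.op_clm L none ht x, (hS.iterate_tderiv j).op_none_pdw l t ht,
        Function.iterate_succ_apply']
    | some i =>
      refine ⟨j, i :: l, fun t ht => ?_⟩
      rw [← op_congr e (some i) t ht]
      ext x
      exact (hw.op_clm L (some i) ht x).symm
  · rintro h ⟨j, l, e⟩
    exact (((hS.iterate_tderiv j).pdw l).clm L).congr e
  · rintro h ⟨j, l, e⟩
    refine L2Bdd.congr (f := fun t x => L (pdw l (tderiv^[j] f) t x)) ?_ e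
    obtain ⟨Λ, hΛ⟩ := (hS.iterate_tderiv j).pdw_eq l
    intro T
    obtain ⟨M, hM⟩ := exists_integral_norm_sq_le (hf.memLp j l.length)
      (hf.continuous j l.length) T
    refine ⟨‖L.comp Λ‖ ^ 2 * M, fun t ht => ?_⟩
    have hm := hf.memLp j l.length t ht.1
    have e2 : (fun x => L (pdw l (tderiv^[j] f) t x))
        = fun x => (L.comp Λ) (iteratedFDeriv ℝ l.length (tderiv^[j] f t) x) :=
      funext fun x => by rw [hΛ t ht.1 x]; rfl
    have hm2 : MemLp (fun x => L (pdw l (tderiv^[j] f) t x)) 2 := by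
      rw [e2]; exact (L.comp Λ).comp_memLp' hm
    refine ⟨hm2, ?_⟩
    calc ∫ x, L (pdw l (tderiv^[j] f) t x) ^ 2
        ≤ ∫ x, ‖L.comp Λ‖ ^ 2 * ‖iteratedFDeriv ℝ l.length (tderiv^[j] f t) x‖ ^ 2 := by
          refine integral_mono hm2.integrable_sq (hm.norm.integrable_sq.const_mul _) fun x => ?_
          beta_reduce
          rw [congrFun e2 x, ← mul_pow, ← sq_abs, ← Real.norm_eq_abs]
          exact pow_le_pow_left₀ (norm_nonneg _) ((L.comp Λ).le_opNorm _) 2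
      _ ≤ ‖L.comp Λ‖ ^ 2 * M := by
          rw [integral_const_mul]
          exact mul_le_mul_of_nonneg_left (hM t ht) (sq_nonneg _)

end Sobolev

/-! ### Time derivatives of integrals -/

section Time

variable {f g : ℝ → Plane → ℝ}

theorem Tame.hasDerivAt (hf : Tame f) {t : ℝ} (ht : 0 < t) (x : Plane) :
    HasDerivAt (fun s => f s x) (INS2D.tderiv f t x) t :=
  (hf.sm.hasDerivWithinAt_tderiv ht.le x).hasDerivAt (Ici_mem_nhds ht)

theorem Tame.continuousOn (hf : Tame f) {a b : ℝ} (ha : 0 ≤ a) :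
    ContinuousOn (fun q : ℝ × Plane => f q.1 q.2) (Icc a b ×ˢ univ) :=
  hf.sm.continuousOn.mono (prod_mono (fun _ ht => ha.trans ht.1) subset_rfl)

theorem Tame.continuousOn_left (hf : Tame f) {a b : ℝ} (ha : 0 ≤ a) (x : Plane) :
    ContinuousOn (fun t => f t x) (Icc a b) :=
  (hf.continuousOn ha).comp (by fun_prop : Continuous fun t : ℝ => (t, x)).continuousOn
    fun _ ht => ⟨ht, mem_univ _⟩

theorem Tame.integral_abs_mul_bdd (hf : Tame f) (hg : Tame g) (T : ℝ) :
    ∃ M, ∀ t ∈ Icc 0 T, ∫ x, |f t x * g t x| ≤ M := by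
  obtain ⟨M, hM⟩ := hf.l2Bdd T
  obtain ⟨N, hN⟩ := hg.l2Bdd T
  refine ⟨M + N, fun t ht => ?_⟩
  obtain ⟨h1, h2⟩ := hM t ht
  obtain ⟨h3, h4⟩ := hN t ht
  have := integral_abs_mul_le h1 h3
  have h5 : 0 ≤ ∫ x, |f t x * g t x| := integral_nonneg fun _ => abs_nonneg _
  linarith

theorem Tame.mul_deriv_bdd (hf : Tame f) (hg : Tame g) (T : ℝ) :
    ∃ M, ∀ t ∈ Icc 0 T,
      Integrable (fun x => INS2D.tderiv f t x * g t x + f t x * INS2D.tderiv g t x) ∧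
      ∫ x, |INS2D.tderiv f t x * g t x + f t x * INS2D.tderiv g t x| ≤ M := by
  obtain ⟨M, hM⟩ := hf.tderiv.integral_abs_mul_bdd hg T
  obtain ⟨N, hN⟩ := hf.integral_abs_mul_bdd hg.tderiv T
  refine ⟨M + N, fun t ht => ?_⟩
  have i1 := hf.tderiv.integrable_mul hg ht.1
  have i2 := hf.integrable_mul hg.tderiv ht.1
  refine ⟨integrable_add i1 i2, ?_⟩
  calc _ ≤ ∫ x, (|INS2D.tderiv f t x * g t x| + |f t x * INS2D.tderiv g t x|) :=
        integral_mono (integrable_add i1 i2).abs (integrable_add i1.abs i2.abs)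
          fun x => abs_add_le _ _
    _ ≤ M + N := by
        rw [integral_add i1.abs i2.abs]
        exact add_le_add (hM t ht) (hN t ht)

theorem Tame.integral_mul_sub (hf : Tame f) (hg : Tame g) {a b : ℝ} (ha : 0 ≤ a) (hab : a ≤ b) :
    (∫ x, f b x * g b x) - ∫ x, f a x * g a x
      = ∫ t in a..b, ∫ x, (INS2D.tderiv f t x * g t x + f t x * INS2D.tderiv g t x) := by
  obtain ⟨M, hM⟩ := hf.mul_deriv_bdd hg b
  refine integral_sub_eq_of_hasDerivAt (F := fun t x => f t x * g t x)
    (K := fun t x => INS2D.tderiv f t x * g t x + f t x * INS2D.tderiv g t x) hab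
    (fun x => (hf.continuousOn_left ha x).mul (hg.continuousOn_left ha x))
    (fun x t ht => (hf.hasDerivAt (ha.trans_lt ht.1) x).mul (hg.hasDerivAt (ha.trans_lt ht.1) x))
    (((hf.tderiv.continuousOn ha).mul (hg.continuousOn ha)).add
      ((hf.continuousOn ha).mul (hg.tderiv.continuousOn ha)))
    (fun t ht => hM t ⟨ha.trans ht.1, ht.2⟩)
    (hf.integrable_mul hg ha) (hf.integrable_mul hg (ha.trans hab))

theorem Tame.continuousOn_integral_mul (hf : Tame f) (hg : Tame g) {a b : ℝ} (ha : 0 ≤ a)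
    (hab : a ≤ b) : ContinuousOn (fun t => ∫ x, f t x * g t x) (Icc a b) := by
  obtain ⟨M, hM⟩ := hf.mul_deriv_bdd hg b
  have hI := intervalIntegrable_integral
    (K := fun t x => INS2D.tderiv f t x * g t x + f t x * INS2D.tderiv g t x) hab
    (((hf.tderiv.continuousOn ha).mul (hg.continuousOn ha)).add
      ((hf.continuousOn ha).mul (hg.tderiv.continuousOn ha)))
    (fun t ht => hM t ⟨ha.trans ht.1, ht.2⟩)
  have hc := intervalIntegral.continuousOn_primitive_interval' hI left_mem_uIcc
  rw [uIcc_of_le hab] at hc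
  refine (hc.const_add (∫ x, f a x * g a x)).congr fun t ht => ?_
  have := hf.integral_mul_sub hg ha ht.1
  beta_reduce
  linarith

theorem sqL2_real (f : Plane → ℝ) : sqL2 f = ∫ x, f x ^ 2 := by simp [sqL2]

theorem Tame.continuousOn_sqL2 (hf : Tame f) {a b : ℝ} (ha : 0 ≤ a) (hab : a ≤ b) :
    ContinuousOn (fun t => sqL2 (f t)) (Icc a b) := by
  simpa only [sqL2_real, sq] using hf.continuousOn_integral_mul hf ha hab

end Time

/-! ### Grönwall's inequality in integral form -/

theorem gronwall_of_continuous {A G : ℝ → ℝ} {s t c : ℝ} (hst : s ≤ t) (hA : Continuous A)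
    (hG : Continuous G) (hA0 : ∀ τ ∈ Icc s t, 0 ≤ A τ)
    (h : ∀ τ ∈ Icc s t, G τ ≤ c + ∫ r in s..τ, A r * G r) :
    G t ≤ c * Real.exp (∫ r in s..t, A r) := by
  set H : ℝ → ℝ := fun τ => (c + ∫ r in s..τ, A r * G r) * Real.exp (-∫ r in s..τ, A r) with hH
  have d1 : ∀ τ, HasDerivAt (fun τ => ∫ r in s..τ, A r * G r) (A τ * G τ) τ := fun τ =>
    ((hA.mul hG).integral_hasStrictDerivAt s τ).hasDerivAt
  have d2 : ∀ τ, HasDerivAt (fun τ => ∫ r in s..τ, A r) (A τ) τ := fun τ =>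
    (hA.integral_hasStrictDerivAt s τ).hasDerivAt
  have dH : ∀ τ, HasDerivAt H (A τ * G τ * Real.exp (-∫ r in s..τ, A r)
      + (c + ∫ r in s..τ, A r * G r) * (Real.exp (-∫ r in s..τ, A r) * -A τ)) τ := fun τ =>
    ((d1 τ).const_add c).mul (d2 τ).neg.exp
  have hanti : AntitoneOn H (Icc s t) := by
    refine antitoneOn_of_deriv_nonpos (convex_Icc s t)
      (fun τ _ => (dH τ).continuousAt.continuousWithinAt)
      (fun τ _ => (dH τ).differentiableAt.differentiableWithinAt) fun τ hτ => ?_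
    have hτ := interior_subset hτ
    rw [(dH τ).deriv]
    have e : A τ * G τ * Real.exp (-∫ r in s..τ, A r)
      + (c + ∫ r in s..τ, A r * G r) * (Real.exp (-∫ r in s..τ, A r) * -A τ)
      = -(A τ * Real.exp (-∫ r in s..τ, A r) * ((c + ∫ r in s..τ, A r * G r) - G τ)) := by ring
    rw [e, neg_nonpos]
    exact mul_nonneg (mul_nonneg (hA0 τ hτ) (Real.exp_pos _).le) (sub_nonneg.2 (h τ hτ))
  have h1 := hanti (left_mem_Icc.2 hst) (right_mem_Icc.2 hst) hst
  simp only [hH, intervalIntegral.integral_same, add_zero, neg_zero, Real.exp_zero, mul_one] at h1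
  refine (h t (right_mem_Icc.2 hst)).trans ?_
  rw [Real.exp_neg, ← div_eq_mul_inv, div_le_iff₀ (Real.exp_pos _)] at h1
  exact h1

theorem gronwall {A G : ℝ → ℝ} {s t c : ℝ} (hst : s ≤ t) (hA : ContinuousOn A (Icc s t))
    (hG : ContinuousOn G (Icc s t)) (hA0 : ∀ τ ∈ Icc s t, 0 ≤ A τ)
    (h : ∀ τ ∈ Icc s t, G τ ≤ c + ∫ r in s..τ, A r * G r) :
    G t ≤ c * Real.exp (∫ r in s..t, A r) := by
  set A' := IccExtend hst ((Icc s t).domRestrict A) with hA'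
  set G' := IccExtend hst ((Icc s t).domRestrict G) with hG'
  have eA : ∀ τ ∈ Icc s t, A' τ = A τ := fun τ hτ => by simp [hA', IccExtend_of_mem hst _ hτ]
  have eG : ∀ τ ∈ Icc s t, G' τ = G τ := fun τ hτ => by simp [hG', IccExtend_of_mem hst _ hτ]
  have cA : Continuous A' := (continuousOn_iff_continuous_domRestrict.1 hA).Icc_extend'
  have cG : Continuous G' := (continuousOn_iff_continuous_domRestrict.1 hG).Icc_extend'
  have e1 : ∫ r in s..t, A' r = ∫ r in s..t, A r :=
    intervalIntegral.integral_congr fun r hr => eA r (uIcc_of_le hst ▸ hr)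
  have := gronwall_of_continuous (A := A') (G := G') (c := c) hst cA cG
    (fun τ hτ => by rw [eA τ hτ]; exact hA0 τ hτ) fun τ hτ => by
      rw [eG τ hτ]
      refine (h τ hτ).trans (le_of_eq ?_)
      congr 1
      refine intervalIntegral.integral_congr fun r hr => ?_
      rw [uIcc_of_le hτ.1] at hr
      have hr' : r ∈ Icc s t := ⟨hr.1, hr.2.trans hτ.2⟩
      simp only [eA r hr', eG r hr']
  rwa [eG t (right_mem_Icc.2 hst), e1] at this

/-! ### Interpolation inequalities -/

theorem sq_integral_abs_mul_le {p q : Plane → ℝ} (hp : MemLp p 2) (hq : MemLp q 2) :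
    (∫ x, |p x * q x|) ^ 2 ≤ (∫ x, p x ^ 2) * ∫ x, q x ^ 2 := by
  have i1 := hp.integrable_sq
  have i2 := hq.integrable_sq
  have i3 := (integrable_mul hp hq).abs
  have key : ∀ s : ℝ, 0 ≤ (∫ x, p x ^ 2) * (s * s) + (2 * ∫ x, |p x * q x|) * s
      + ∫ x, q x ^ 2 := by
    intro s
    have e : ∫ x, ((s * s) * p x ^ 2 + (2 * s) * |p x * q x| + q x ^ 2)
        = (∫ x, p x ^ 2) * (s * s) + (2 * ∫ x, |p x * q x|) * s + ∫ x, q x ^ 2 := by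
      rw [integral_add (integrable_add (i1.const_mul _) (i3.const_mul _)) i2,
        integral_add (i1.const_mul _) (i3.const_mul _), integral_const_mul, integral_const_mul]
      ring
    rw [← e]
    refine integral_nonneg fun x => ?_
    have : (s * s) * p x ^ 2 + (2 * s) * |p x * q x| + q x ^ 2 = (s * |p x| + |q x|) ^ 2 := by
      rw [abs_mul, ← sq_abs (p x), ← sq_abs (q x)]; ring
    simp only [this]
    exact sq_nonneg _
  have := discrim_le_zero key
  rw [discrim] at this
  nlinarith

section Interpolation

variable {f g p q s m v z : ℝ → Plane → ℝ} {t : ℝ}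

theorem gradSqL2_real (f : Plane → ℝ) :
    gradSqL2 f = (∫ x, pd 0 f x ^ 2) + ∫ x, pd 1 f x ^ 2 := by
  simp [gradSqL2, sqL2_real]

theorem sqL2_nonneg {F : Type*} [NormedAddCommGroup F] (f : Plane → F) : 0 ≤ sqL2 f :=
  integral_nonneg fun _ => sq_nonneg _

theorem gradSqL2_nonneg {F : Type*} [NormedAddCommGroup F] [NormedSpace ℝ F] (f : Plane → F) :
    0 ≤ gradSqL2 f :=
  Finset.sum_nonneg fun _ _ => sqL2_nonneg _

/-- Ladyzhenskaya's inequality. -/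
theorem Tame.integral_pow_four_le (hf : Tame f) (ht : 0 ≤ t) :
    ∫ x, f t x ^ 4 ≤ 2 * (sqL2 (f t) * gradSqL2 (f t)) := by
  have m := hf.memLp ht
  have mi : ∀ i, MemLp (INS2D.pd i (f t)) 2 := fun i => (hf.pd i).memLp ht
  have ei : ∀ i, INS2D.pd i (fun y => f t y * f t y) = fun x => 2 * (f t x * INS2D.pd i (f t) x) :=
    fun i => funext fun x => hf.pd_sq ht i x
  have ii : ∀ i, Integrable (INS2D.pd i (fun y => f t y * f t y)) := fun i => by
    rw [ei]; exact (INS2D.integrable_mul m (mi i)).const_mul 2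
  have h := integral_sq_le_integral_pd_mul (w := fun y => f t y * f t y)
    ((hf.differentiable ht).mul (hf.differentiable ht)) (INS2D.integrable_mul m m) (ii 0) (ii 1)
  simp only [ei, abs_mul, abs_two, integral_const_mul] at h
  simp only [← abs_mul] at h
  have c0 := sq_integral_abs_mul_le m (mi 0)
  have c1 := sq_integral_abs_mul_le m (mi 1)
  rw [sqL2_real, gradSqL2_real]
  have e4 : ∫ x, (f t x * f t x) ^ 2 = ∫ x, f t x ^ 4 := by
    congr 1; ext x; ring
  rw [e4] at h
  have n0 : 0 ≤ ∫ x, |f t x * INS2D.pd 0 (f t) x| := integral_nonneg fun _ => abs_nonneg _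
  have n1 : 0 ≤ ∫ x, |f t x * INS2D.pd 1 (f t) x| := integral_nonneg fun _ => abs_nonneg _
  nlinarith [sq_nonneg ((∫ x, |f t x * INS2D.pd 0 (f t) x|) - ∫ x, |f t x * INS2D.pd 1 (f t) x|)]

theorem Tame.sq_integral_mul_sq_le (hp : Tame p) (hq : Tame q) (ht : 0 ≤ t) :
    (∫ x, (p t x * q t x) ^ 2) ^ 2 ≤ (∫ x, p t x ^ 4) * ∫ x, q t x ^ 4 := by
  have h := sq_integral_abs_mul_le ((hp.mul hp).memLp ht) ((hq.mul hq).memLp ht)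
  convert h using 2
  · congr 1; ext x
    rw [abs_of_nonneg (mul_nonneg (mul_self_nonneg _) (mul_self_nonneg _))]; ring
  · congr 1; ext x; ring
  · congr 1; ext x; ring

theorem Tame.integral_pow_eight_le (hf : Tame f) (ht : 0 ≤ t) :
    ∫ x, f t x ^ 8 ≤ 128 * (sqL2 (f t) * gradSqL2 (f t) ^ 3) := by
  have hh := hf.mul hf
  have m := (hf.mul hh).memLp ht
  have mi : ∀ i, MemLp (INS2D.pd i (f t)) 2 := fun i => (hf.pd i).memLp ht
  have ei : ∀ i, INS2D.pd i (fun y => (f t y * f t y) * (f t y * f t y))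
      = fun x => 4 * ((f t x * (f t x * f t x)) * INS2D.pd i (f t) x) := by
    intro i; ext x
    rw [hh.pd_sq ht i x, hf.pd_sq ht i x]; ring
  have ii : ∀ i, Integrable (INS2D.pd i (fun y => (f t y * f t y) * (f t y * f t y))) := fun i => by
    rw [ei]; exact (INS2D.integrable_mul m (mi i)).const_mul 4
  have h := integral_sq_le_integral_pd_mul (w := fun y => (f t y * f t y) * (f t y * f t y))
    ((hh.differentiable ht).mul (hh.differentiable ht)) (hh.integrable_mul hh ht) (ii 0) (ii 1)
  have e4 : |(4 : ℝ)| = 4 := by norm_num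
  simp only [ei] at h
  have k : ∀ i, ∫ x, |4 * ((f t x * (f t x * f t x)) * INS2D.pd i (f t) x)|
      = 4 * ∫ x, |(f t x * (f t x * f t x)) * INS2D.pd i (f t) x| := by
    intro i
    rw [← integral_const_mul]
    congr 1; ext x; rw [abs_mul, e4]
  rw [k, k] at h
  have c0 := sq_integral_abs_mul_le m (mi 0)
  have c1 := sq_integral_abs_mul_le m (mi 1)
  have c2 := hf.sq_integral_mul_sq_le hh ht
  have e8 : ∫ x, (f t x * f t x) ^ 4 = ∫ x, f t x ^ 8 := by congr 1; ext x; ring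
  have e8' : ∫ x, ((f t x * f t x) * (f t x * f t x)) ^ 2 = ∫ x, f t x ^ 8 := by
    congr 1; ext x; ring
  rw [e8] at c2
  rw [e8'] at h
  have l4 := hf.integral_pow_four_le ht
  have hg := gradSqL2_real (f t)
  have g0 : 0 ≤ ∫ x, INS2D.pd 0 (f t) x ^ 2 := integral_nonneg fun _ => sq_nonneg _
  have g1 : 0 ≤ ∫ x, INS2D.pd 1 (f t) x ^ 2 := integral_nonneg fun _ => sq_nonneg _
  have n0 : 0 ≤ ∫ x, |(f t x * (f t x * f t x)) * INS2D.pd 0 (f t) x| :=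
    integral_nonneg fun _ => abs_nonneg _
  have n1 : 0 ≤ ∫ x, |(f t x * (f t x * f t x)) * INS2D.pd 1 (f t) x| :=
    integral_nonneg fun _ => abs_nonneg _
  have n8 : 0 ≤ ∫ x, f t x ^ 8 := integral_nonneg fun _ => by positivity
  have n4 : 0 ≤ ∫ x, f t x ^ 4 := integral_nonneg fun _ => by positivity
  have n6 : 0 ≤ ∫ x, (f t x * (f t x * f t x)) ^ 2 := integral_nonneg fun _ => sq_nonneg _
  have ns := sqL2_nonneg (f t)
  generalize (∫ x, f t x ^ 8) = X8 at *
  generalize (∫ x, f t x ^ 4) = X4 at *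
  generalize (∫ x, (f t x * (f t x * f t x)) ^ 2) = X6 at *
  generalize (∫ x, |(f t x * (f t x * f t x)) * INS2D.pd 0 (f t) x|) = A0 at *
  generalize (∫ x, |(f t x * (f t x * f t x)) * INS2D.pd 1 (f t) x|) = A1 at *
  generalize (∫ x, INS2D.pd 0 (f t) x ^ 2) = G0 at *
  generalize (∫ x, INS2D.pd 1 (f t) x ^ 2) = G1 at *
  generalize sqL2 (f t) = N at *
  rw [hg] at l4 ⊢
  have s1 : X8 ^ 2 ≤ 256 * (X6 * G0) * (X6 * G1) := by
    calc X8 ^ 2 ≤ (4 * A0 * (4 * A1)) ^ 2 := pow_le_pow_left₀ n8 h 2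
      _ = 256 * (A0 ^ 2) * (A1 ^ 2) := by ring
      _ ≤ 256 * (X6 * G0) * (X6 * G1) := by gcongr
  have s2 : X8 ^ 2 ≤ X8 * (256 * X4 * (G0 * G1)) := by
    calc X8 ^ 2 ≤ 256 * (X6 * G0) * (X6 * G1) := s1
      _ = 256 * X6 ^ 2 * (G0 * G1) := by ring
      _ ≤ 256 * (X4 * X8) * (G0 * G1) := by gcongr
      _ = X8 * (256 * X4 * (G0 * G1)) := by ring
  have s3 : X8 ≤ 256 * X4 * (G0 * G1) := by
    rcases n8.eq_or_lt with h0 | h0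
    · rw [← h0]; positivity
    · rw [sq] at s2; exact le_of_mul_le_mul_left s2 h0
  calc X8 ≤ 256 * X4 * (G0 * G1) := s3
    _ ≤ 256 * (2 * (N * (G0 + G1))) * ((G0 + G1) ^ 2 / 4) := by
        gcongr
        nlinarith [sq_nonneg (G0 - G1)]
    _ = 128 * (N * (G0 + G1) ^ 3) := by ring

/-- `sqL2 (f t) ≤ a` and `gradSqL2 (f t) ≤ b`. -/
structure NormLE (f : ℝ → Plane → ℝ) (t a b : ℝ) : Prop where
  tame : Tame f
  sq_le : sqL2 (f t) ≤ a
  grad_le : gradSqL2 (f t) ≤ b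

variable {a b c d D : ℝ}

theorem NormLE.left_nonneg (h : NormLE f t a b) : 0 ≤ a := (sqL2_nonneg _).trans h.sq_le

theorem NormLE.right_nonneg (h : NormLE f t a b) : 0 ≤ b := (gradSqL2_nonneg _).trans h.grad_le

theorem NormLE.pow_four (h : NormLE f t a b) (ht : 0 ≤ t) : ∫ x, f t x ^ 4 ≤ 2 * (a * b) := by
  refine (h.tame.integral_pow_four_le ht).trans ?_
  have := mul_le_mul h.sq_le h.grad_le (gradSqL2_nonneg _) h.left_nonneg
  linarith

theorem NormLE.pow_eight (h : NormLE f t a b) (ht : 0 ≤ t) :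
    ∫ x, f t x ^ 8 ≤ 128 * (a * b ^ 3) := by
  refine (h.tame.integral_pow_eight_le ht).trans ?_
  have := mul_le_mul h.sq_le (pow_le_pow_left₀ (gradSqL2_nonneg _) h.grad_le 3)
    (pow_nonneg (gradSqL2_nonneg _) _) h.left_nonneg
  linarith

theorem NormLE.sq_integral_mul (hp : NormLE p t a b) (hq : NormLE q t c d) (ht : 0 ≤ t) :
    (∫ x, (p t x * q t x) ^ 2) ^ 2 ≤ 4 * ((a * b) * (c * d)) := by
  refine (hp.tame.sq_integral_mul_sq_le hq.tame ht).trans ?_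
  have := mul_le_mul (hp.pow_four ht) (hq.pow_four ht) (integral_nonneg fun _ => by positivity)
    (mul_nonneg zero_le_two (mul_nonneg hp.left_nonneg hp.right_nonneg))
  linarith

theorem NormLE.integral_mul (hp : NormLE p t a b) (hq : NormLE q t a b) (ht : 0 ≤ t) :
    ∫ x, (p t x * q t x) ^ 2 ≤ 2 * (a * b) := by
  have := hp.sq_integral_mul hq ht
  have h0 := mul_nonneg hp.left_nonneg hp.right_nonneg
  exact abs_le_of_sq_le_sq' (by nlinarith) (by linarith) |>.2

theorem NormLE.sq_integral_mul_mul (hp : NormLE p t a b) (hq : NormLE q t a b)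
    (hs : NormLE s t c d) (ht : 0 ≤ t) :
    (∫ x, ((p t x * q t x) * s t x) ^ 2) ^ 2 ≤ 256 * ((a * b ^ 3) * (c * d)) := by
  have hpq := hp.tame.mul hq.tame
  have ha := hp.left_nonneg
  have hb := hp.right_nonneg
  have h1 := hpq.sq_integral_mul_sq_le hs.tame ht
  have h2 : ∫ x, (p t x * q t x) ^ 4 ≤ 128 * (a * b ^ 3) := by
    have h3 := (hp.tame.mul hp.tame).sq_integral_mul_sq_le (hq.tame.mul hq.tame) ht
    have e1 : ∫ x, ((p t x * p t x) * (q t x * q t x)) ^ 2 = ∫ x, (p t x * q t x) ^ 4 := by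
      congr 1; ext x; ring
    have e2 : ∀ f : ℝ → Plane → ℝ, ∫ x, (f t x * f t x) ^ 4 = ∫ x, f t x ^ 8 := by
      intro f; congr 1; ext x; ring
    rw [e1, e2, e2] at h3
    have h4 := mul_le_mul (hp.pow_eight ht) (hq.pow_eight ht)
      (integral_nonneg fun _ => by positivity) (by positivity)
    exact abs_le_of_sq_le_sq' (by nlinarith) (by positivity) |>.2
  refine h1.trans ?_
  have := mul_le_mul h2 (hs.pow_four ht) (integral_nonneg fun _ => by positivity) (by positivity)
  linarith

end Interpolation

/-! ### Bounds for the multilinear terms -/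

section Terms

variable {p q s s' m v w z : ℝ → Plane → ℝ} {t a b c d D : ℝ}

theorem young_sqrt {X A B ε : ℝ} (hε : 0 < ε) (hA : 0 ≤ A) (hB : 0 ≤ B) (h : X ^ 2 ≤ 4 * (A * B)) :
    X ≤ ε * A + B / ε := by
  have hB' : 0 ≤ B / ε := by positivity
  have e : ε * (B / ε) = B := by field_simp
  refine abs_le_of_sq_le_sq' ?_ (by positivity) |>.2
  have : A * B = (ε * A) * (B / ε) := by
    calc A * B = A * (ε * (B / ε)) := by rw [e]
      _ = (ε * A) * (B / ε) := by ring
  nlinarith [sq_nonneg (ε * A - B / ε)]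

theorem sqL2_mul (p q : ℝ → Plane → ℝ) (t : ℝ) :
    sqL2 ((fun t x => p t x * q t x) t) = ∫ x, (p t x * q t x) ^ 2 := sqL2_real _

theorem Tame.sq_integral_abs_le (hp : Tame p) (hq : Tame q) (ht : 0 ≤ t) :
    (∫ x, |p t x * q t x|) ^ 2 ≤ sqL2 (p t) * sqL2 (q t) := by
  rw [sqL2_real, sqL2_real]
  exact sq_integral_abs_mul_le (hp.memLp ht) (hq.memLp ht)

/-- The term `u · ∇v · v`. -/
theorem integral_convection_le (hp : NormLE p t a b) (hv : NormLE v t c D) (hz : Tame z)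
    (hzD : sqL2 (z t) ≤ D) (ht : 0 ≤ t) :
    ∫ x, |(p t x * v t x) * z t x| ≤ 1 / 100 * D + 500000 * (a * b * c) := by
  have hpv := hp.tame.mul hv.tame
  have h1 := hpv.sq_integral_abs_le hz ht
  rw [sqL2_mul] at h1
  have h2 := hp.sq_integral_mul hv ht
  have ha := hp.left_nonneg
  have hb := hp.right_nonneg
  have hc := hv.left_nonneg
  have hD := hv.right_nonneg
  have hX : 0 ≤ ∫ x, (p t x * v t x) ^ 2 := integral_nonneg fun _ => sq_nonneg _
  generalize (∫ x, (p t x * v t x) ^ 2) = X at *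
  have h3 : X ≤ 1 / 10000 * D + (a * b * c) / (1 / 10000) :=
    young_sqrt (by norm_num) hD (by positivity) (by linarith)
  have h4 : ∫ x, |(p t x * v t x) * z t x| ≤ 1 / 200 * D + X / 4 / (1 / 200) :=
    young_sqrt (by norm_num) hD (by positivity)
      (by nlinarith [mul_le_mul_of_nonneg_left hzD hX])
  have h5 : 0 ≤ a * b * c := by positivity
  linarith

/-- The term `v · ∇u · v`. -/
theorem integral_stretching_le (hv : NormLE v t c D) (hw : NormLE w t c D) (hs : Tame s)
    (hsb : sqL2 (s t) ≤ b) (ht : 0 ≤ t) :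
    ∫ x, |(v t x * w t x) * s t x| ≤ 1 / 200 * D + 100 * (b * c) := by
  have h1 := (hv.tame.mul hw.tame).sq_integral_abs_le hs ht
  rw [sqL2_mul] at h1
  have h2 := hv.integral_mul hw ht
  have hc := hv.left_nonneg
  have hD := hv.right_nonneg
  have hb := (sqL2_nonneg _).trans hsb
  have h3 := mul_le_mul h2 hsb (sqL2_nonneg _) (by positivity)
  have := young_sqrt (X := ∫ x, |(v t x * w t x) * s t x|) (A := D) (B := b * c / 2)
    (ε := 1 / 200) (by norm_num) hD (by positivity) (by linarith)
  linarith

/-- The term `u · ∇u · ∇u · v`. -/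
theorem integral_gradient_gradient_le (hp : NormLE p t a b) (hv : NormLE v t c D)
    (hs : NormLE s t b d) (hs' : NormLE s' t b d) (ht : 0 ≤ t) :
    ∫ x, |(p t x * v t x) * (s t x * s' t x)|
      ≤ 1 / 200 * D + 200 * (a * b * c) + b * d := by
  have h1 := (hp.tame.mul hv.tame).sq_integral_abs_le (hs.tame.mul hs'.tame) ht
  rw [sqL2_mul, sqL2_mul] at h1
  have h2 := hp.sq_integral_mul hv ht
  have h3 := hs.integral_mul hs' ht
  have ha := hp.left_nonneg
  have hb := hp.right_nonneg
  have hc := hv.left_nonneg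
  have hD := hv.right_nonneg
  have hd := hs.right_nonneg
  have hX : 0 ≤ ∫ x, (p t x * v t x) ^ 2 := integral_nonneg fun _ => sq_nonneg _
  generalize (∫ x, (p t x * v t x) ^ 2) = X at *
  have h4 : X ≤ 1 / 200 * D + (a * b * c) / (1 / 200) :=
    young_sqrt (by norm_num) hD (by positivity) (by linarith)
  have h6 : 0 ≤ b * d := by positivity
  have h5 : ∫ x, |(p t x * v t x) * (s t x * s' t x)| ≤ 1 * X + (b * d) / 1 :=
    young_sqrt (by norm_num) hX h6
      (by nlinarith [mul_le_mul_of_nonneg_left h3 hX, mul_nonneg hX h6])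
  linarith

/-- The term `u · u · ∇²u · v`. -/
theorem integral_hessian_le (hp : NormLE p t a b) (hq : NormLE q t a b) (hv : NormLE v t c D)
    (hm : Tame m) (hmd : sqL2 (m t) ≤ d) (ht : 0 ≤ t) :
    ∫ x, |((p t x * q t x) * v t x) * m t x|
      ≤ 1 / 50 * D + 800 * (a * b * c) + b * d := by
  have h1 := ((hp.tame.mul hq.tame).mul hv.tame).sq_integral_abs_le hm ht
  rw [sqL2_mul (fun t x => p t x * q t x) v] at h1
  have h2 := hp.sq_integral_mul_mul hq hv ht
  have ha := hp.left_nonneg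
  have hb := hp.right_nonneg
  have hc := hv.left_nonneg
  have hD := hv.right_nonneg
  have hd := (sqL2_nonneg _).trans hmd
  have hV : 0 ≤ ∫ x, ((p t x * q t x) * v t x) ^ 2 := integral_nonneg fun _ => sq_nonneg _
  generalize (∫ x, ((p t x * q t x) * v t x) ^ 2) = V at *
  set Y := 1 / 200 * D + (a * b * c) / (1 / 200) with hY
  have hY0 : 0 ≤ Y := by positivity
  have hY2 : 4 * (D * (a * b * c)) ≤ Y ^ 2 := by
    have e : 4 * (D * (a * b * c)) = 4 * ((1 / 200 * D) * ((a * b * c) / (1 / 200))) := by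
      field_simp
    rw [e, hY]
    nlinarith [sq_nonneg (1 / 200 * D - (a * b * c) / (1 / 200))]
  have h3 : V ≤ 8 * b * Y := by
    refine abs_le_of_sq_le_sq' ?_ (by positivity) |>.2
    calc V ^ 2 ≤ 64 * b ^ 2 * (4 * (D * (a * b * c))) := by linarith
      _ ≤ 64 * b ^ 2 * Y ^ 2 := by gcongr
      _ = (8 * b * Y) ^ 2 := by ring
  have h5 : ∫ x, |((p t x * q t x) * v t x) * m t x| ≤ 2 * Y + (b * d) / 1 := by
    have := young_sqrt (X := ∫ x, |((p t x * q t x) * v t x) * m t x|) (A := 2 * Y) (B := b * d)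
      (ε := 1) (by norm_num) (by positivity) (by positivity)
      (h1.trans (by
        calc V * sqL2 (m t) ≤ (8 * b * Y) * d := mul_le_mul h3 hmd (sqL2_nonneg _) (by positivity)
          _ = 4 * (2 * Y * (b * d)) := by ring))
    linarith
  have h6 : 0 ≤ a * b * c := by positivity
  rw [hY] at h5
  linarith

/-- The term `u · u · ∇u · ∇v`. -/
theorem integral_gradient_le (hp : NormLE p t a b) (hq : NormLE q t a b) (hs : NormLE s t b d)
    (hz : Tame z) (hzD : sqL2 (z t) ≤ D) (ht : 0 ≤ t) :
    ∫ x, |((p t x * q t x) * s t x) * z t x|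
      ≤ 1 / 200 * D + 400 * (b * (b ^ 2 + a * d)) := by
  have h1 := ((hp.tame.mul hq.tame).mul hs.tame).sq_integral_abs_le hz ht
  rw [sqL2_mul (fun t x => p t x * q t x) s] at h1
  have h2 := hp.sq_integral_mul_mul hq hs ht
  have ha := hp.left_nonneg
  have hb := hp.right_nonneg
  have hd := hs.right_nonneg
  have hD := (sqL2_nonneg _).trans hzD
  have hV : 0 ≤ ∫ x, ((p t x * q t x) * s t x) ^ 2 := integral_nonneg fun _ => sq_nonneg _
  generalize (∫ x, ((p t x * q t x) * s t x) ^ 2) = V at *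
  have h3 : V ≤ 8 * (b * (b ^ 2 + a * d)) := by
    refine abs_le_of_sq_le_sq' ?_ (by positivity) |>.2
    have : 256 * ((a * b ^ 3) * (b * d)) = 64 * b ^ 2 * (4 * (b ^ 2 * (a * d))) := by ring
    calc V ^ 2 ≤ 64 * b ^ 2 * (4 * (b ^ 2 * (a * d))) := by linarith
      _ ≤ 64 * b ^ 2 * (b ^ 2 + a * d) ^ 2 := by
          gcongr
          nlinarith [sq_nonneg (b ^ 2 - a * d)]
      _ = (8 * (b * (b ^ 2 + a * d))) ^ 2 := by ring
  have h4 : ∫ x, |((p t x * q t x) * s t x) * z t x| ≤ 1 / 200 * D + V / 4 / (1 / 200) :=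
    young_sqrt (by norm_num) hD (by positivity)
      (by nlinarith [mul_le_mul_of_nonneg_left hzD hV])
  linarith

/-- A bound for `‖u · ∇u‖²`. -/
theorem integral_convection_sq_le (hp : NormLE p t a b) (hs : NormLE s t b d) {ε : ℝ} (hε : 0 < ε)
    (ht : 0 ≤ t) : ∫ x, (p t x * s t x) ^ 2 ≤ ε * d + a * b ^ 2 / ε := by
  have h2 := hp.sq_integral_mul hs ht
  exact young_sqrt hε hs.right_nonneg
    (mul_nonneg hp.left_nonneg (sq_nonneg _)) (by linarith)

end Terms

/-! ### The maximum principle for the transport equation -/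

theorem hasDerivAt_max_zero_sq (s : ℝ) :
    HasDerivAt (fun s : ℝ => (max s 0) ^ 2) (2 * max s 0) s := by
  rw [hasDerivAt_iff_isLittleO]
  refine Asymptotics.IsBigO.trans_isLittleO (Asymptotics.IsBigO.of_bound 1 ?_)
    (Asymptotics.isLittleO_pow_sub_sub s one_lt_two)
  refine Eventually.of_forall fun y => ?_
  rw [Real.norm_eq_abs, Real.norm_eq_abs, Real.norm_eq_abs, sq_abs, abs_of_nonneg (sq_nonneg (y - s)),
    one_mul, smul_eq_mul, abs_le]
  rcases le_total y 0 with h1 | h1 <;> rcases le_total s 0 with h2 | h2 <;>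
    simp only [max_eq_right h1, max_eq_left h1, max_eq_right h2, max_eq_left h2] <;>
    constructor <;> nlinarith [sq_nonneg (y - s), sq_nonneg y, sq_nonneg s, h1, h2]

theorem integrable_of_abs_le_mul {h p q : Plane → ℝ} (hh : Continuous h) (hp : MemLp p 2)
    (hq : MemLp q 2) {C : ℝ} (hb : ∀ x, |h x| ≤ C * |p x * q x|) : Integrable h :=
  ((integrable_mul hp hq).abs.const_mul C).mono' hh.aestronglyMeasurable
    (Eventually.of_forall hb)

theorem le_of_transport {U : Fin 2 → ℝ → Plane → ℝ} {f : ℝ → Plane → ℝ} {c : ℝ}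
    (hU : ∀ i, Tame (U i)) (hf : Tame f) (hc : 0 ≤ c)
    (hdiv : ∀ t, 0 ≤ t → ∀ x, pd 0 (U 0 t) x + pd 1 (U 1 t) x = 0)
    (htr : ∀ t, 0 ≤ t → ∀ x,
      tderiv f t x + (U 0 t x * pd 0 (f t) x + U 1 t x * pd 1 (f t) x) = 0)
    (h0 : ∀ x, f 0 x ≤ c) {t : ℝ} (ht : 0 ≤ t) (x : Plane) : f t x ≤ c := by
  set P : ℝ → Plane → ℝ := fun t x => max (f t x - c) 0 with hP
  have P0 : ∀ t x, 0 ≤ P t x := fun t x => le_max_right _ _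
  have Ple : ∀ t x, P t x ≤ |f t x| := fun t x =>
    max_le (by linarith [le_abs_self (f t x)]) (abs_nonneg _)
  have Psq : ∀ t x, |P t x ^ 2| ≤ |f t x| * |f t x| := fun t x => by
    rw [abs_of_nonneg (sq_nonneg _), sq]
    exact mul_le_mul (Ple t x) (Ple t x) (P0 t x) (abs_nonneg _)
  have cP : ∀ {t}, 0 ≤ t → Continuous (P t) := fun ht =>
    ((hf.contDiff ht).continuous.sub continuous_const).max continuous_const
  have dP : ∀ {t}, 0 ≤ t → ∀ x, HasFDerivAt (fun y => P t y ^ 2)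
      ((2 * P t x) • fderiv ℝ (f t) x) x := fun {t} ht x => by
    have h1 : HasFDerivAt (fun y => f t y - c) (fderiv ℝ (f t) x) x :=
      ((hf.differentiable ht) x).hasFDerivAt.sub_const c
    exact HasDerivAt.comp_hasFDerivAt x (hasDerivAt_max_zero_sq (f t x - c)) h1
  have iP : ∀ {t}, 0 ≤ t → Integrable (fun x => P t x ^ 2) := fun {t} ht =>
    integrable_of_abs_le_mul (C := 1) ((cP ht).pow 2) (hf.memLp ht) (hf.memLp ht) fun x => by
      rw [one_mul, abs_mul]; exact Psq t x
  set K : ℝ → Plane → ℝ := fun t x => 2 * P t x * tderiv f t x with hK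
  have Kle : ∀ t x, |K t x| ≤ 2 * |f t x * tderiv f t x| := fun t x => by
    simp only [hK]
    rw [abs_mul, abs_mul, abs_two, abs_of_nonneg (P0 t x), abs_mul, mul_assoc]
    gcongr
    exact Ple t x
  have iK : ∀ {t}, 0 ≤ t → Integrable (K t) := fun {t} ht =>
    integrable_of_abs_le_mul ((continuous_const.mul (cP ht)).mul
      (hf.tderiv.contDiff ht).continuous) (hf.memLp ht) (hf.tderiv.memLp ht) (Kle t)
  have zK : ∀ {t}, 0 ≤ t → ∫ x, K t x = 0 := by
    intro t ht
    have dU := fun i => (hU i).differentiable ht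
    have e : ∀ i x, pd i (fun y => U i t y * P t y ^ 2) x
        = pd i (U i t) x * P t x ^ 2 + U i t x * (2 * P t x * pd i (f t) x) := by
      intro i x
      rw [pd_mul (dU i x) (dP ht x).differentiableAt]
      congr 2
      simp only [pd]
      rw [(dP ht x).fderiv]; simp
    have i1 : ∀ i, Integrable (fun y => U i t y * P t y ^ 2) := fun i =>
      integrable_of_abs_le_mul (C := 1) ((hU i).contDiff ht |>.continuous.mul ((cP ht).pow 2))
        (((hU i).mul hf).memLp ht) (hf.memLp ht) fun x => by
          rw [one_mul, abs_mul, abs_mul, abs_mul, mul_assoc]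
          exact mul_le_mul_of_nonneg_left (Psq t x) (abs_nonneg _)
    have i2 : ∀ i, Integrable (pd i (fun y => U i t y * P t y ^ 2)) := by
      intro i
      have e' : pd i (fun y => U i t y * P t y ^ 2)
        = fun x => pd i (U i t) x * P t x ^ 2 + U i t x * (2 * P t x * pd i (f t) x) :=
        funext (e i)
      rw [e']
      refine integrable_add ?_ ?_
      · exact integrable_of_abs_le_mul (C := 1)
          (((hU i).pd i).contDiff ht |>.continuous.mul ((cP ht).pow 2))
          ((((hU i).pd i).mul hf).memLp ht) (hf.memLp ht) fun x => by
            rw [one_mul, abs_mul, abs_mul, abs_mul, mul_assoc]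
            exact mul_le_mul_of_nonneg_left (Psq t x) (abs_nonneg _)
      · exact integrable_of_abs_le_mul (C := 2)
          ((hU i).contDiff ht |>.continuous.mul ((continuous_const.mul (cP ht)).mul
            ((hf.pd i).contDiff ht).continuous))
          (((hU i).mul (hf.pd i)).memLp ht) (hf.memLp ht) fun x => by
            rw [abs_mul, abs_mul, abs_mul, abs_mul, abs_mul, abs_two, abs_of_nonneg (P0 t x)]
            have := mul_le_mul_of_nonneg_left (Ple t x)
              (mul_nonneg (abs_nonneg (U i t x)) (abs_nonneg (pd i (f t) x)))
            linarith
    have z : ∀ i, ∫ x, pd i (fun y => U i t y * P t y ^ 2) x = 0 := fun i =>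
      integral_pd_eq_zero ((dU i).mul fun x => (dP ht x).differentiableAt) i (i1 i) (i2 i)
    have : ∀ x, K t x = -(pd 0 (fun y => U 0 t y * P t y ^ 2) x
        + pd 1 (fun y => U 1 t y * P t y ^ 2) x) := by
      intro x
      rw [e, e]
      simp only [hK]
      linear_combination 2 * P t x * htr t ht x + P t x ^ 2 * hdiv t ht x
    simp only [this]
    rw [integral_neg, integral_add (i2 0) (i2 1), z, z]; simp
  obtain ⟨M, hM⟩ := hf.integral_abs_mul_bdd hf.tderiv t
  have cPt : ContinuousOn (fun q : ℝ × Plane => P q.1 q.2) (Icc 0 t ×ˢ univ) := by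
    have h1 : ContinuousOn (fun q : ℝ × Plane => f q.1 q.2 - c) (Icc 0 t ×ˢ univ) :=
      (hf.continuousOn le_rfl).sub continuousOn_const
    exact h1.sup continuousOn_const
  have h := integral_sub_eq_of_hasDerivAt (F := fun t x => P t x ^ 2) (K := K) (a := 0) (b := t) ht
    (fun x => by
      have h1 : ContinuousOn (fun s => f s x - c) (Icc 0 t) :=
        (hf.continuousOn_left le_rfl x).sub continuousOn_const
      exact (h1.sup continuousOn_const).pow 2)
    (fun x s hs => (hasDerivAt_max_zero_sq (f s x - c)).comp s
      ((hf.hasDerivAt hs.1 x).sub_const c))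
    ((continuousOn_const.mul cPt).mul (hf.tderiv.continuousOn le_rfl))
    (M := 2 * M)
    (fun s hs => ⟨iK hs.1, by
      refine (integral_mono (iK hs.1).abs
        ((hf.integrable_mul hf.tderiv hs.1).abs.const_mul 2) (Kle s)).trans ?_
      rw [integral_const_mul]
      exact mul_le_mul_of_nonneg_left (hM s hs) zero_le_two⟩)
    (iP le_rfl) (iP ht)
  have hz : ∫ s in (0 : ℝ)..t, ∫ x, K s x = 0 := by
    rw [intervalIntegral.integral_congr (g := fun _ => (0 : ℝ)) fun s hs => ?_]
    · simp
    · rw [uIcc_of_le ht] at hs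
      exact zK hs.1
  have hP00 : ∀ x, P 0 x = 0 := fun x => max_eq_right (by linarith [h0 x])
  simp only [hz, hP00] at h
  have h1 : ∫ x, P t x ^ 2 = 0 := by simpa using h
  rw [integral_eq_zero_iff_of_nonneg (fun x => sq_nonneg _) (iP ht)] at h1
  have h2 := (Continuous.ae_eq_iff_eq volume ((cP ht).pow 2) continuous_const).1 h1
  have h3 : P t x ^ 2 = 0 := congrFun h2 x
  have h4 : P t x = 0 := by simpa using h3
  have h5 : f t x - c ≤ P t x := le_max_left _ _
  linarith

/-! ### Calculus of tame functions -/

section Rules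

variable {f g r : ℝ → Plane → ℝ} {t : ℝ}

theorem Tame.pd_add (hf : Tame f) (hg : Tame g) (i : Fin 2) (ht : 0 ≤ t) (x : Plane) :
    INS2D.pd i (fun x => f t x + g t x) x = INS2D.pd i (f t) x + INS2D.pd i (g t) x :=
  hf.sm.op_add hg.sm (some i) ht x

theorem Tame.pd_mul (hf : Tame f) (hg : Tame g) (i : Fin 2) (ht : 0 ≤ t) (x : Plane) :
    INS2D.pd i (fun x => f t x * g t x) x = INS2D.pd i (f t) x * g t x + f t x * INS2D.pd i (g t) x :=
  hf.sm.op_mul hg.sm (some i) ht x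

theorem Tame.tderiv_add (hf : Tame f) (hg : Tame g) (ht : 0 ≤ t) (x : Plane) :
    INS2D.tderiv (fun t x => f t x + g t x) t x = INS2D.tderiv f t x + INS2D.tderiv g t x :=
  hf.sm.op_add hg.sm none ht x

theorem Tame.tderiv_mul (hf : Tame f) (hg : Tame g) (ht : 0 ≤ t) (x : Plane) :
    INS2D.tderiv (fun t x => f t x * g t x) t x
      = INS2D.tderiv f t x * g t x + f t x * INS2D.tderiv g t x :=
  hf.sm.op_mul hg.sm none ht x

theorem Tame.tderiv_one_add_mul (hr : Tame r) (hf : Tame f) (ht : 0 ≤ t) (x : Plane) :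
    INS2D.tderiv (fun t x => (1 + r t x) * f t x) t x
      = INS2D.tderiv r t x * f t x + (1 + r t x) * INS2D.tderiv f t x := by
  simp only [add_mul, one_mul]
  rw [hf.tderiv_add (hr.mul hf) ht, hr.tderiv_mul hf ht]
  ring

theorem Tame.pd_one_add_mul (hr : Tame r) (hf : Tame f) (i : Fin 2) (ht : 0 ≤ t) (x : Plane) :
    INS2D.pd i (fun x => (1 + r t x) * f t x) x
      = INS2D.pd i (r t) x * f t x + (1 + r t x) * INS2D.pd i (f t) x := by
  simp only [add_mul, one_mul]
  rw [hf.pd_add (hr.mul hf) i ht, hr.pd_mul hf i ht]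
  ring

theorem Tame.tderiv_pd (hf : Tame f) (i : Fin 2) (ht : 0 ≤ t) :
    INS2D.tderiv (fun t => INS2D.pd i (f t)) t = INS2D.pd i (INS2D.tderiv f t) :=
  hf.sm.op_comm none (some i) ht

theorem Tame.pd_comm (hf : Tame f) (i j : Fin 2) (ht : 0 ≤ t) :
    INS2D.pd i (INS2D.pd j (f t)) = INS2D.pd j (INS2D.pd i (f t)) :=
  hf.sm.op_comm (some i) (some j) ht

theorem Tame.integral_pd_mul (hf : Tame f) (hg : Tame g) (i : Fin 2) (ht : 0 ≤ t) :
    ∫ x, INS2D.pd i (f t) x * g t x = - ∫ x, f t x * INS2D.pd i (g t) x :=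
  INS2D.integral_pd_mul (hf.differentiable ht) (hg.differentiable ht) i (hf.memLp ht)
    (hg.memLp ht) ((hf.pd i).memLp ht) ((hg.pd i).memLp ht)

/-- The Laplacian of a function of time and space. -/
noncomputable def lapl (f : ℝ → Plane → ℝ) (t : ℝ) (x : Plane) : ℝ :=
  pd 0 (pd 0 (f t)) x + pd 1 (pd 1 (f t)) x

theorem Tame.lapl (hf : Tame f) : Tame (lapl f) := ((hf.pd 0).pd 0).add ((hf.pd 1).pd 1)

theorem Tame.tderiv_lapl (hf : Tame f) (ht : 0 ≤ t) (x : Plane) :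
    INS2D.tderiv (INS2D.lapl f) t x = INS2D.lapl (INS2D.tderiv f) t x := by
  have h : ∀ i, INS2D.tderiv (fun t => INS2D.pd i (INS2D.pd i (f t))) t
      = INS2D.pd i (INS2D.pd i (INS2D.tderiv f t)) := fun i =>
    ((hf.pd i).tderiv_pd i ht).trans (by rw [hf.tderiv_pd i ht])
  have := ((hf.pd 0).pd 0).tderiv_add ((hf.pd 1).pd 1) ht x
  rw [h, h] at this
  exact this

theorem Tame.integral_mul_lapl (hf : Tame f) (hg : Tame g) (ht : 0 ≤ t) :
    ∫ x, g t x * INS2D.lapl f t x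
      = - ((∫ x, INS2D.pd 0 (f t) x * INS2D.pd 0 (g t) x)
        + ∫ x, INS2D.pd 1 (f t) x * INS2D.pd 1 (g t) x) := by
  have h : ∀ i, ∫ x, INS2D.pd i (f t) x * INS2D.pd i (g t) x
      = - ∫ x, g t x * INS2D.pd i (INS2D.pd i (f t)) x := by
    intro i
    have := (hf.pd i).integral_pd_mul hg i ht
    simp only [mul_comm (g t _)]
    linarith
  rw [h, h, ← neg_add, neg_neg, ← integral_add (hg.integrable_mul ((hf.pd 0).pd 0) ht)
    (hg.integrable_mul ((hf.pd 1).pd 1) ht)]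
  simp only [INS2D.lapl, mul_add]

theorem Tame.integral_mul_lapl_self (hf : Tame f) (ht : 0 ≤ t) :
    ∫ x, f t x * INS2D.lapl f t x = - gradSqL2 (f t) := by
  rw [hf.integral_mul_lapl hf ht, gradSqL2_real]
  simp only [sq]

/-- `‖∇²f‖ = ‖Δf‖`. -/
theorem Tame.hessSqL2_eq (hf : Tame f) (ht : 0 ≤ t) :
    hessSqL2 (f t) = ∫ x, INS2D.lapl f t x ^ 2 := by
  have h00 := (hf.pd 0).pd 0
  have h11 := (hf.pd 1).pd 1
  have h01 := (hf.pd 1).pd 0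
  have e : ∫ x, INS2D.pd 0 (INS2D.pd 0 (f t)) x * INS2D.pd 1 (INS2D.pd 1 (f t)) x
      = ∫ x, INS2D.pd 0 (INS2D.pd 1 (f t)) x ^ 2 := by
    have e1 := (hf.pd 0).integral_pd_mul h11 0 ht
    have e2 := (hf.pd 0).integral_pd_mul h01 1 ht
    have c1 : INS2D.pd 0 (INS2D.pd 1 (INS2D.pd 1 (f t)))
        = INS2D.pd 1 (INS2D.pd 0 (INS2D.pd 1 (f t))) := (hf.pd 1).pd_comm 0 1 ht
    have c2 : INS2D.pd 1 (INS2D.pd 0 (f t)) = INS2D.pd 0 (INS2D.pd 1 (f t)) := hf.pd_comm 1 0 ht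
    rw [c1] at e1
    rw [c2] at e2
    simp only [sq]
    linarith
  have c2 : INS2D.pd 1 (INS2D.pd 0 (f t)) = INS2D.pd 0 (INS2D.pd 1 (f t)) := hf.pd_comm 1 0 ht
  have e3 : ∀ x, INS2D.lapl f t x ^ 2 = (INS2D.pd 0 (INS2D.pd 0 (f t)) x ^ 2
      + INS2D.pd 1 (INS2D.pd 1 (f t)) x ^ 2)
      + 2 * (INS2D.pd 0 (INS2D.pd 0 (f t)) x * INS2D.pd 1 (INS2D.pd 1 (f t)) x) := by
    intro x; simp only [INS2D.lapl]; ring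
  simp only [e3]
  rw [integral_add (integrable_add (h00.integrable_sq ht) (h11.integrable_sq ht))
    ((h00.integrable_mul h11 ht).const_mul 2), integral_add (h00.integrable_sq ht)
    (h11.integrable_sq ht), integral_const_mul, e]
  simp only [hessSqL2, Fin.sum_univ_two, sqL2_real, c2]
  ring

theorem Tame.intervalIntegrable_deriv (hf : Tame f) (hg : Tame g) {a b : ℝ} (ha : 0 ≤ a)
    (hab : a ≤ b) : IntervalIntegrable (fun t => ∫ x,
      (INS2D.tderiv f t x * g t x + f t x * INS2D.tderiv g t x)) volume a b := by
  obtain ⟨M, hM⟩ := hf.mul_deriv_bdd hg b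
  exact intervalIntegrable_integral hab
    (((hf.tderiv.continuousOn ha).mul (hg.continuousOn ha)).add
      ((hf.continuousOn ha).mul (hg.tderiv.continuousOn ha)))
    (fun t ht => hM t ⟨ha.trans ht.1, ht.2⟩)

theorem Tame.sum_integral_mul_sub {ι : Type*} [Fintype ι] {f g : ι → ℝ → Plane → ℝ}
    (hf : ∀ i, Tame (f i)) (hg : ∀ i, Tame (g i)) {a b : ℝ} (ha : 0 ≤ a) (hab : a ≤ b) :
    (∑ i, ∫ x, f i b x * g i b x) - ∑ i, ∫ x, f i a x * g i a x
      = ∫ t in a..b, ∑ i, ∫ x,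
        (INS2D.tderiv (f i) t x * g i t x + f i t x * INS2D.tderiv (g i) t x) := by
  rw [intervalIntegral.integral_finsetSum, ← Finset.sum_sub_distrib]
  · exact Finset.sum_congr rfl fun i _ => (hf i).integral_mul_sub (hg i) ha hab
  · exact fun i _ => (hf i).intervalIntegrable_deriv (hg i) ha hab

theorem Tame.sum_integral_mul_sub_le {ι : Type*} [Fintype ι] {f g : ι → ℝ → Plane → ℝ}
    (hf : ∀ i, Tame (f i)) (hg : ∀ i, Tame (g i)) {a b : ℝ} (ha : 0 ≤ a) (hab : a ≤ b)
    {φ : ℝ → ℝ} (hφ : ContinuousOn φ (Icc a b))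
    (h : ∀ t ∈ Icc a b, ∑ i, ∫ x,
      (INS2D.tderiv (f i) t x * g i t x + f i t x * INS2D.tderiv (g i) t x) ≤ φ t) :
    (∑ i, ∫ x, f i b x * g i b x) - ∑ i, ∫ x, f i a x * g i a x ≤ ∫ t in a..b, φ t := by
  rw [Tame.sum_integral_mul_sub hf hg ha hab]
  refine intervalIntegral.integral_mono_on hab ?_ (hφ.intervalIntegrable_of_Icc hab) h
  rw [intervalIntegrable_iff_integrableOn_Ioc_of_le hab]
  exact integrable_finsetSum _ fun i _ => ((hf i).intervalIntegrable_deriv (hg i) ha hab).1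

end Rules

/-! ### The system in coordinates -/

/-- The Navier–Stokes system in coordinates, for the density `1 + r`, the velocity `U` and the
pressure gradient `G`. -/
structure System (r : ℝ → Plane → ℝ) (U G : Fin 2 → ℝ → Plane → ℝ) : Prop where
  tame_r : Tame r
  tame_U : ∀ i, Tame (U i)
  tame_G : ∀ i, Tame (G i)
  mass : ∀ t, 0 ≤ t → ∀ x, tderiv r t x + (U 0 t x * pd 0 (r t) x + U 1 t x * pd 1 (r t) x) = 0
  momentum : ∀ t, 0 ≤ t → ∀ i x, (1 + r t x) * tderiv (U i) t x
    + (1 + r t x) * (U 0 t x * pd 0 (U i t) x + U 1 t x * pd 1 (U i t) x)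
    - lapl (U i) t x + G i t x = 0
  div : ∀ t, 0 ≤ t → ∀ x, pd 0 (U 0 t) x + pd 1 (U 1 t) x = 0
  curl : ∀ t, 0 ≤ t → ∀ x, pd 0 (G 1 t) x = pd 1 (G 0 t) x
  initial_le : ∀ x, |r 0 x| ≤ 1 / 4

namespace System

variable {r : ℝ → Plane → ℝ} {U G : Fin 2 → ℝ → Plane → ℝ} {t : ℝ}

theorem abs_r_le (h : System r U G) (ht : 0 ≤ t) (x : Plane) : |r t x| ≤ 1 / 4 := by
  have h1 := le_of_transport h.tame_U h.tame_r (c := 1 / 4) (by norm_num) h.div h.mass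
    (fun x => (abs_le.1 (h.initial_le x)).2) ht x
  have hm : ∀ t, 0 ≤ t → ∀ x, tderiv (fun t x => - r t x) t x
      + (U 0 t x * pd 0 (fun x => - r t x) x + U 1 t x * pd 1 (fun x => - r t x) x) = 0 := by
    intro t ht x
    have e : ∀ o, op o (fun t x => - r t x) t x = - op o r t x := fun o => by
      simpa using h.tame_r.sm.op_clm (-ContinuousLinearMap.id ℝ ℝ) o ht x
    have e0 : tderiv (fun t x => - r t x) t x = - tderiv r t x := e none
    have e1 : pd 0 (fun x => - r t x) x = - pd 0 (r t) x := e (some 0)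
    have e2 : pd 1 (fun x => - r t x) x = - pd 1 (r t) x := e (some 1)
    rw [e0, e1, e2]
    linear_combination - h.mass t ht x
  have h2 := le_of_transport h.tame_U h.tame_r.neg (c := 1 / 4) (by norm_num) h.div hm
    (fun x => by linarith [(abs_le.1 (h.initial_le x)).1]) ht x
  rw [abs_le]
  constructor <;> linarith

/-- The transport of a product by the flow. -/
theorem integral_transport (h : System r U G) {f g : ℝ → Plane → ℝ} (hf : Tame f) (hg : Tame g)
    (ht : 0 ≤ t) :
    ∫ x, (tderiv r t x * (f t x * g t x)
      - (1 + r t x) * (U 0 t x * (pd 0 (f t) x * g t x + f t x * pd 0 (g t) x)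
        + U 1 t x * (pd 1 (f t) x * g t x + f t x * pd 1 (g t) x))) = 0 := by
  have hw : ∀ i, Tame (fun t x => (1 + r t x) * U i t x) := fun i =>
    h.tame_r.one_add_mul (h.tame_U i)
  have hfg := hf.mul hg
  have z : ∀ i, ∫ x, (pd i (fun x => (1 + r t x) * U i t x) x * (f t x * g t x)
      + ((1 + r t x) * U i t x) * pd i (fun x => f t x * g t x) x) = 0 := by
    intro i
    have e := (hw i).integral_pd_mul hfg i ht
    rw [integral_add (((hw i).pd i).integrable_mul hfg ht) ((hw i).integrable_mul (hfg.pd i) ht), e]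
    ring
  have i : ∀ i, Integrable fun x => (pd i (fun x => (1 + r t x) * U i t x) x * (f t x * g t x)
      + ((1 + r t x) * U i t x) * pd i (fun x => f t x * g t x) x) := fun i =>
    integrable_add (((hw i).pd i).integrable_mul hfg ht) ((hw i).integrable_mul (hfg.pd i) ht)
  have key : ∀ x, (tderiv r t x * (f t x * g t x)
      - (1 + r t x) * (U 0 t x * (pd 0 (f t) x * g t x + f t x * pd 0 (g t) x)
        + U 1 t x * (pd 1 (f t) x * g t x + f t x * pd 1 (g t) x)))
      = -((pd 0 (fun x => (1 + r t x) * U 0 t x) x * (f t x * g t x)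
      + ((1 + r t x) * U 0 t x) * pd 0 (fun x => f t x * g t x) x)
      + (pd 1 (fun x => (1 + r t x) * U 1 t x) x * (f t x * g t x)
      + ((1 + r t x) * U 1 t x) * pd 1 (fun x => f t x * g t x) x)) := by
    intro x
    rw [h.tame_r.pd_one_add_mul (h.tame_U 0) 0 ht, h.tame_r.pd_one_add_mul (h.tame_U 1) 1 ht,
      hf.pd_mul hg 0 ht, hf.pd_mul hg 1 ht]
    linear_combination (f t x * g t x) * h.mass t ht x
      + (1 + r t x) * (f t x * g t x) * h.div t ht x
  simp only [key]
  rw [integral_neg, integral_add (i 0) (i 1), z, z]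
  simp

theorem tame_V (h : System r U G) (i : Fin 2) : Tame (tderiv (U i)) := (h.tame_U i).tderiv

/-- The convection term `u · ∇uⁱ`. -/
noncomputable def conv (U : Fin 2 → ℝ → Plane → ℝ) (i : Fin 2) (t : ℝ) (x : Plane) : ℝ :=
  U 0 t x * pd 0 (U i t) x + U 1 t x * pd 1 (U i t) x

theorem tame_conv (h : System r U G) (i : Fin 2) : Tame (conv U i) :=
  ((h.tame_U 0).mul ((h.tame_U i).pd 0)).add ((h.tame_U 1).mul ((h.tame_U i).pd 1))

theorem lapl_eq (h : System r U G) (ht : 0 ≤ t) (i : Fin 2) (x : Plane) :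
    lapl (U i) t x = (1 + r t x) * tderiv (U i) t x + (1 + r t x) * conv U i t x + G i t x := by
  have := h.momentum t ht i x
  simp only [conv]
  linarith

theorem integral_pressure (h : System r U G) {v : Fin 2 → ℝ → Plane → ℝ} (hv : ∀ i, Tame (v i))
    (ht : 0 ≤ t) (hdiv : ∀ x, pd 0 (v 0 t) x + pd 1 (v 1 t) x = 0) :
    ∑ i, ∫ x, G i t x * v i t x = 0 := by
  rw [Fin.sum_univ_two, ← integral_add ((h.tame_G 0).integrable_mul (hv 0) ht)
    ((h.tame_G 1).integrable_mul (hv 1) ht)]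
  exact integral_curlFree_mul_divFree (g := fun i => G i t) (v := fun i => v i t)
    (fun i => ((h.tame_G i).contDiff ht).of_le (by norm_cast))
    (fun i => ((hv i).contDiff ht).of_le (by norm_cast)) (fun i => (h.tame_G i).memLp ht)
    (fun i => (hv i).memLp ht) (fun i j => ((h.tame_G j).pd i).memLp ht)
    (fun i j => ((hv j).pd i).memLp ht) (h.curl t ht) hdiv

theorem tderiv_congr_zero {f : ℝ → Plane → ℝ} (hf : ∀ t, 0 ≤ t → ∀ x, f t x = 0) (ht : 0 ≤ t)
    (x : Plane) : tderiv f t x = 0 := by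
  have := op_congr (f := f) (g := fun _ _ => (0 : ℝ)) (fun t ht => funext (hf t ht)) none t ht
  have h2 := congrFun this x
  simpa [op, INS2D.tderiv] using h2

theorem div_V (h : System r U G) (ht : 0 ≤ t) (x : Plane) :
    pd 0 (tderiv (U 0) t) x + pd 1 (tderiv (U 1) t) x = 0 := by
  have := tderiv_congr_zero h.div ht x
  rwa [((h.tame_U 0).pd 0).tderiv_add ((h.tame_U 1).pd 1) ht, (h.tame_U 0).tderiv_pd 0 ht,
    (h.tame_U 1).tderiv_pd 1 ht] at this

theorem div_lapl (h : System r U G) (ht : 0 ≤ t) (x : Plane) :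
    pd 0 (lapl (U 0) t) x + pd 1 (lapl (U 1) t) x = 0 := by
  have hU := h.tame_U
  have e : ∀ i j, pd i (pd j (pd j (U i t))) = pd j (pd j (pd i (U i t))) := fun i j =>
    (((hU i).pd j).pd_comm i j ht).trans (by rw [(hU i).pd_comm i j ht])
  have e1 : ∀ i, pd i (lapl (U i) t) x = pd 0 (pd 0 (pd i (U i t))) x
      + pd 1 (pd 1 (pd i (U i t))) x := by
    intro i
    rw [← e, ← e]
    exact (((hU i).pd 0).pd 0).pd_add (((hU i).pd 1).pd 1) i ht x
  have z : ∀ j, pd j (pd j (pd 0 (U 0 t))) x + pd j (pd j (pd 1 (U 1 t))) x = 0 := by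
    intro j
    have hz : (fun x => pd 0 (U 0 t) x + pd 1 (U 1 t) x) = fun _ => 0 := funext (h.div t ht)
    have p1 : (fun x => pd j (pd 0 (U 0 t)) x + pd j (pd 1 (U 1 t)) x) = fun _ => 0 := by
      ext x
      rw [← ((hU 0).pd 0).pd_add ((hU 1).pd 1) j ht x, hz]
      simp [pd]
    rw [← (((hU 0).pd 0).pd j).pd_add (((hU 1).pd 1).pd j) j ht x, p1]
    simp [pd]
  rw [e1, e1]
  linear_combination z 0 + z 1

/-- The time derivative of the pressure gradient is orthogonal to that of the velocity. -/
theorem integral_tderiv_pressure (h : System r U G) (ht : 0 ≤ t) :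
    ∑ i, ∫ x, tderiv (G i) t x * tderiv (U i) t x = 0 := by
  have hG := fun i => (h.tame_G i).tderiv
  have hv := h.tame_V
  rw [Fin.sum_univ_two, ← integral_add ((hG 0).integrable_mul (hv 0) ht)
    ((hG 1).integrable_mul (hv 1) ht)]
  refine integral_curlFree_mul_divFree (g := fun i => tderiv (G i) t)
    (v := fun i => tderiv (U i) t)
    (fun i => ((hG i).contDiff ht).of_le (by norm_cast))
    (fun i => ((hv i).contDiff ht).of_le (by norm_cast)) (fun i => (hG i).memLp ht)
    (fun i => (hv i).memLp ht) (fun i j => ((hG j).pd i).memLp ht)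
    (fun i j => ((hv j).pd i).memLp ht) (fun x => ?_) (h.div_V ht)
  have := op_congr (f := fun t => pd 0 (G 1 t)) (g := fun t => pd 1 (G 0 t))
    (fun t ht => funext (h.curl t ht)) none t ht
  have h2 : tderiv (fun t => pd 0 (G 1 t)) t x = tderiv (fun t => pd 1 (G 0 t)) t x :=
    congrFun this x
  rwa [(h.tame_G 1).tderiv_pd 0 ht, (h.tame_G 0).tderiv_pd 1 ht] at h2

/-- The momentum equation differentiated in time. -/
theorem tderiv_momentum (h : System r U G) (ht : 0 ≤ t) (i : Fin 2) (x : Plane) :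
    lapl (tderiv (U i)) t x = tderiv r t x * tderiv (U i) t x
      + (1 + r t x) * tderiv (tderiv (U i)) t x
      + (tderiv r t x * conv U i t x + (1 + r t x) * tderiv (conv U i) t x)
      + tderiv (G i) t x := by
  have hV := h.tame_V i
  have hc := h.tame_conv i
  have := op_congr (f := lapl (U i)) (g := fun t x => (1 + r t x) * tderiv (U i) t x
    + (1 + r t x) * conv U i t x + G i t x) (fun t ht => funext (h.lapl_eq ht i)) none t ht
  have h2 : tderiv (lapl (U i)) t x = tderiv (fun t x => (1 + r t x) * tderiv (U i) t x
    + (1 + r t x) * conv U i t x + G i t x) t x := congrFun this x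
  rwa [(h.tame_U i).tderiv_lapl ht, ((h.tame_r.one_add_mul hV).add
    (h.tame_r.one_add_mul hc)).tderiv_add (h.tame_G i) ht, (h.tame_r.one_add_mul hV).tderiv_add
    (h.tame_r.one_add_mul hc) ht, h.tame_r.tderiv_one_add_mul hV ht,
    h.tame_r.tderiv_one_add_mul hc ht] at h2

theorem tderiv_conv (h : System r U G) (ht : 0 ≤ t) (i : Fin 2) (x : Plane) :
    tderiv (conv U i) t x
      = (tderiv (U 0) t x * pd 0 (U i t) x + U 0 t x * pd 0 (tderiv (U i) t) x)
      + (tderiv (U 1) t x * pd 1 (U i t) x + U 1 t x * pd 1 (tderiv (U i) t) x) := by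
  have hU := h.tame_U
  have e := ((hU 0).mul ((hU i).pd 0)).tderiv_add ((hU 1).mul ((hU i).pd 1)) ht x
  rwa [(hU 0).tderiv_mul ((hU i).pd 0) ht, (hU 1).tderiv_mul ((hU i).pd 1) ht,
    (hU i).tderiv_pd 0 ht, (hU i).tderiv_pd 1 ht] at e

theorem pd_conv (h : System r U G) (ht : 0 ≤ t) (i j : Fin 2) (x : Plane) :
    pd j (conv U i t) x
      = (pd j (U 0 t) x * pd 0 (U i t) x + U 0 t x * pd j (pd 0 (U i t)) x)
      + (pd j (U 1 t) x * pd 1 (U i t) x + U 1 t x * pd j (pd 1 (U i t)) x) := by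
  have hU := h.tame_U
  have e := ((hU 0).mul ((hU i).pd 0)).pd_add ((hU 1).mul ((hU i).pd 1)) j ht x
  rwa [(hU 0).pd_mul ((hU i).pd 0) j ht, (hU 1).pd_mul ((hU i).pd 1) j ht] at e

end System

/-- `h` is integrable with `L¹` norm at most `B`. -/
def L1LE (h : Plane → ℝ) (B : ℝ) : Prop := Integrable h ∧ ∫ x, |h x| ≤ B

theorem L1LE.add {f g : Plane → ℝ} {A B : ℝ} (hf : L1LE f A) (hg : L1LE g B) :
    L1LE (fun x => f x + g x) (A + B) := by
  refine ⟨integrable_add hf.1 hg.1, ?_⟩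
  calc ∫ x, |f x + g x| ≤ ∫ x, (|f x| + |g x|) :=
        integral_mono (integrable_add hf.1 hg.1).abs (integrable_add hf.1.abs hg.1.abs)
          fun x => abs_add_le _ _
    _ ≤ A + B := by rw [integral_add hf.1.abs hg.1.abs]; exact add_le_add hf.2 hg.2

theorem L1LE.const_mul {f : Plane → ℝ} {A : ℝ} (hf : L1LE f A) {c : ℝ} (hc : 0 ≤ c) :
    L1LE (fun x => c * f x) (c * A) := by
  refine ⟨hf.1.const_mul c, ?_⟩
  simp only [abs_mul, abs_of_nonneg hc]
  rw [integral_const_mul]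
  exact mul_le_mul_of_nonneg_left hf.2 hc

namespace System

variable {r : ℝ → Plane → ℝ} {U G : Fin 2 → ℝ → Plane → ℝ} {t : ℝ}

/-- `‖√ρ f‖²` for the density `ρ = 1 + r`. -/
noncomputable def wsq (r : ℝ → Plane → ℝ) (f : Fin 2 → ℝ → Plane → ℝ) (t : ℝ) : ℝ :=
  ∑ i, ∫ x, ((1 + r t x) * f i t x) * f i t x

/-- `‖f‖²`. -/
noncomputable def vsq (f : Fin 2 → ℝ → Plane → ℝ) (t : ℝ) : ℝ := ∑ i, sqL2 (f i t)

/-- `‖∇f‖²`. -/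
noncomputable def vgrad (f : Fin 2 → ℝ → Plane → ℝ) (t : ℝ) : ℝ := ∑ i, gradSqL2 (f i t)

/-- `‖∇²f‖²`. -/
noncomputable def vhess (f : Fin 2 → ℝ → Plane → ℝ) (t : ℝ) : ℝ := ∑ i, hessSqL2 (f i t)

/-- The time derivatives of the components. -/
noncomputable abbrev vel (U : Fin 2 → ℝ → Plane → ℝ) (i : Fin 2) : ℝ → Plane → ℝ := tderiv (U i)

theorem hessSqL2_nonneg (f : Plane → ℝ) : 0 ≤ hessSqL2 f :=
  Finset.sum_nonneg fun _ _ => Finset.sum_nonneg fun _ _ => sqL2_nonneg _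

theorem vsq_nonneg (f : Fin 2 → ℝ → Plane → ℝ) (t : ℝ) : 0 ≤ vsq f t :=
  Finset.sum_nonneg fun _ _ => sqL2_nonneg _

theorem vgrad_nonneg (f : Fin 2 → ℝ → Plane → ℝ) (t : ℝ) : 0 ≤ vgrad f t :=
  Finset.sum_nonneg fun _ _ => gradSqL2_nonneg _

theorem vhess_nonneg (f : Fin 2 → ℝ → Plane → ℝ) (t : ℝ) : 0 ≤ vhess f t :=
  Finset.sum_nonneg fun _ _ => hessSqL2_nonneg _

theorem integrable_rho_mul (h : System r U G) {f g : ℝ → Plane → ℝ} (hf : Tame f) (hg : Tame g)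
    (ht : 0 ≤ t) : Integrable fun x => ((1 + r t x) * f t x) * g t x :=
  (h.tame_r.one_add_mul hf).integrable_mul hg ht

theorem rho_bounds (h : System r U G) (ht : 0 ≤ t) (x : Plane) :
    3 / 4 ≤ 1 + r t x ∧ 1 + r t x ≤ 5 / 4 := by
  have := abs_le.1 (h.abs_r_le ht x)
  constructor <;> linarith [this.1, this.2]

theorem sqL2_le_rho (h : System r U G) {f : ℝ → Plane → ℝ} (hf : Tame f) (ht : 0 ≤ t) :
    sqL2 (f t) ≤ 4 / 3 * ∫ x, ((1 + r t x) * f t x) * f t x := by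
  rw [sqL2_real, ← integral_const_mul]
  refine integral_mono (hf.integrable_sq ht) ((h.integrable_rho_mul hf hf ht).const_mul _)
    fun x => ?_
  have := (h.rho_bounds ht x).1
  beta_reduce
  nlinarith [mul_le_mul_of_nonneg_right this (sq_nonneg (f t x))]

theorem vsq_le_wsq (h : System r U G) {f : Fin 2 → ℝ → Plane → ℝ} (hf : ∀ i, Tame (f i))
    (ht : 0 ≤ t) : vsq f t ≤ 4 / 3 * wsq r f t := by
  rw [vsq, wsq, Finset.mul_sum]
  exact Finset.sum_le_sum fun i _ => h.sqL2_le_rho (hf i) ht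

theorem wsq_nonneg (h : System r U G) {f : Fin 2 → ℝ → Plane → ℝ} (hf : ∀ i, Tame (f i))
    (ht : 0 ≤ t) : 0 ≤ wsq r f t := by
  have := h.vsq_le_wsq hf ht
  have := vsq_nonneg f t
  linarith

theorem abs_integral_rho_mul_le (h : System r U G) {f : Plane → ℝ} {B : ℝ} (hf : L1LE f B)
    (ht : 0 ≤ t) : |∫ x, (1 + r t x) * f x| ≤ 5 / 4 * B := by
  calc |∫ x, (1 + r t x) * f x| ≤ ∫ x, |(1 + r t x) * f x| := abs_integral_le_integral_abs
    _ ≤ ∫ x, 5 / 4 * |f x| := by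
        refine integral_mono_of_nonneg (Eventually.of_forall fun _ => abs_nonneg _)
          (hf.1.abs.const_mul _) (Eventually.of_forall fun x => ?_)
        beta_reduce
        obtain ⟨h1, h2⟩ := h.rho_bounds ht x
        rw [abs_mul, abs_of_nonneg (by linarith : 0 ≤ 1 + r t x)]
        exact mul_le_mul_of_nonneg_right h2 (abs_nonneg _)
    _ ≤ 5 / 4 * B := by
        rw [integral_const_mul]
        exact mul_le_mul_of_nonneg_left hf.2 (by norm_num)

/-! ### Identities -/

/-- The energy balance. -/
theorem energy_deriv (h : System r U G) (ht : 0 ≤ t) :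
    ∑ i, ∫ x, (tderiv (fun t x => (1 + r t x) * U i t x) t x * U i t x
      + ((1 + r t x) * U i t x) * tderiv (U i) t x) = -2 * vgrad U t := by
  have hr := h.tame_r
  have key : ∀ i, ∫ x, (tderiv (fun t x => (1 + r t x) * U i t x) t x * U i t x
      + ((1 + r t x) * U i t x) * tderiv (U i) t x)
      = -2 * gradSqL2 (U i t) - 2 * ∫ x, G i t x * U i t x := by
    intro i
    have hU := h.tame_U i
    have hV := h.tame_V i
    have hG := h.tame_G i
    have e : ∀ x, (tderiv (fun t x => (1 + r t x) * U i t x) t x * U i t x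
        + ((1 + r t x) * U i t x) * tderiv (U i) t x)
        - (2 * (U i t x * lapl (U i) t x) - 2 * (G i t x * U i t x))
        = (tderiv r t x * (U i t x * U i t x)
        - (1 + r t x) * (U 0 t x * (pd 0 (U i t) x * U i t x + U i t x * pd 0 (U i t) x)
          + U 1 t x * (pd 1 (U i t) x * U i t x + U i t x * pd 1 (U i t) x))) := by
      intro x
      rw [hr.tderiv_one_add_mul hU ht, h.lapl_eq ht i x, conv]
      ring
    have tr := h.integral_transport hU hU ht
    simp only [← e] at tr
    have i1 : Integrable fun x => (tderiv (fun t x => (1 + r t x) * U i t x) t x * U i t x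
        + ((1 + r t x) * U i t x) * tderiv (U i) t x) :=
      integrable_add ((hr.one_add_mul hU).tderiv.integrable_mul hU ht)
        ((hr.one_add_mul hU).integrable_mul hV ht)
    have i2 := (hU.integrable_mul hU.lapl ht).const_mul 2
    have i3 := (hG.integrable_mul hU ht).const_mul 2
    have i4 : Integrable fun x => 2 * (U i t x * lapl (U i) t x) - 2 * (G i t x * U i t x) :=
      i2.sub i3
    rw [integral_sub i1 i4, integral_sub i2 i3, integral_const_mul, integral_const_mul,
      hU.integral_mul_lapl_self ht] at tr
    linarith
  have hp := h.integral_pressure h.tame_U ht (h.div t ht)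
  rw [Fin.sum_univ_two] at hp ⊢
  rw [key, key, vgrad, Fin.sum_univ_two]
  linarith

/-- The balance of `‖∇u‖²`. -/
theorem grad_deriv (h : System r U G) (ht : 0 ≤ t) :
    ∑ p : Fin 2 × Fin 2, ∫ x, (tderiv (fun t => pd p.2 (U p.1 t)) t x * pd p.2 (U p.1 t) x
      + pd p.2 (U p.1 t) x * tderiv (fun t => pd p.2 (U p.1 t)) t x)
      = -2 * wsq r (vel U) t - 2 * ∑ i, ∫ x, ((1 + r t x) * conv U i t x) * tderiv (U i) t x := by
  have e1 : ∀ i j, ∫ x, (tderiv (fun t => pd j (U i t)) t x * pd j (U i t) x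
      + pd j (U i t) x * tderiv (fun t => pd j (U i t)) t x)
      = 2 * ∫ x, pd j (U i t) x * pd j (tderiv (U i) t) x := by
    intro i j
    rw [← integral_const_mul, (h.tame_U i).tderiv_pd j ht]
    congr 1; ext x; ring
  have e2 : ∀ i, (∫ x, pd 0 (U i t) x * pd 0 (tderiv (U i) t) x)
      + (∫ x, pd 1 (U i t) x * pd 1 (tderiv (U i) t) x)
      = - ((∫ x, ((1 + r t x) * tderiv (U i) t x) * tderiv (U i) t x)
        + (∫ x, ((1 + r t x) * conv U i t x) * tderiv (U i) t x)
        + ∫ x, G i t x * tderiv (U i) t x) := by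
    intro i
    have hV := h.tame_V i
    have hc := h.tame_conv i
    have hl := (h.tame_U i).integral_mul_lapl hV ht
    have i1 := h.integrable_rho_mul hV hV ht
    have i2 := h.integrable_rho_mul hc hV ht
    have i3 := (h.tame_G i).integrable_mul hV ht
    rw [← integral_add i1 i2, ← integral_add (integrable_add i1 i2) i3]
    have : ∀ x, tderiv (U i) t x * lapl (U i) t x
        = ((1 + r t x) * tderiv (U i) t x) * tderiv (U i) t x
          + ((1 + r t x) * conv U i t x) * tderiv (U i) t x + G i t x * tderiv (U i) t x := by
      intro x; rw [h.lapl_eq ht i x]; ring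
    simp only [this] at hl
    linarith
  have hp := h.integral_pressure h.tame_V ht (h.div_V ht)
  rw [Fintype.sum_prod_type]
  simp only [Fin.sum_univ_two, wsq] at hp ⊢
  rw [e1, e1, e1, e1]
  have a0 := e2 0
  have a1 := e2 1
  linarith

/-- The cubic and quartic terms in the balance of `‖√ρ ∂ₜu‖²`. -/
noncomputable def remTerm (U : Fin 2 → ℝ → Plane → ℝ) (t : ℝ) (i j k : Fin 2) (x : Plane) : ℝ :=
  (2 * ((U j t x * tderiv (U i) t x) * (pd j (U k t) x * pd k (U i t) x))
    + 2 * (((U j t x * U k t x) * tderiv (U i) t x) * pd j (pd k (U i t)) x))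
    + 2 * (((U j t x * U k t x) * pd k (U i t) x) * pd j (tderiv (U i) t) x)

/-- The nonlinear terms in the balance of `‖√ρ ∂ₜu‖²`. -/
noncomputable def rem (U : Fin 2 → ℝ → Plane → ℝ) (t : ℝ) (i j : Fin 2) (x : Plane) : ℝ :=
  (4 * ((U j t x * tderiv (U i) t x) * pd j (tderiv (U i) t) x)
    + 2 * ((tderiv (U j) t x * tderiv (U i) t x) * pd j (U i t) x))
    + (remTerm U t i j 0 x + remTerm U t i j 1 x)

/-- The balance of `‖√ρ ∂ₜu‖²`. -/
theorem vel_deriv (h : System r U G) (ht : 0 ≤ t)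
    (hR : ∀ i j, Integrable (rem U t i j)) :
    ∑ i, ∫ x, (tderiv (fun t x => (1 + r t x) * tderiv (U i) t x) t x * tderiv (U i) t x
      + ((1 + r t x) * tderiv (U i) t x) * tderiv (tderiv (U i)) t x)
      = -2 * vgrad (vel U) t - ∑ i, ∫ x, (1 + r t x) * (rem U t i 0 x + rem U t i 1 x) := by
  have hr := h.tame_r
  have key : ∀ i, ∫ x, (tderiv (fun t x => (1 + r t x) * tderiv (U i) t x) t x * tderiv (U i) t x
      + ((1 + r t x) * tderiv (U i) t x) * tderiv (tderiv (U i)) t x)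
      = -2 * gradSqL2 (tderiv (U i) t) - 2 * (∫ x, tderiv (G i) t x * tderiv (U i) t x)
        - ∫ x, (1 + r t x) * (rem U t i 0 x + rem U t i 1 x) := by
    intro i
    have hV := h.tame_V i
    have hc := h.tame_conv i
    have hG := (h.tame_G i).tderiv
    have tr1 := h.integral_transport hV hV ht
    have tr2 := h.integral_transport hc hV ht
    have iR : Integrable fun x => (1 + r t x) * (rem U t i 0 x + rem U t i 1 x) := by
      refine ((integrable_add (hR i 0) (hR i 1)).norm.const_mul (5 / 4)).mono' ?_
        (Eventually.of_forall fun x => ?_)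
      · exact ((continuous_const.add (hr.contDiff ht).continuous).aestronglyMeasurable).mul
          (integrable_add (hR i 0) (hR i 1)).aestronglyMeasurable
      · obtain ⟨h1, h2⟩ := h.rho_bounds ht x
        rw [norm_mul, Real.norm_eq_abs, abs_of_nonneg (by linarith : 0 ≤ 1 + r t x)]
        exact mul_le_mul_of_nonneg_right h2 (norm_nonneg _)
    have i1 : Integrable fun x =>
        (tderiv (fun t x => (1 + r t x) * tderiv (U i) t x) t x * tderiv (U i) t x
        + ((1 + r t x) * tderiv (U i) t x) * tderiv (tderiv (U i)) t x) :=
      integrable_add ((hr.one_add_mul hV).tderiv.integrable_mul hV ht)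
        ((hr.one_add_mul hV).integrable_mul hV.tderiv ht)
    have i2 := (hV.integrable_mul hV.lapl ht).const_mul 2
    have i3 := (hG.integrable_mul hV ht).const_mul 2
    have itr : ∀ {f : ℝ → Plane → ℝ}, Tame f → Integrable fun x =>
        (tderiv r t x * (f t x * tderiv (U i) t x)
        - (1 + r t x) * (U 0 t x * (pd 0 (f t) x * tderiv (U i) t x
            + f t x * pd 0 (tderiv (U i) t) x)
          + U 1 t x * (pd 1 (f t) x * tderiv (U i) t x + f t x * pd 1 (tderiv (U i) t) x))) := by
      intro f hf
      have j1 := hr.tderiv.integrable_mul (hf.mul hV) ht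
      have j3 : ∀ j, Integrable fun x => (1 + r t x) * (U j t x * (pd j (f t) x * tderiv (U i) t x
            + f t x * pd j (tderiv (U i) t) x)) := fun j => by
        have := (h.tame_r.one_add_mul (h.tame_U j)).integrable_mul
          (((hf.pd j).mul hV).add (hf.mul (hV.pd j))) ht
        simpa only [mul_assoc] using this
      refine (j1.sub (integrable_add (j3 0) (j3 1))).congr (Eventually.of_forall fun x => ?_)
      simp only [Pi.sub_apply]
      ring
    have e : ∀ x, (tderiv (fun t x => (1 + r t x) * tderiv (U i) t x) t x * tderiv (U i) t x
        + ((1 + r t x) * tderiv (U i) t x) * tderiv (tderiv (U i)) t x)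
        = ((2 * (tderiv (U i) t x * lapl (tderiv (U i)) t x)
            - 2 * (tderiv (G i) t x * tderiv (U i) t x))
          - (1 + r t x) * (rem U t i 0 x + rem U t i 1 x))
          - ((tderiv r t x * (tderiv (U i) t x * tderiv (U i) t x)
              - (1 + r t x) * (U 0 t x * (pd 0 (tderiv (U i) t) x * tderiv (U i) t x
                  + tderiv (U i) t x * pd 0 (tderiv (U i) t) x)
                + U 1 t x * (pd 1 (tderiv (U i) t) x * tderiv (U i) t x
                  + tderiv (U i) t x * pd 1 (tderiv (U i) t) x)))
            + 2 * (tderiv r t x * (conv U i t x * tderiv (U i) t x)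
              - (1 + r t x) * (U 0 t x * (pd 0 (conv U i t) x * tderiv (U i) t x
                  + conv U i t x * pd 0 (tderiv (U i) t) x)
                + U 1 t x * (pd 1 (conv U i t) x * tderiv (U i) t x
                  + conv U i t x * pd 1 (tderiv (U i) t) x)))) := by
      intro x
      rw [hr.tderiv_one_add_mul hV ht, h.tderiv_momentum ht i x, h.tderiv_conv ht,
        h.pd_conv ht, h.pd_conv ht, rem, rem, remTerm, remTerm, remTerm, remTerm, conv]
      ring
    have i4 : Integrable fun x => 2 * (tderiv (U i) t x * lapl (tderiv (U i)) t x)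
            - 2 * (tderiv (G i) t x * tderiv (U i) t x) := i2.sub i3
    have i5 : Integrable fun x => (2 * (tderiv (U i) t x * lapl (tderiv (U i)) t x)
            - 2 * (tderiv (G i) t x * tderiv (U i) t x))
            - (1 + r t x) * (rem U t i 0 x + rem U t i 1 x) := i4.sub iR
    simp only [e]
    rw [integral_sub i5 (integrable_add (itr hV) ((itr hc).const_mul 2)),
      integral_add (itr hV) ((itr hc).const_mul 2), integral_const_mul, tr1, tr2,
      integral_sub i4 iR, integral_sub i2 i3, integral_const_mul, integral_const_mul,
      hV.integral_mul_lapl_self ht]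
    ring
  have hp := h.integral_tderiv_pressure ht
  rw [Fin.sum_univ_two] at hp
  rw [Fin.sum_univ_two, key, key, vgrad, Fin.sum_univ_two, Fin.sum_univ_two]
  simp only [vel]
  linarith

/-! ### Estimates at a fixed time -/

theorem sqL2_le_vsq (f : Fin 2 → ℝ → Plane → ℝ) (t : ℝ) (i : Fin 2) : sqL2 (f i t) ≤ vsq f t :=
  Finset.single_le_sum (f := fun i => sqL2 (f i t)) (fun _ _ => sqL2_nonneg _) (Finset.mem_univ i)

theorem gradSqL2_le_vgrad (f : Fin 2 → ℝ → Plane → ℝ) (t : ℝ) (i : Fin 2) :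
    gradSqL2 (f i t) ≤ vgrad f t :=
  Finset.single_le_sum (f := fun i => gradSqL2 (f i t)) (fun _ _ => gradSqL2_nonneg _)
    (Finset.mem_univ i)

theorem sqL2_pd_le_vgrad (f : Fin 2 → ℝ → Plane → ℝ) (t : ℝ) (i j : Fin 2) :
    sqL2 (pd j (f i t)) ≤ vgrad f t :=
  (Finset.single_le_sum (f := fun j => sqL2 (pd j (f i t))) (fun _ _ => sqL2_nonneg _)
    (Finset.mem_univ j)).trans (gradSqL2_le_vgrad f t i)

theorem sqL2_pd_pd_le_vhess (f : Fin 2 → ℝ → Plane → ℝ) (t : ℝ) (i j k : Fin 2) :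
    sqL2 (pd j (pd k (f i t))) ≤ vhess f t := by
  have h1 : sqL2 (pd j (pd k (f i t))) ≤ ∑ k, sqL2 (pd j (pd k (f i t))) :=
    Finset.single_le_sum (f := fun k => sqL2 (pd j (pd k (f i t)))) (fun _ _ => sqL2_nonneg _)
      (Finset.mem_univ k)
  have h2 : ∑ k, sqL2 (pd j (pd k (f i t))) ≤ hessSqL2 (f i t) :=
    Finset.single_le_sum (f := fun j => ∑ k, sqL2 (pd j (pd k (f i t))))
      (fun _ _ => Finset.sum_nonneg fun _ _ => sqL2_nonneg _) (Finset.mem_univ j)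
  have h3 : hessSqL2 (f i t) ≤ vhess f t :=
    Finset.single_le_sum (f := fun i => hessSqL2 (f i t)) (fun _ _ => hessSqL2_nonneg _)
      (Finset.mem_univ i)
  exact h1.trans (h2.trans h3)

theorem gradSqL2_pd_le_vhess (f : Fin 2 → ℝ → Plane → ℝ) (t : ℝ) (i j : Fin 2) :
    gradSqL2 (pd j (f i t)) ≤ vhess f t := by
  have h2 : gradSqL2 (pd j (f i t)) ≤ hessSqL2 (f i t) := by
    rw [gradSqL2, hessSqL2, Finset.sum_comm]
    exact Finset.single_le_sum (f := fun j => ∑ k, sqL2 (pd k (pd j (f i t))))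
      (fun _ _ => Finset.sum_nonneg fun _ _ => sqL2_nonneg _) (Finset.mem_univ j)
  have h3 : hessSqL2 (f i t) ≤ vhess f t :=
    Finset.single_le_sum (f := fun i => hessSqL2 (f i t)) (fun _ _ => hessSqL2_nonneg _)
      (Finset.mem_univ i)
  exact h2.trans h3

variable {a : ℝ}

theorem normLE_U (h : System r U G) (ha : vsq U t ≤ a) (i : Fin 2) :
    NormLE (U i) t a (vgrad U t) :=
  ⟨h.tame_U i, (sqL2_le_vsq U t i).trans ha, gradSqL2_le_vgrad U t i⟩

theorem normLE_pd (h : System r U G) (i j : Fin 2) :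
    NormLE (fun t => pd j (U i t)) t (vgrad U t) (vhess U t) :=
  ⟨(h.tame_U i).pd j, sqL2_pd_le_vgrad U t i j, gradSqL2_pd_le_vhess U t i j⟩

theorem normLE_vel (h : System r U G) (ht : 0 ≤ t) (i : Fin 2) :
    NormLE (vel U i) t (4 / 3 * wsq r (vel U) t) (vgrad (vel U) t) :=
  ⟨h.tame_V i, (sqL2_le_vsq (vel U) t i).trans (h.vsq_le_wsq h.tame_V ht),
    gradSqL2_le_vgrad (vel U) t i⟩

/-- `‖u · ∇u‖²` is controlled by `‖∇u‖` and a small multiple of `‖∇²u‖²`. -/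
theorem conv_le (h : System r U G) (ht : 0 ≤ t) (ha : vsq U t ≤ a) {ε : ℝ} (hε : 0 < ε) :
    ∑ i, ∫ x, conv U i t x ^ 2 ≤ 8 * (ε * vhess U t + a * vgrad U t ^ 2 / ε) := by
  have hU := h.tame_U
  have key : ∀ i, ∫ x, conv U i t x ^ 2 ≤ 4 * (ε * vhess U t + a * vgrad U t ^ 2 / ε) := by
    intro i
    have j : ∀ j, ∫ x, (U j t x * pd j (U i t) x) ^ 2 ≤ ε * vhess U t + a * vgrad U t ^ 2 / ε :=
      fun j => integral_convection_sq_le (h.normLE_U ha j) (h.normLE_pd i j) hε ht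
    have i1 : ∀ j, Integrable fun x => 2 * (U j t x * pd j (U i t) x) ^ 2 := fun j =>
      (((hU j).mul ((hU i).pd j)).integrable_sq ht).const_mul 2
    calc ∫ x, conv U i t x ^ 2
        ≤ ∫ x, (2 * (U 0 t x * pd 0 (U i t) x) ^ 2 + 2 * (U 1 t x * pd 1 (U i t) x) ^ 2) := by
          refine integral_mono ((h.tame_conv i).integrable_sq ht)
            (integrable_add (i1 0) (i1 1)) fun x => ?_
          simp only [conv]
          nlinarith [sq_nonneg (U 0 t x * pd 0 (U i t) x - U 1 t x * pd 1 (U i t) x)]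
      _ ≤ _ := by
          rw [integral_add (i1 0) (i1 1), integral_const_mul, integral_const_mul]
          linarith [j 0, j 1]
  rw [Fin.sum_univ_two]
  linarith [key 0, key 1]

/-- The regularity estimate for the Stokes system. -/
theorem stokes_le (h : System r U G) (ht : 0 ≤ t) (ha : vsq U t ≤ a) :
    vhess U t + vsq G t ≤ 5 * wsq r (vel U) t + 2500 * (a * vgrad U t ^ 2) := by
  have key : ∀ i, hessSqL2 (U i t) + sqL2 (G i t) - 2 * ∫ x, G i t x * lapl (U i) t x
      ≤ 5 / 2 * (∫ x, ((1 + r t x) * tderiv (U i) t x) * tderiv (U i) t x)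
        + 25 / 8 * ∫ x, conv U i t x ^ 2 := by
    intro i
    have hU := h.tame_U i
    have hV := h.tame_V i
    have hG := h.tame_G i
    have hc := h.tame_conv i
    rw [hU.hessSqL2_eq ht, sqL2_real]
    have i1 := hU.lapl.integrable_sq ht
    have i2 := hG.integrable_sq ht
    have i3 := (hG.integrable_mul hU.lapl ht).const_mul 2
    have i4 := (h.integrable_rho_mul hV hV ht).const_mul (5 / 2)
    have i5 := (hc.integrable_sq ht).const_mul (25 / 8)
    rw [← integral_const_mul, ← integral_const_mul, ← integral_const_mul, ← integral_add i1 i2,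
      ← integral_sub (integrable_add i1 i2) i3, ← integral_add i4 i5]
    refine integral_mono ((integrable_add i1 i2).sub i3) (integrable_add i4 i5) fun x => ?_
    beta_reduce
    rw [h.lapl_eq ht i x]
    obtain ⟨h1, h2⟩ := h.rho_bounds ht x
    generalize 1 + r t x = R at *
    generalize tderiv (U i) t x = p
    generalize conv U i t x = q
    generalize G i t x = g
    have e1 : (R * p + R * q + g) ^ 2 + g ^ 2 - 2 * (g * (R * p + R * q + g))
        = R ^ 2 * (p + q) ^ 2 := by ring
    have e2 : R ^ 2 * p ^ 2 ≤ 5 / 4 * (R * p ^ 2) := by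
      have : 0 ≤ (5 / 4 - R) * (R * p ^ 2) :=
        mul_nonneg (by linarith) (mul_nonneg (by linarith) (sq_nonneg p))
      nlinarith
    have e3 : R ^ 2 * q ^ 2 ≤ 25 / 16 * q ^ 2 :=
      mul_le_mul_of_nonneg_right (by nlinarith) (sq_nonneg q)
    have e4 : R ^ 2 * (p + q) ^ 2 ≤ 2 * (R ^ 2 * p ^ 2) + 2 * (R ^ 2 * q ^ 2) := by
      have : 0 ≤ R ^ 2 * (p - q) ^ 2 := by positivity
      nlinarith
    rw [e1]
    linarith
  have hp := h.integral_pressure (v := fun i => lapl (U i)) (fun i => (h.tame_U i).lapl) ht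
    (h.div_lapl ht)
  have hc := h.conv_le ht ha (ε := 1 / 50) (by norm_num)
  have k0 := key 0
  have k1 := key 1
  have hd := vhess_nonneg U t
  have hg := vsq_nonneg G t
  simp only [wsq, Fin.sum_univ_two, vhess, vsq] at *
  linarith

/-- The differential inequality for `‖∇u‖²`. -/
theorem grad_deriv_le (h : System r U G) (ht : 0 ≤ t) (ha : vsq U t ≤ a) :
    ∑ p : Fin 2 × Fin 2, ∫ x, (tderiv (fun t => pd p.2 (U p.1 t)) t x * pd p.2 (U p.1 t) x
      + pd p.2 (U p.1 t) x * tderiv (fun t => pd p.2 (U p.1 t)) t x)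
      ≤ 2125 * a * vgrad U t * vgrad U t := by
  rw [h.grad_deriv ht]
  have key : ∀ i, -2 * ∫ x, ((1 + r t x) * conv U i t x) * tderiv (U i) t x
      ≤ (∫ x, ((1 + r t x) * tderiv (U i) t x) * tderiv (U i) t x)
        + 5 / 4 * ∫ x, conv U i t x ^ 2 := by
    intro i
    have hV := h.tame_V i
    have hc := h.tame_conv i
    have i1 := (h.integrable_rho_mul hc hV ht).const_mul (-2)
    have i2 := h.integrable_rho_mul hV hV ht
    have i3 := (hc.integrable_sq ht).const_mul (5 / 4)
    rw [← integral_const_mul, ← integral_const_mul, ← integral_add i2 i3]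
    refine integral_mono i1 (integrable_add i2 i3) fun x => ?_
    beta_reduce
    obtain ⟨h1, h2⟩ := h.rho_bounds ht x
    generalize 1 + r t x = R at *
    generalize tderiv (U i) t x = p
    generalize conv U i t x = q
    have e1 : 0 ≤ R * (p + q) ^ 2 := mul_nonneg (by linarith) (sq_nonneg _)
    have e2 : R * q ^ 2 ≤ 5 / 4 * q ^ 2 := mul_le_mul_of_nonneg_right h2 (sq_nonneg _)
    nlinarith
  have hs := h.stokes_le ht ha
  have hc := h.conv_le ht ha (ε := 1 / 200) (by norm_num)
  have hg := vsq_nonneg G t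
  have hy := h.wsq_nonneg h.tame_V ht
  have k0 := key 0
  have k1 := key 1
  have e : wsq r (vel U) t = (∫ x, ((1 + r t x) * tderiv (U 0) t x) * tderiv (U 0) t x)
    + ∫ x, ((1 + r t x) * tderiv (U 1) t x) * tderiv (U 1) t x := Fin.sum_univ_two _
  have hy' : 0 ≤ wsq r (vel U) t := hy
  rw [Fin.sum_univ_two] at hc ⊢
  have e2 : 2125 * a * vgrad U t * vgrad U t = 2125 * (a * vgrad U t ^ 2) := by ring
  rw [e2]
  linarith

theorem remTerm_le (h : System r U G) (ht : 0 ≤ t) (ha : vsq U t ≤ a) (i j k : Fin 2) :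
    L1LE (remTerm U t i j k)
      (3 / 50 * vgrad (vel U) t + 2000 * (a * vgrad U t * (4 / 3 * wsq r (vel U) t))
        + 4 * (vgrad U t * vhess U t)
        + 800 * (vgrad U t * (vgrad U t ^ 2 + a * vhess U t))) := by
  have hU := h.tame_U
  have hV := h.tame_V
  have t1 : L1LE (fun x => (U j t x * tderiv (U i) t x) * (pd j (U k t) x * pd k (U i t) x)) _ :=
    ⟨((hU j).mul (hV i)).integrable_mul (((hU k).pd j).mul ((hU i).pd k)) ht,
      integral_gradient_gradient_le (h.normLE_U ha j) (h.normLE_vel ht i) (h.normLE_pd k j)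
        (h.normLE_pd i k) ht⟩
  have t2 : L1LE (fun x => ((U j t x * U k t x) * tderiv (U i) t x) * pd j (pd k (U i t)) x) _ :=
    ⟨(((hU j).mul (hU k)).mul (hV i)).integrable_mul (((hU i).pd k).pd j) ht,
      integral_hessian_le (h.normLE_U ha j) (h.normLE_U ha k) (h.normLE_vel ht i)
        (((hU i).pd k).pd j) (sqL2_pd_pd_le_vhess U t i j k) ht⟩
  have t3 : L1LE (fun x => ((U j t x * U k t x) * pd k (U i t) x) * pd j (tderiv (U i) t) x) _ :=
    ⟨(((hU j).mul (hU k)).mul ((hU i).pd k)).integrable_mul ((hV i).pd j) ht,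
      integral_gradient_le (h.normLE_U ha j) (h.normLE_U ha k) (h.normLE_pd i k)
        ((hV i).pd j) (sqL2_pd_le_vgrad (vel U) t i j) ht⟩
  have := ((t1.const_mul zero_le_two).add (t2.const_mul zero_le_two)).add (t3.const_mul zero_le_two)
  exact ⟨this.1, this.2.trans (by linarith)⟩

theorem rem_le (h : System r U G) (ht : 0 ≤ t) (ha : vsq U t ≤ a) (i j : Fin 2) :
    L1LE (rem U t i j)
      (17 / 100 * vgrad (vel U) t + 2004000 * (a * vgrad U t * (4 / 3 * wsq r (vel U) t))
        + 200 * (vgrad U t * (4 / 3 * wsq r (vel U) t))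
        + 8 * (vgrad U t * vhess U t)
        + 1600 * (vgrad U t * (vgrad U t ^ 2 + a * vhess U t))) := by
  have hU := h.tame_U
  have hV := h.tame_V
  have t1 : L1LE (fun x => (U j t x * tderiv (U i) t x) * pd j (tderiv (U i) t) x) _ :=
    ⟨((hU j).mul (hV i)).integrable_mul ((hV i).pd j) ht,
      integral_convection_le (h.normLE_U ha j) (h.normLE_vel ht i) ((hV i).pd j)
        (sqL2_pd_le_vgrad (vel U) t i j) ht⟩
  have t2 : L1LE (fun x => (tderiv (U j) t x * tderiv (U i) t x) * pd j (U i t) x) _ :=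
    ⟨((hV j).mul (hV i)).integrable_mul ((hU i).pd j) ht,
      integral_stretching_le (h.normLE_vel ht j) (h.normLE_vel ht i) ((hU i).pd j)
        (sqL2_pd_le_vgrad U t i j) ht⟩
  have := ((t1.const_mul zero_le_four).add (t2.const_mul zero_le_two)).add
    ((h.remTerm_le ht ha i j 0).add (h.remTerm_le ht ha i j 1))
  exact ⟨this.1, this.2.trans (by linarith)⟩

/-- The differential inequality for `‖√ρ ∂ₜu‖²`. -/
theorem vel_deriv_le (h : System r U G) (ht : 0 ≤ t) (ha : vsq U t ≤ a) :
    ∑ i, ∫ x, (tderiv (fun t x => (1 + r t x) * tderiv (U i) t x) t x * tderiv (U i) t x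
      + ((1 + r t x) * tderiv (U i) t x) * tderiv (tderiv (U i)) t x)
      ≤ -vgrad (vel U) t
        + 10 ^ 11 * (1 + a) ^ 2 * vgrad U t * (wsq r (vel U) t + vgrad U t ^ 2) := by
  rw [h.vel_deriv ht fun i j => (h.rem_le ht ha i j).1]
  have key := fun i => (abs_le.1 (h.abs_integral_rho_mul_le
    ((h.rem_le ht ha i 0).add (h.rem_le ht ha i 1)) ht)).1
  have k0 := key 0
  have k1 := key 1
  rw [Fin.sum_univ_two]
  have hs := h.stokes_le ht ha
  have hg := vsq_nonneg G t
  have hy : 0 ≤ wsq r (vel U) t := h.wsq_nonneg h.tame_V ht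
  have hb := vgrad_nonneg U t
  have hd := vhess_nonneg U t
  have hD := vgrad_nonneg (vel U) t
  have ha0 : 0 ≤ a := (vsq_nonneg U t).trans ha
  generalize wsq r (vel U) t = y at *
  generalize vgrad U t = b at *
  generalize vhess U t = d at *
  generalize vgrad (vel U) t = D at *
  have hd' : d ≤ 5 * y + 2500 * (a * b ^ 2) := by linarith
  have b1 : b * d ≤ b * (5 * y + 2500 * (a * b ^ 2)) := mul_le_mul_of_nonneg_left hd' hb
  have b2 : a * (b * d) ≤ a * (b * (5 * y + 2500 * (a * b ^ 2))) :=
    mul_le_mul_of_nonneg_left b1 ha0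
  have p1 : 0 ≤ b * y := by positivity
  have p2 : 0 ≤ a * (b * y) := by positivity
  have p3 : 0 ≤ a ^ 2 * (b * y) := by positivity
  have p4 : 0 ≤ b ^ 3 := by positivity
  have p5 : 0 ≤ a * b ^ 3 := by positivity
  have p6 : 0 ≤ a ^ 2 * b ^ 3 := by positivity
  have e : 10 ^ 11 * (1 + a) ^ 2 * b * (y + b ^ 2)
      = 10 ^ 11 * (b * y + 2 * (a * (b * y)) + a ^ 2 * (b * y)
        + (b ^ 3 + 2 * (a * b ^ 3) + a ^ 2 * b ^ 3)) := by ring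
  rw [e]
  ring_nf at *
  linarith

/-! ### Estimates in time -/

theorem continuousOn_vgrad {f : Fin 2 → ℝ → Plane → ℝ} (hf : ∀ i, Tame (f i)) {s t : ℝ}
    (hs : 0 ≤ s) (hst : s ≤ t) : ContinuousOn (vgrad f) (Icc s t) :=
  continuousOn_finsetSum _ fun i _ => continuousOn_finsetSum _ fun j _ =>
    ((hf i).pd j).continuousOn_sqL2 hs hst

theorem continuousOn_wsq (h : System r U G) {f : Fin 2 → ℝ → Plane → ℝ} (hf : ∀ i, Tame (f i))
    {s t : ℝ} (hs : 0 ≤ s) (hst : s ≤ t) : ContinuousOn (wsq r f) (Icc s t) :=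
  continuousOn_finsetSum _ fun i _ =>
    (h.tame_r.one_add_mul (hf i)).continuousOn_integral_mul (hf i) hs hst

theorem energy_eq (h : System r U G) {s t : ℝ} (hs : 0 ≤ s) (hst : s ≤ t) :
    wsq r U t - wsq r U s = -2 * ∫ τ in s..t, vgrad U τ := by
  have := Tame.sum_integral_mul_sub (f := fun i t x => (1 + r t x) * U i t x) (g := U)
    (fun i => h.tame_r.one_add_mul (h.tame_U i)) h.tame_U hs hst
  rw [wsq, wsq, this, ← intervalIntegral.integral_const_mul]
  refine intervalIntegral.integral_congr fun τ hτ => ?_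
  rw [uIcc_of_le hst] at hτ
  exact h.energy_deriv (hs.trans hτ.1)

theorem integral_vgrad_nonneg (f : Fin 2 → ℝ → Plane → ℝ) {s t : ℝ} (hst : s ≤ t) :
    0 ≤ ∫ τ in s..t, vgrad f τ :=
  intervalIntegral.integral_nonneg hst fun τ _ => vgrad_nonneg f τ

theorem wsq_le_initial (h : System r U G) (ht : 0 ≤ t) : wsq r U t ≤ wsq r U 0 := by
  have := h.energy_eq le_rfl ht
  have := integral_vgrad_nonneg U ht
  linarith

theorem integral_vgrad_le (h : System r U G) {s t : ℝ} (hs : 0 ≤ s) (hst : s ≤ t) :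
    ∫ τ in s..t, vgrad U τ ≤ wsq r U 0 / 2 := by
  have h1 := h.energy_eq hs hst
  have h2 := h.wsq_le_initial hs
  have h3 := h.wsq_nonneg h.tame_U (hs.trans hst)
  linarith

theorem vsq_le_initial (h : System r U G) (ht : 0 ≤ t) : vsq U t ≤ 4 / 3 * wsq r U 0 := by
  have h1 := h.vsq_le_wsq h.tame_U ht
  have h2 := h.wsq_le_initial ht
  linarith

theorem sum_pd_sq (U : Fin 2 → ℝ → Plane → ℝ) (t : ℝ) :
    ∑ p : Fin 2 × Fin 2, ∫ x, pd p.2 (U p.1 t) x * pd p.2 (U p.1 t) x = vgrad U t := by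
  rw [Fintype.sum_prod_type]
  simp only [vgrad, gradSqL2, sqL2_real, sq]

/-- Propagation of `‖∇u‖²`. -/
theorem vgrad_le (h : System r U G) {s t : ℝ} (hs : 0 ≤ s) (hst : s ≤ t) :
    vgrad U t ≤ vgrad U s * Real.exp (2125 * (4 / 3 * wsq r U 0) * (wsq r U 0 / 2)) := by
  set a := 4 / 3 * wsq r U 0 with ha
  have ha0 : 0 ≤ a := mul_nonneg (by norm_num) (h.wsq_nonneg h.tame_U le_rfl)
  have hc := continuousOn_vgrad h.tame_U hs hst
  have hg := gronwall (A := fun τ => 2125 * a * vgrad U τ) (G := vgrad U) (c := vgrad U s) hst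
    (continuousOn_const.mul hc) hc
    (fun τ _ => mul_nonneg (mul_nonneg (by norm_num) ha0) (vgrad_nonneg U τ)) fun τ hτ => by
      have := Tame.sum_integral_mul_sub_le (f := fun p : Fin 2 × Fin 2 => fun t => pd p.2 (U p.1 t))
        (g := fun p : Fin 2 × Fin 2 => fun t => pd p.2 (U p.1 t))
        (fun p => (h.tame_U p.1).pd p.2) (fun p => (h.tame_U p.1).pd p.2) hs hτ.1
        (φ := fun τ => 2125 * a * vgrad U τ * vgrad U τ)
        (((continuousOn_const.mul hc).mul hc).mono (Icc_subset_Icc le_rfl hτ.2))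
        (fun σ hσ => h.grad_deriv_le (hs.trans hσ.1) (h.vsq_le_initial (hs.trans hσ.1)))
      rw [sum_pd_sq, sum_pd_sq] at this
      linarith
  refine hg.trans (mul_le_mul_of_nonneg_left (Real.exp_le_exp.2 ?_) (vgrad_nonneg U s))
  rw [intervalIntegral.integral_const_mul]
  exact mul_le_mul_of_nonneg_left (h.integral_vgrad_le hs hst)
    (mul_nonneg (by norm_num) ha0)

end System

/-- The bound for the growth of `‖∇u‖²`. -/
noncomputable def gradGrowth (E : ℝ) : ℝ := Real.exp (2125 * (4 / 3 * E) * (E / 2))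

/-- The rate of growth of `‖√ρ ∂ₜu‖²`. -/
noncomputable def velRate (E : ℝ) : ℝ := 10 ^ 11 * (1 + 4 / 3 * E) ^ 2

/-- The constant of the main estimate, as a function of the energy. -/
noncomputable def mainConst (E : ℝ) : ℝ :=
  gradGrowth E ^ 2 * ((6 + velRate E * (E / 2)) * Real.exp (velRate E * (E / 2))
    + (1 + 2500 * (4 / 3 * E)))

theorem monotoneOn_mainConst : MonotoneOn mainConst (Ici 0) := by
  intro E hE F hF hEF
  have hE : 0 ≤ E := hE
  have hF : 0 ≤ F := hF
  simp only [mainConst, gradGrowth, velRate]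
  gcongr

namespace System

variable {r : ℝ → Plane → ℝ} {U G : Fin 2 → ℝ → Plane → ℝ}

theorem main_estimate (h : System r U G) {s t : ℝ} (hs : 0 ≤ s) (hst : s ≤ t) :
    wsq r (vel U) t + vhess U t + vsq G t + (∫ τ in s..t, vgrad (vel U) τ)
      ≤ mainConst (wsq r U 0) * (wsq r (vel U) s + vgrad U s ^ 2) := by
  set E := wsq r U 0 with hE
  have hE0 : 0 ≤ E := h.wsq_nonneg h.tame_U le_rfl
  have ht : 0 ≤ t := hs.trans hst
  set κ := gradGrowth E with hκ
  have hκ1 : 1 ≤ κ := Real.one_le_exp (by positivity)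
  set C := velRate E with hC
  have hC0 : 0 ≤ C := by simp only [hC, velRate]; positivity
  set z := (vgrad U s * κ) ^ 2 with hz
  have hb0 := vgrad_nonneg U
  have hz0 : 0 ≤ z := sq_nonneg _
  have hbz : ∀ τ ∈ Icc s t, vgrad U τ ^ 2 ≤ z := fun τ hτ =>
    pow_le_pow_left₀ (hb0 τ) (h.vgrad_le hs hτ.1) 2
  have hy0 : ∀ τ ∈ Icc s t, 0 ≤ wsq r (vel U) τ := fun τ hτ =>
    h.wsq_nonneg h.tame_V (hs.trans hτ.1)
  have cb := continuousOn_vgrad h.tame_U hs hst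
  have cD : ContinuousOn (vgrad (vel U)) (Icc s t) := continuousOn_vgrad h.tame_V hs hst
  have cy : ContinuousOn (wsq r (vel U)) (Icc s t) := h.continuousOn_wsq h.tame_V hs hst
  have cA : ContinuousOn (fun τ => C * vgrad U τ) (Icc s t) := continuousOn_const.mul cb
  have cyz : ContinuousOn (fun τ => wsq r (vel U) τ + z) (Icc s t) := cy.add continuousOn_const
  have cAy : ContinuousOn (fun τ => C * vgrad U τ * (wsq r (vel U) τ + z)) (Icc s t) := cA.mul cyz
  have step : ∀ τ ∈ Icc s t, wsq r (vel U) τ + (∫ σ in s..τ, vgrad (vel U) σ)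
      ≤ wsq r (vel U) s + ∫ σ in s..τ, C * vgrad U σ * (wsq r (vel U) σ + z) := by
    intro τ hτ
    have hsub : Icc s τ ⊆ Icc s t := Icc_subset_Icc le_rfl hτ.2
    have := Tame.sum_integral_mul_sub_le (f := fun i t x => (1 + r t x) * vel U i t x)
      (g := vel U) (fun i => h.tame_r.one_add_mul (h.tame_V i)) h.tame_V hs hτ.1
      (φ := fun σ => C * vgrad U σ * (wsq r (vel U) σ + z) - vgrad (vel U) σ)
      ((cAy.sub cD).mono hsub) (fun σ hσ => by
        have hσ' := hsub hσ
        have e := h.vel_deriv_le (hs.trans hσ.1) (h.vsq_le_initial (hs.trans hσ.1))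
        refine e.trans ?_
        have e2 : C * vgrad U σ * (wsq r (vel U) σ + vgrad U σ ^ 2)
            ≤ C * vgrad U σ * (wsq r (vel U) σ + z) :=
          mul_le_mul_of_nonneg_left (by linarith [hbz σ hσ']) (mul_nonneg hC0 (hb0 σ))
        have e3 : 10 ^ 11 * (1 + 4 / 3 * wsq r U 0) ^ 2 = C := rfl
        rw [e3]
        linarith)
    rw [intervalIntegral.integral_sub ((cAy.mono hsub).intervalIntegrable_of_Icc hτ.1)
      ((cD.mono hsub).intervalIntegrable_of_Icc hτ.1)] at this
    simp only [wsq] at this ⊢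
    linarith
  have hI : ∀ τ ∈ Icc s t, ∫ σ in s..τ, C * vgrad U σ ≤ C * (E / 2) := fun τ hτ => by
    rw [intervalIntegral.integral_const_mul]
    exact mul_le_mul_of_nonneg_left (h.integral_vgrad_le hs hτ.1) hC0
  set X := Real.exp (C * (E / 2)) with hX
  have hX1 : 1 ≤ X := Real.one_le_exp (by positivity)
  set Y := wsq r (vel U) s + z with hY
  have hY0 : 0 ≤ Y := add_nonneg (hy0 s (left_mem_Icc.2 hst)) hz0
  have grow : ∀ τ ∈ Icc s t, wsq r (vel U) τ + z ≤ Y * X := by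
    intro τ hτ
    have hsub : Icc s τ ⊆ Icc s t := Icc_subset_Icc le_rfl hτ.2
    have hg := gronwall (A := fun τ => C * vgrad U τ) (G := fun τ => wsq r (vel U) τ + z) (c := Y)
      hτ.1 (cA.mono hsub) (cyz.mono hsub) (fun σ _ => mul_nonneg hC0 (hb0 σ)) fun σ hσ => by
        have := step σ (hsub hσ)
        have := integral_vgrad_nonneg (vel U) hσ.1
        linarith
    exact hg.trans (mul_le_mul_of_nonneg_left (Real.exp_le_exp.2 (hI τ hτ)) hY0)
  have last : ∫ σ in s..t, C * vgrad U σ * (wsq r (vel U) σ + z) ≤ C * (E / 2) * (Y * X) := by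
    calc _ ≤ ∫ σ in s..t, C * vgrad U σ * (Y * X) := by
          refine intervalIntegral.integral_mono_on hst (cAy.intervalIntegrable_of_Icc hst)
            ((cA.mul continuousOn_const).intervalIntegrable_of_Icc hst) fun σ hσ => ?_
          exact mul_le_mul_of_nonneg_left (grow σ hσ) (mul_nonneg hC0 (hb0 σ))
      _ ≤ C * (E / 2) * (Y * X) := by
          rw [intervalIntegral.integral_mul_const]
          exact mul_le_mul_of_nonneg_right (hI t (right_mem_Icc.2 hst)) (by positivity)
  have tt : t ∈ Icc s t := right_mem_Icc.2 hst
  have g1 := grow t tt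
  have g2 := step t tt
  have g3 := h.stokes_le ht (h.vsq_le_initial ht)
  have g4 := hbz t tt
  have hyt := hy0 t tt
  have hys := hy0 s (left_mem_Icc.2 hst)
  have g5 : 4 / 3 * E * vgrad U t ^ 2 ≤ 4 / 3 * E * z := mul_le_mul_of_nonneg_left g4 (by positivity)
  have g6 : 4 / 3 * E * z ≤ 4 / 3 * E * Y :=
    mul_le_mul_of_nonneg_left (by linarith) (by positivity)
  have hYle : Y ≤ κ ^ 2 * (wsq r (vel U) s + vgrad U s ^ 2) := by
    have : wsq r (vel U) s ≤ κ ^ 2 * wsq r (vel U) s :=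
      le_mul_of_one_le_left hys (one_le_pow₀ hκ1)
    rw [hY, hz]
    nlinarith
  set W := (6 + C * (E / 2)) * X + (1 + 2500 * (4 / 3 * E)) with hW
  have hW0 : 0 ≤ W := by positivity
  have total : wsq r (vel U) t + vhess U t + vsq G t + (∫ τ in s..t, vgrad (vel U) τ) ≤ Y * W := by
    have e : Y * W = 6 * (Y * X) + C * (E / 2) * (Y * X) + Y + 2500 * (4 / 3 * E * Y) := by
      rw [hW]; ring
    rw [e]
    linarith
  calc _ ≤ Y * W := total
    _ ≤ κ ^ 2 * (wsq r (vel U) s + vgrad U s ^ 2) * W := mul_le_mul_of_nonneg_right hYle hW0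
    _ = mainConst E * (wsq r (vel U) s + vgrad U s ^ 2) := by
        rw [mainConst, hW]; ring

end System

/-! ### Passage to coordinates -/

section Components

variable {f : ℝ → Plane → Plane} {t : ℝ}

/-- The components of a vector field. -/
def comp (f : ℝ → Plane → Plane) (i : Fin 2) (t : ℝ) (x : Plane) : ℝ := f t x i

theorem Sm.op_comp (hf : Sm f) (o : Option (Fin 2)) (ht : 0 ≤ t) (i : Fin 2) :
    INS2D.op o (comp f i) t = comp (INS2D.op o f) i t :=
  funext fun x => hf.op_clm (EuclideanSpace.proj (𝕜 := ℝ) i) o ht x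

theorem Sm.pd_comp (hf : Sm f) (j : Fin 2) (ht : 0 ≤ t) (i : Fin 2) (x : Plane) :
    pd j (f t) x i = pd j (comp f i t) x :=
  (congrFun (hf.op_comp (some j) ht i) x).symm

theorem Sm.pd_pd_comp (hf : Sm f) (j k : Fin 2) (ht : 0 ≤ t) (i : Fin 2) (x : Plane) :
    pd j (pd k (f t)) x i = pd j (pd k (comp f i t)) x := by
  have h1 := (hf.op (some k)).pd_comp j ht i x
  have h2 : comp (INS2D.op (some k) f) i t = pd k (comp f i t) :=
    (hf.op_comp (some k) ht i).symm
  rw [h2] at h1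
  exact h1

theorem norm_sq_plane (v : Plane) : ‖v‖ ^ 2 = v 0 ^ 2 + v 1 ^ 2 := by
  rw [EuclideanSpace.real_norm_sq_eq, Fin.sum_univ_two]

theorem sqL2_plane {g : Plane → Plane} (hg : ∀ i, MemLp (fun x => g x i) 2) :
    sqL2 g = ∑ i, sqL2 (fun x => g x i) := by
  simp only [Fin.sum_univ_two, sqL2_real]
  rw [← integral_add (hg 0).integrable_sq (hg 1).integrable_sq, sqL2]
  simp only [norm_sq_plane]

theorem gradSqL2_plane (hf : Sm f) (hT : ∀ i, Tame (comp f i)) (ht : 0 ≤ t) :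
    gradSqL2 (f t) = System.vgrad (comp f) t := by
  rw [System.vgrad]
  simp only [gradSqL2]
  rw [Finset.sum_comm]
  refine Finset.sum_congr rfl fun j _ => ?_
  rw [sqL2_plane]
  · simp only [hf.pd_comp j ht]
  · intro i
    simp only [hf.pd_comp j ht]
    exact ((hT i).pd j).memLp ht

theorem hessSqL2_plane (hf : Sm f) (hT : ∀ i, Tame (comp f i)) (ht : 0 ≤ t) :
    hessSqL2 (f t) = System.vhess (comp f) t := by
  have e : ∀ j k, sqL2 (pd j (pd k (f t))) = ∑ i, sqL2 (pd j (pd k (comp f i t))) := by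
    intro j k
    rw [sqL2_plane]
    · simp only [hf.pd_pd_comp j k ht]
    · intro i
      simp only [hf.pd_pd_comp j k ht]
      exact (((hT i).pd k).pd j).memLp ht
  simp only [System.vhess, hessSqL2, e, Fin.sum_univ_two]
  ring

end Components

theorem fderiv_apply_plane (g : Plane → ℝ) (x v : Plane) :
    fderiv ℝ g x v = v 0 * pd 0 g x + v 1 * pd 1 g x := by
  conv_lhs => rw [← pt_coord v, pt_eq]
  simp [pd]

theorem fderiv_apply_plane_comp (g : Plane → Plane) (x v : Plane) (i : Fin 2) :
    fderiv ℝ g x v i = v 0 * pd 0 g x i + v 1 * pd 1 g x i := by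
  conv_lhs => rw [← pt_coord v, pt_eq]
  simp [pd]

/-- A gradient is curl free. -/
theorem pd_gradient_comm {p : Plane → ℝ} (hp : Differentiable ℝ p)
    (hg : Differentiable ℝ (gradient p)) (x : Plane) :
    pd 0 (gradient p) x 1 = pd 1 (gradient p) x 0 := by
  set A : Plane →L[ℝ] (Plane →L[ℝ] ℝ) := innerSL ℝ with hA
  have h1 : ∀ y, HasFDerivAt p (A (gradient p y)) y := fun y => (hp y).hasGradientAt.hasFDerivAt
  have h2 : HasFDerivAt (fun y => A (gradient p y)) (A.comp (fderiv ℝ (gradient p) x)) x :=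
    A.hasFDerivAt.comp x (hg x).hasFDerivAt
  have := second_derivative_symmetric h1 h2 (basisVec 0) (basisVec 1)
  have e : ∀ (v : Plane) (i : Fin 2), A v (basisVec i) = v i := fun v i => by
    change inner ℝ v (basisVec i) = v i
    simp [EuclideanSpace.inner_single_right]
  simp only [ContinuousLinearMap.comp_apply, e] at this
  exact this

namespace IsSmoothSolution

variable {ρ : ℝ → Plane → ℝ} {u : ℝ → Plane → Plane} {P : ℝ → Plane → ℝ} {t : ℝ}

theorem tame_u (h : IsSmoothSolution ρ u P) (i : Fin 2) : Tame (comp u i) :=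
  h.smooth_u.tame (EuclideanSpace.proj (𝕜 := ℝ) i)

theorem tame_gradP (h : IsSmoothSolution ρ u P) (i : Fin 2) :
    Tame (comp (fun t => gradient (P t)) i) :=
  h.smooth_gradP.tame (EuclideanSpace.proj (𝕜 := ℝ) i)

theorem system (h : IsSmoothSolution ρ u P) (h0 : ∀ x, 3 / 4 ≤ ρ 0 x ∧ ρ 0 x ≤ 5 / 4) :
    System (fun t x => ρ t x - 1) (comp u) (comp fun t => gradient (P t)) where
  tame_r := h.smooth_rho.tame (ContinuousLinearMap.id ℝ ℝ)
  tame_U := h.tame_u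
  tame_G := h.tame_gradP
  mass t ht x := by
    have e := h.mass t ht x
    rw [fderiv_apply_plane] at e
    have e1 : tderiv (fun t x => ρ t x - 1) t x = tderiv ρ t x := by
      simp only [tderiv, derivWithin_sub_const_fun]
    have e2 : ∀ j, pd j (fun x => ρ t x - 1) x = pd j (ρ t) x := fun j => by
      simp only [pd, fderiv_sub_const]
    rw [e1, e2, e2]
    exact e
  momentum t ht i x := by
    have hu : Sm u := h.smooth_u.contDiffOn
    have e := congrArg (fun v : Plane => v i) (h.momentum t ht x)
    have e1 : tderiv (comp u i) t x = tderiv u t x i := congrFun (hu.op_comp none ht i) x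
    have e2 := hu.pd_pd_comp 0 0 ht i x
    have e3 := hu.pd_pd_comp 1 1 ht i x
    have e4 := hu.pd_comp 0 ht i x
    have e5 := hu.pd_comp 1 ht i x
    simp only [PiLp.add_apply, PiLp.sub_apply, PiLp.smul_apply, smul_eq_mul, PiLp.zero_apply,
      fderiv_apply_plane_comp, lap, Fin.sum_univ_two] at e
    rw [e2, e3, e4, e5] at e
    rw [e1, lapl]
    simp only [comp] at e ⊢
    linear_combination e
  div t ht x := by
    have hu : Sm u := h.smooth_u.contDiffOn
    have e := h.incompressible t ht x
    rw [divergence, Fin.sum_univ_two, hu.pd_comp 0 ht, hu.pd_comp 1 ht] at e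
    exact e
  curl t ht x := by
    have hg : Sm (fun t => gradient (P t)) := h.smooth_gradP.contDiffOn
    rw [← hg.pd_comp 0 ht, ← hg.pd_comp 1 ht]
    exact pd_gradient_comm (h.differentiable_P t ht)
      ((hg.contDiff ht).differentiable (by simp)) x
  initial_le x := by
    rw [abs_le]
    constructor <;> linarith [(h0 x).1, (h0 x).2]

theorem E0_eq (h : IsSmoothSolution ρ u P) (h0 : ∀ x, 3 / 4 ≤ ρ 0 x ∧ ρ 0 x ≤ 5 / 4) :
    E0 ρ u = System.wsq (fun t x => ρ t x - 1) (comp u) 0 := by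
  have hs := h.system h0
  have i := fun i => hs.integrable_rho_mul (hs.tame_U i) (hs.tame_U i) le_rfl
  rw [System.wsq, Fin.sum_univ_two, ← integral_add (i 0) (i 1), E0]
  congr 1
  ext x
  rw [norm_sq_plane]
  simp only [comp]
  ring

theorem sqRhoDt_eq (h : IsSmoothSolution ρ u P) (h0 : ∀ x, 3 / 4 ≤ ρ 0 x ∧ ρ 0 x ≤ 5 / 4)
    (ht : 0 ≤ t) :
    sqRhoDt ρ u t = System.wsq (fun t x => ρ t x - 1) (System.vel (comp u)) t := by
  have hs := h.system h0
  have hu : Sm u := h.smooth_u.contDiffOn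
  have i := fun i => hs.integrable_rho_mul (hs.tame_V i) (hs.tame_V i) ht
  rw [System.wsq, Fin.sum_univ_two, ← integral_add (i 0) (i 1), sqRhoDt, sqL2]
  congr 1
  ext x
  have e : ∀ i, tderiv (comp u i) t x = tderiv u t x i := fun i =>
    congrFun (hu.op_comp none ht i) x
  have hρ : 0 ≤ ρ t x := by have := (hs.rho_bounds ht x).1; linarith
  rw [norm_smul, mul_pow, Real.norm_eq_abs, sq_abs, Real.sq_sqrt hρ, norm_sq_plane, e, e]
  ring

theorem gradSqL2_tderiv (h : IsSmoothSolution ρ u P) (ht : 0 ≤ t) :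
    gradSqL2 (tderiv u t) = System.vgrad (System.vel (comp u)) t := by
  have hu : Sm u := h.smooth_u.contDiffOn
  have e : ∀ i t, 0 ≤ t → tderiv (comp u i) t = comp (tderiv u) i t := fun i t ht =>
    hu.op_comp none ht i
  have hT : ∀ i, Tame (comp (tderiv u) i) := fun i => (h.tame_u i).tderiv.congr (e i)
  rw [gradSqL2_plane (f := tderiv u) (hu.op none) hT ht]
  simp only [System.vgrad, System.vel, e _ t ht]

end IsSmoothSolution

end INS2D


theorem stmt_8 :
    ∃ C : ℝ → ℝ, Monotone C ∧
      ∀ (ρ : ℝ → INS2D.Plane → ℝ) (u : ℝ → INS2D.Plane → INS2D.Plane) (P : ℝ → INS2D.Plane → ℝ),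
        INS2D.IsSmoothSolution ρ u P →
        (∀ x, 3 / 4 ≤ ρ 0 x ∧ ρ 0 x ≤ 5 / 4) →
        ∀ t₀ : ℝ, 0 < t₀ → ∀ t : ℝ, t₀ ≤ t →
          INS2D.sqRhoDt ρ u t + INS2D.hessSqL2 (u t) + INS2D.sqL2 (gradient (P t))
              + (∫ t' in t₀..t, INS2D.gradSqL2 (INS2D.tderiv u t'))
            ≤ C (INS2D.E0 ρ u) * INS2D.E2 ρ u t₀ := by
  refine ⟨fun E => INS2D.mainConst (max E 0), fun E F hEF =>
    INS2D.monotoneOn_mainConst (mem_Ici.2 (le_max_right _ _)) (mem_Ici.2 (le_max_right _ _))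
      (max_le_max_right 0 hEF), fun ρ u P h h0 t₀ ht₀ t ht => ?_⟩
  have hs := h.system h0
  have hu : INS2D.Sm u := h.smooth_u.contDiffOn
  have ht0 : 0 ≤ t := ht₀.le.trans ht
  have hE : INS2D.E0 ρ u = _ := h.E0_eq h0
  have hE0 : 0 ≤ INS2D.E0 ρ u := hE ▸ hs.wsq_nonneg hs.tame_U le_rfl
  have hI : ∫ t' in t₀..t, INS2D.gradSqL2 (INS2D.tderiv u t')
      = ∫ t' in t₀..t, INS2D.System.vgrad (INS2D.System.vel (INS2D.comp u)) t' := by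
    refine intervalIntegral.integral_congr fun s hs => ?_
    rw [uIcc_of_le ht] at hs
    exact h.gradSqL2_tderiv (ht₀.le.trans hs.1)
  have hG : INS2D.sqL2 (gradient (P t))
      = INS2D.System.vsq (INS2D.comp fun t => gradient (P t)) t :=
    INS2D.sqL2_plane fun i => (h.tame_gradP i).memLp ht0
  rw [hI, hG, INS2D.E2, h.sqRhoDt_eq h0 ht0, h.sqRhoDt_eq h0 ht₀.le,
    INS2D.hessSqL2_plane hu h.tame_u ht0, INS2D.gradSqL2_plane hu h.tame_u ht₀.le]
  simp only [max_eq_left hE0]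
  rw [hE]
  exact hs.main_estimate ht₀.le ht
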